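/- arXiv:1910.05076 — 2 statements merged into one kernel-verified Lean document; each statement's English description precedes it below -/
import Mathlib

section
/- There exist positive constants C₀, C₁, C₂, C₃ and T₀ > 0 such that for every T ≥ T₀ there are natural numbers M, m, K₁ with M even, 2m < M and 4K₁ < M, satisfying: (i) C₀ T ≤ log M ≤ C₁ T; (ii) K₁ ≥ C₂ · (log log T)/(log log log T); (iii) r_{4,4}(m+k, M) ≤ M³/(2K₁) for all 0 ≤ k < K₁; (iv) r_{4,4}(m′, M) ≤ e^{C₃} · M³ for all m′ ∈ ℤ. -/
/-- `rmod4 m M` is the number of quadruples `(x₁,x₂,x₃,x₄) ∈ (ℤ/MΖ)⁴` with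
`x₁⁴ + x₂⁴ + x₃⁴ + x₄⁴ ≡ m (mod M)`. -/
noncomputable def rmod4 (m : ℤ) (M : ℕ) : ℕ :=
  Nat.card {x : Fin 4 → ZMod M // ∑ i, (x i) ^ 4 = (m : ZMod M)}

open ArithmeticFunction vonMangoldt DirichletCharacter in
/-- Near `s = 1` the Dirichlet series of the von Mangoldt function restricted to an invertible
residue class differs from its polar part by a bounded amount. -/
theorem abs_tsum_residueClass_sub_le {q : ℕ} [NeZero q] {a : ZMod q} (ha : IsUnit a) :
    ∃ C : ℝ, ∀ x ∈ Set.Ioc (1 : ℝ) 2,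
      |∑' n : ℕ, residueClass a n / (n : ℝ) ^ x - (q.totient : ℝ)⁻¹ / (x - 1)| ≤ C := by
  have H {x : ℝ} (hx : 1 < x) :
      ∑' n : ℕ, residueClass a n / (n : ℝ) ^ x =
        (LFunctionResidueClassAux a x).re + (q.totient : ℝ)⁻¹ / (x - 1) := by
    refine Complex.ofReal_injective ?_
    simp only [Complex.ofReal_tsum, Complex.ofReal_div, Complex.ofReal_cpow (Nat.cast_nonneg _),
      Complex.ofReal_natCast, Complex.ofReal_add, Complex.ofReal_inv, Complex.ofReal_sub,
      Complex.ofReal_one]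
    simp_rw [← LFunctionResidueClassAux_real ha hx,
      eqOn_LFunctionResidueClassAux ha <| Set.mem_ofPred.mpr (Complex.ofReal_re x ▸ hx),
      sub_add_cancel, LSeries, LSeries.term]
    refine tsum_congr fun n ↦ ?_
    split_ifs with hn
    · simp only [hn, residueClass_apply_zero, Complex.ofReal_zero, zero_div]
    · rfl
  have hcont : ContinuousOn (fun x : ℝ ↦ (LFunctionResidueClassAux a x).re) (Set.Icc 1 2) :=
    Complex.continuous_re.continuousOn.comp (t := Set.univ)
      (continuousOn_LFunctionResidueClassAux a)
      (fun _ _ ↦ trivial) |>.comp Complex.continuous_ofReal.continuousOn fun x hx ↦ by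
        simpa only [Set.mem_ofPred_eq, Complex.ofReal_re] using hx.1
  obtain ⟨C, hC⟩ := isCompact_Icc.exists_bound_of_continuousOn hcont
  refine ⟨C, fun x hx ↦ ?_⟩
  rw [H hx.1, add_sub_cancel_right]
  exact hC x (Set.Ioc_subset_Icc_self hx)

open ArithmeticFunction vonMangoldt in
theorem summable_residueClass_div_rpow {q : ℕ} (a : ZMod q) {s : ℝ} (hs : 1 < s) :
    Summable fun n : ℕ ↦ residueClass a n / (n : ℝ) ^ s :=
  LSeries.summable_real_of_abscissaOfAbsConv_lt <|
    (abscissaOfAbsConv_residueClass_le_one a).trans_lt <| mod_cast hs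

/-- A truncation inequality: outside the window `(x, x ^ 64]` the weight `n ^ (-1 - δ)` is
dominated by the weights with exponents `1 + 8 * δ` and `1 + δ / 2`. -/
theorem one_div_rpow_le_window {x n : ℕ} (hx : 2 ≤ x) (hn : 0 < n) {u : ℝ}
    (hu : u = Real.log x) :
    1 / (n : ℝ) ^ (1 + 1 / (8 * u)) ≤ (if n ∈ Finset.Ioc x (x ^ 64) then 1 / (n : ℝ) else 0) +
      Real.exp 1 * (1 / (n : ℝ) ^ (1 + 1 / u)) +
      Real.exp (-4) * (1 / (n : ℝ) ^ (1 + 1 / (16 * u))) := by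
  have hx' : (1 : ℝ) < x := by exact_mod_cast hx
  have hu0 : 0 < u := hu ▸ Real.log_pos hx'
  have hn0 : (0 : ℝ) < n := by exact_mod_cast hn
  have hln : 0 ≤ Real.log n := Real.log_natCast_nonneg n
  have key (s : ℝ) : 1 / (n : ℝ) ^ (1 + s) = 1 / (n : ℝ) * Real.exp (-(Real.log n * s)) := by
    rw [Real.rpow_add hn0, Real.rpow_one, Real.rpow_def_of_pos hn0, Real.exp_neg]
    field_simp
  rw [key, key, key]
  have hinv : 0 < 1 / (n : ℝ) := by positivity
  have h1 : Real.exp (-(Real.log n * (1 / (8 * u)))) ≤ 1 :=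
    Real.exp_le_one_iff.mpr (by have : 0 ≤ Real.log n * (1 / (8 * u)) := by positivity
                                linarith)
  have e1 := Real.exp_pos (-(Real.log n * (1 / u)))
  have e2 := Real.exp_pos (-(Real.log n * (1 / (16 * u))))
  have e3 := Real.exp_pos 1
  have e4 := Real.exp_pos (-4)
  rcases le_or_gt n x with h | h
  · have hl : Real.log n ≤ u := hu ▸ Real.log_le_log hn0 (by exact_mod_cast h)
    have : 1 ≤ Real.exp 1 * Real.exp (-(Real.log n * (1 / u))) := by
      rw [← Real.exp_add]
      apply Real.one_le_exp
      have : Real.log n * (1 / u) ≤ 1 := by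
        rw [mul_one_div, div_le_one hu0]; exact hl
      linarith
    have h0 : (0 : ℝ) ≤ if n ∈ Finset.Ioc x (x ^ 64) then 1 / (n : ℝ) else 0 := by positivity
    have := mul_le_mul_of_nonneg_left (h1.trans this) hinv.le
    have h4 : 0 ≤ Real.exp (-4) * (1 / n * Real.exp (-(Real.log n * (1 / (16 * u))))) := by
      positivity
    linarith
  rcases le_or_gt n (x ^ 64) with h' | h'
  · rw [if_pos (Finset.mem_Ioc.mpr ⟨h, h'⟩)]
    have := mul_le_mul_of_nonneg_left h1 hinv.le
    have h4 : 0 ≤ Real.exp (-4) * (1 / n * Real.exp (-(Real.log n * (1 / (16 * u))))) := by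
      positivity
    have h5 : 0 ≤ Real.exp 1 * (1 / n * Real.exp (-(Real.log n * (1 / u)))) := by
      positivity
    linarith
  · have hl : 64 * u ≤ Real.log n := by
      have : Real.log ((x : ℝ) ^ 64) ≤ Real.log n :=
        Real.log_le_log (by positivity) (by exact_mod_cast h'.le)
      rw [Real.log_pow] at this
      rw [hu]; exact_mod_cast this
    have h4 : Real.exp (-(Real.log n * (1 / (8 * u)))) ≤
        Real.exp (-4) * Real.exp (-(Real.log n * (1 / (16 * u)))) := by
      rw [← Real.exp_add]
      apply Real.exp_le_exp.mpr
      have e : Real.log n * (1 / (8 * u)) - Real.log n * (1 / (16 * u)) =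
        Real.log n / (16 * u) := by field_simp; ring
      have : 4 ≤ Real.log n / (16 * u) := by
        rw [le_div_iff₀ (by positivity)]; linarith
      linarith
    have := mul_le_mul_of_nonneg_left h4 hinv.le
    have h5 : 0 ≤ Real.exp 1 * (1 / n * Real.exp (-(Real.log n * (1 / u)))) := by
      positivity
    have h0 : (0 : ℝ) ≤ if n ∈ Finset.Ioc x (x ^ 64) then 1 / (n : ℝ) else 0 := by positivity
    linarith

open ArithmeticFunction vonMangoldt in
theorem sum_window_residueClass_lower {q : ℕ} [NeZero q] {a : ZMod q} (ha : IsUnit a) :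
    ∃ C : ℝ, ∀ x : ℕ, 3 ≤ x → (q.totient : ℝ)⁻¹ * Real.log x - C ≤
      ∑ n ∈ Finset.Ioc x (x ^ 64), residueClass a n / n := by
  obtain ⟨C, hC⟩ := abs_tsum_residueClass_sub_le ha
  refine ⟨5 * C, fun x hx ↦ ?_⟩
  set u := Real.log x with hu
  set c : ℝ := (q.totient : ℝ)⁻¹ with hc
  have hc0 : 0 ≤ c := by positivity
  have hx3 : (3 : ℝ) ≤ x := by exact_mod_cast hx
  have hu1 : 1 < u := by
    rw [hu, Real.lt_log_iff_exp_lt (by linarith)]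
    linarith [Real.exp_one_lt_d9]
  have hterm (n : ℕ) : residueClass a n / (n : ℝ) ^ (1 + 1 / (8 * u)) ≤
      (if n ∈ Finset.Ioc x (x ^ 64) then residueClass a n / (n : ℝ) else 0) +
      Real.exp 1 * (residueClass a n / (n : ℝ) ^ (1 + 1 / u)) +
      Real.exp (-4) * (residueClass a n / (n : ℝ) ^ (1 + 1 / (16 * u))) := by
    rcases n.eq_zero_or_pos with rfl | hn
    · simp
    have := mul_le_mul_of_nonneg_left (one_div_rpow_le_window (by omega : 2 ≤ x) hn hu)
      (residueClass_nonneg a n)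
    convert! this using 1
    · ring
    · split_ifs <;> ring
  have s1 : Summable fun n : ℕ ↦
      if n ∈ Finset.Ioc x (x ^ 64) then residueClass a n / (n : ℝ) else 0 :=
    summable_of_ne_finset_zero (s := Finset.Ioc x (x ^ 64)) fun n hn ↦ if_neg hn
  have hs {t : ℝ} (ht : 0 < t) := summable_residueClass_div_rpow a (s := 1 + t) (by linarith)
  have p1 : 0 < 1 / u := by positivity
  have p8 : 0 < 1 / (8 * u) := by positivity
  have p16 : 0 < 1 / (16 * u) := by positivity
  have hsum := (hs p8).tsum_le_tsum hterm
    ((s1.add ((hs p1).mul_left _)).add ((hs p16).mul_left _))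
  rw [(s1.add ((hs p1).mul_left _)).tsum_add ((hs p16).mul_left _),
    s1.tsum_add ((hs p1).mul_left _), tsum_mul_left, tsum_mul_left,
    tsum_eq_sum (s := Finset.Ioc x (x ^ 64)) (fun n hn ↦ if_neg hn),
    Finset.sum_congr rfl (fun n hn ↦ if_pos hn)] at hsum
  have q1 : 1 / u ≤ 1 := by rw [div_le_one (by positivity)]; linarith
  have q8 : 1 / (8 * u) ≤ 1 := by rw [div_le_one (by positivity)]; linarith
  have q16 : 1 / (16 * u) ≤ 1 := by rw [div_le_one (by positivity)]; linarith
  have b1 := abs_le.mp (hC (1 + 1 / u) ⟨by linarith, by linarith⟩)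
  have b8 := abs_le.mp (hC (1 + 1 / (8 * u)) ⟨by linarith, by linarith⟩)
  have b16 := abs_le.mp (hC (1 + 1 / (16 * u)) ⟨by linarith, by linarith⟩)
  have c1 : c / (1 + 1 / u - 1) = c * u := by field_simp; ring
  have c8 : c / (1 + 1 / (8 * u) - 1) = 8 * (c * u) := by field_simp; ring
  have c16 : c / (1 + 1 / (16 * u) - 1) = 16 * (c * u) := by field_simp; ring
  rw [c1] at b1
  rw [c8] at b8
  rw [c16] at b16
  have hC0 : 0 ≤ C := by linarith [b1.1, b1.2]
  have hcu : 0 ≤ c * u := by positivity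
  have he : Real.exp 1 < 3 := by linarith [Real.exp_one_lt_d9]
  have he4 : Real.exp (-4) ≤ 1 / 16 := by
    rw [Real.exp_neg, inv_eq_one_div]
    apply one_div_le_one_div_of_le (by norm_num)
    rw [show (4 : ℝ) = (4 : ℕ) * 1 by norm_num, Real.exp_nat_mul]
    calc (16 : ℝ) = 2 ^ 4 := by norm_num
      _ ≤ _ := by gcongr; linarith [Real.exp_one_gt_d9]
  have t1 := mul_le_mul he.le (sub_le_iff_le_add.mp b1.2)
    (tsum_nonneg fun n ↦ div_nonneg (residueClass_nonneg a n) (by positivity)) (by norm_num)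
  have t2 := mul_le_mul he4 (sub_le_iff_le_add.mp b16.2)
    (tsum_nonneg fun n ↦ div_nonneg (residueClass_nonneg a n) (by positivity)) (by norm_num)
  linarith [b8.1]

open ArithmeticFunction vonMangoldt in
/-- Every window `(x, x ^ 64]` with `x` large contains a positive proportion, in the sense of
`∑ 1 / p`, of primes from a given invertible residue class. -/
theorem sum_window_inv_primes_lower {q : ℕ} [NeZero q] {a : ZMod q} (ha : IsUnit a) :
    ∃ c : ℝ, 0 < c ∧ ∃ X : ℕ, ∀ x : ℕ, X ≤ x → c ≤
      ∑ p ∈ (Finset.Ioc x (x ^ 64)).filter fun p : ℕ ↦ p.Prime ∧ (p : ZMod q) = a, 1 / (p : ℝ) := by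
  obtain ⟨C, hC⟩ := sum_window_residueClass_lower ha
  have hsm := summable_residueClass_non_primes_div a
  set D := ∑' n : ℕ, (if n.Prime then 0 else residueClass a n) / (n : ℝ) with hD
  set κ : ℝ := (q.totient : ℝ)⁻¹ with hκ
  have hκ0 : 0 < κ := inv_pos.mpr (mod_cast q.totient.pos_of_neZero)
  have hlog : Filter.Tendsto (fun x : ℕ ↦ Real.log x) Filter.atTop Filter.atTop :=
    Real.tendsto_log_atTop.comp tendsto_natCast_atTop_atTop
  obtain ⟨X, hX⟩ := Filter.eventually_atTop.mp
    (hlog.eventually_ge_atTop (max 1 (2 * (C + D) / κ)))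
  refine ⟨κ / 128, by positivity, max X 3, fun x hx ↦ ?_⟩
  have hlx := hX x (le_of_max_le_left hx)
  have h3 : 3 ≤ x := le_of_max_le_right hx
  set u := Real.log x with hu
  have hu1 : 1 ≤ u := le_of_max_le_left hlx
  have hu2 : 2 * (C + D) ≤ κ * u := by
    have := (div_le_iff₀ hκ0).mp (le_of_max_le_right hlx)
    linarith
  have hsplit : ∑ n ∈ Finset.Ioc x (x ^ 64), residueClass a n / (n : ℝ) ≤ D + 64 * u *
      ∑ p ∈ (Finset.Ioc x (x ^ 64)).filter fun p : ℕ ↦ p.Prime ∧ (p : ZMod q) = a, 1 / (p : ℝ) := by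
    have hD' : ∑ n ∈ Finset.Ioc x (x ^ 64), (if n.Prime then 0 else residueClass a n) / (n : ℝ) ≤ D :=
      hsm.sum_le_tsum _ fun n _ ↦ by
        split_ifs
        · simp
        · exact div_nonneg (residueClass_nonneg a n) n.cast_nonneg
    refine le_trans ?_ (add_le_add_left hD' _)
    rw [Finset.sum_filter, Finset.mul_sum, ← Finset.sum_add_distrib]
    refine Finset.sum_le_sum fun n hn ↦ ?_
    rw [Finset.mem_Ioc] at hn
    have hn0 : (0 : ℝ) < n := by exact_mod_cast (by omega : 0 < n)
    by_cases hp : n.Prime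
    · by_cases hna : (n : ZMod q) = a
      · rw [if_pos hp, if_pos ⟨hp, hna⟩, zero_div, zero_add, mul_one_div]
        gcongr
        refine (residueClass_le a n).trans ?_
        rw [vonMangoldt_apply_prime hp]
        have : Real.log n ≤ Real.log ((x : ℝ) ^ 64) :=
          Real.log_le_log hn0 (by exact_mod_cast hn.2)
        rw [Real.log_pow] at this
        exact_mod_cast this
      · simp [hp, hna]
    · simp [hp]
  have := hC x h3
  have hu0 : 0 < u := by linarith
  by_contra! hlt
  have h64 := mul_lt_mul_of_pos_left hlt (by positivity : 0 < 64 * u)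
  nlinarith

namespace Biquadrates

section PrimeModulus

variable {p : ℕ} [Fact p.Prime]

/-- The quartic exponential sum `∑ x, ψ (t * x ^ 4)` for the standard character of `ZMod p`. -/
noncomputable def quarticSum (t : ZMod p) : ℂ := ∑ x : ZMod p, ZMod.stdAddChar (t * x ^ 4)

theorem card_mul_rmod4_eq_sum (m : ℤ) :
    (p : ℂ) * rmod4 m p = ∑ t : ZMod p, quarticSum t ^ 4 * ZMod.stdAddChar (-(t * (m : ZMod p))) := by
  have h (t : ZMod p) : quarticSum t ^ 4 * ZMod.stdAddChar (-(t * (m : ZMod p))) =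
      ∑ x : Fin 4 → ZMod p, ZMod.stdAddChar (t * (∑ j, x j ^ 4 - (m : ZMod p))) := by
    rw [quarticSum, Fintype.sum_pow, Finset.sum_mul]
    refine Finset.sum_congr rfl fun x _ ↦ ?_
    rw [mul_sub, sub_eq_add_neg, AddChar.map_add_eq_mul, Finset.mul_sum]
    simp only [Fin.sum_univ_four, Fin.prod_univ_four, AddChar.map_add_eq_mul]
  simp_rw [h]
  rw [Finset.sum_comm]
  simp_rw [AddChar.sum_mulShift _ (ZMod.isPrimitive_stdAddChar p), sub_eq_zero, ZMod.card]
  push_cast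
  rw [← Finset.sum_filter, Finset.sum_const, nsmul_eq_mul, rmod4, Nat.card_eq_fintype_card,
    Fintype.card_subtype, mul_comm]

theorem conj_quarticSum (t : ZMod p) : (starRingEnd ℂ) (quarticSum t) = quarticSum (-t) := by
  simp only [quarticSum, map_sum, ← AddChar.map_neg_eq_conj, neg_mul]

theorem quarticSum_mul_pow (t : ZMod p) {u : ZMod p} (hu : u ≠ 0) :
    quarticSum (t * u ^ 4) = quarticSum t := by
  refine Fintype.sum_equiv (Equiv.mulLeft₀ u hu) _ _ fun x ↦ ?_
  simp only [Equiv.mulLeft₀_apply, mul_pow, mul_assoc]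

theorem quarticSum_zero : quarticSum (0 : ZMod p) = p := by
  simp [quarticSum]

/-- Modulo a prime `p ≡ 5 (mod 8)` the square roots of `-1` are non-squares. -/
theorem exists_sq_eq_neg_one_not_isSquare (hp : p % 8 = 5) :
    ∃ i : ZMod p, i ^ 2 = -1 ∧ ¬ IsSquare i := by
  obtain ⟨i, hi⟩ := (ZMod.exists_sq_eq_neg_one_iff (p := p)).mpr (by omega)
  refine ⟨i, by rw [hi, sq], ?_⟩
  rintro ⟨w, rfl⟩
  have : Fact (2 < p) := ⟨by have := (Fact.out : p.Prime).two_le; omega⟩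
  have hw4 : w ^ 4 = -1 := by rw [hi]; ring
  have h8 : orderOf w = 2 ^ (2 + 1) := by
    apply orderOf_eq_prime_pow
    · norm_num [hw4, ZMod.neg_one_ne_one]
    · rw [show (2 : ℕ) ^ (2 + 1) = 4 * 2 by norm_num, pow_mul, hw4]; norm_num
  have hw0 : w ≠ 0 := by rintro rfl; norm_num at hw4
  have := ZMod.orderOf_dvd_card_sub_one hw0
  rw [h8] at this
  omega

theorem isSquare_mul_of_not_isSquare {a b : ZMod p} (ha : ¬ IsSquare a) (hb : ¬ IsSquare b) :
    IsSquare (a * b) := by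
  have h0 : a * b ≠ 0 := mul_ne_zero (by rintro rfl; simp at ha) (by rintro rfl; simp at hb)
  rw [← quadraticChar_one_iff_isSquare h0, map_mul,
    quadraticChar_neg_one_iff_not_isSquare.mpr ha, quadraticChar_neg_one_iff_not_isSquare.mpr hb]
  norm_num

theorem sum_sq_eq (hp2 : p ≠ 2) (g : ZMod p → ℂ) :
    ∑ x, g (x ^ 2) = ∑ y, g y * ((quadraticChar (ZMod p) y : ℤ) + 1 : ℂ) := by
  rw [← Finset.sum_fiberwise Finset.univ (fun x : ZMod p ↦ x ^ 2) (fun x ↦ g (x ^ 2))]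
  refine Finset.sum_congr rfl fun y _ ↦ ?_
  have h := quadraticChar_card_sqrts (by rwa [ZMod.ringChar_zmod_n]) y
  have hc : (((quadraticChar (ZMod p) y : ℤ) : ℂ) + 1) =
      ((Finset.univ.filter fun x : ZMod p ↦ x ^ 2 = y).card : ℂ) := by
    have h' := congrArg (fun z : ℤ ↦ (z : ℂ)) h
    push_cast at h'
    rw [← h']
    congr 2
    ext; simp
  rw [hc, Finset.sum_congr rfl (g := fun _ ↦ g y) (fun x hx ↦ by
    rw [(Finset.mem_filter.mp hx).2]), Finset.sum_const, nsmul_eq_mul, mul_comm]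

theorem sum_sq_add_sum_mul_sq (hp2 : p ≠ 2) {ν : ZMod p} (hν : ¬ IsSquare ν) (g : ZMod p → ℂ) :
    ∑ x, g (x ^ 2) + ∑ x, g (ν * x ^ 2) = 2 * ∑ y, g y := by
  have hν0 : ν ≠ 0 := by rintro rfl; simp at hν
  have h2 : ∑ x, g (ν * x ^ 2) = ∑ y, g y * (1 - (quadraticChar (ZMod p) y : ℤ) : ℂ) := by
    rw [sum_sq_eq hp2 fun y ↦ g (ν * y)]
    refine Fintype.sum_equiv (Equiv.mulLeft₀ ν hν0) _ _ fun x ↦ ?_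
    rw [Equiv.mulLeft₀_apply, map_mul, quadraticChar_neg_one_iff_not_isSquare.mpr hν]
    push_cast
    ring
  rw [sum_sq_eq hp2, h2, ← Finset.sum_add_distrib, Finset.mul_sum]
  exact Finset.sum_congr rfl fun y _ ↦ by ring

/-- For `p ≡ 5 (mod 8)` the real part of the quartic sum is the quadratic Gauss sum. -/
theorem re_quarticSum_sq (hp : p % 8 = 5) {t : ZMod p} (ht : t ≠ 0) :
    (quarticSum t).re ^ 2 = p := by
  have hp2 : p ≠ 2 := by rintro rfl; omega
  obtain ⟨i, hi, hisq⟩ := exists_sq_eq_neg_one_not_isSquare hp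
  set χ : MulChar (ZMod p) ℂ := (quadraticChar (ZMod p)).ringHomComp (Int.castRingHom ℂ) with hχ
  set ψ : AddChar (ZMod p) ℂ := ZMod.stdAddChar.mulShift t with hψ
  have hψ1 : ψ ≠ 1 := ZMod.isPrimitive_stdAddChar p ht
  have hgauss : gaussSum χ ψ ^ 2 = p := by
    rw [gaussSum_sq _ ((quadraticChar_isQuadratic (ZMod p)).comp _)
      (AddChar.IsPrimitive.of_ne_one hψ1), ZMod.card]
    · have : IsSquare (-1 : ZMod p) := ⟨i, by rw [← hi, sq]⟩
      rw [MulChar.ringHomComp_apply,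
        (quadraticChar_one_iff_isSquare (neg_ne_zero.mpr one_ne_zero)).mpr this]
      simp
    · exact (MulChar.ringHomComp_ne_one_iff (RingHom.injective_int _)).mpr
        (quadraticChar_ne_one (by rwa [ZMod.ringChar_zmod_n]))
  have hsum : quarticSum t + quarticSum (-t) = 2 * gaussSum χ ψ := by
    have h1 : quarticSum t + quarticSum (-t) =
        ∑ x, ψ ((x ^ 2) ^ 2) + ∑ x, ψ ((i * x ^ 2) ^ 2) := by
      simp only [quarticSum, hψ, AddChar.mulShift_apply]
      congr 1 <;> refine Finset.sum_congr rfl fun x _ ↦ ?_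
      · congr 1; ring
      · congr 1; rw [mul_pow, hi]; ring
    rw [h1, sum_sq_add_sum_mul_sq hp2 hisq fun y ↦ ψ (y ^ 2), sum_sq_eq hp2, gaussSum]
    congr 1
    simp only [mul_add, mul_one, Finset.sum_add_distrib, AddChar.sum_eq_zero_of_ne_one hψ1,
      add_zero]
    exact Finset.sum_congr rfl fun x _ ↦ by simp [hχ, mul_comm]
  rw [← conj_quarticSum, Complex.add_conj] at hsum
  have h := congrArg (· ^ 2) hsum
  simp only [mul_pow, hgauss] at h
  have : ((4 * (quarticSum t).re ^ 2 : ℝ) : ℂ) = ((4 * p : ℝ) : ℂ) := by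
    push_cast
    push_cast at h
    linear_combination h
  have := Complex.ofReal_injective this
  linarith

theorem card_fourth_pow_eq (hp : p % 8 = 5) :
    ((Finset.univ.filter fun z : ZMod p × ZMod p ↦ z.1 ^ 4 = z.2 ^ 4).card : ℝ) =
      1 + 4 * (p - 1) := by
  obtain ⟨i, hi, hisq⟩ := exists_sq_eq_neg_one_not_isSquare hp
  have : Fact (2 < p) := ⟨by have := (Fact.out : p.Prime).two_le; omega⟩
  have hi0 : i ≠ 0 := by rintro rfl; simp at hisq
  have h2 : (2 : ZMod p) ≠ 0 := by
    have := ZMod.neg_one_ne_one (n := p)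
    intro h
    apply this
    linear_combination -h
  have hi1 : i ≠ 1 := by rintro rfl; simp at hisq
  have hi1' : i ≠ -1 := by
    rintro rfl
    apply h2
    linear_combination hi
  have hcard (y : ZMod p) : (Finset.univ.filter fun x : ZMod p ↦ x ^ 4 = y ^ 4).card =
      if y = 0 then 1 else 4 := by
    split_ifs with hy
    · rw [Finset.card_eq_one]
      refine ⟨0, ?_⟩
      ext x
      simp [hy]
    · rw [show (Finset.univ.filter fun x : ZMod p ↦ x ^ 4 = y ^ 4) = {y, -y, i * y, -(i * y)} by
        ext x
        simp only [Finset.mem_filter, Finset.mem_univ, true_and, Finset.mem_insert,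
          Finset.mem_singleton]
        rw [← sub_eq_zero, show x ^ 4 - y ^ 4 = (x - y) * (x + y) * ((x - i * y) * (x + i * y)) by
          linear_combination (y ^ 2 * x ^ 2 - y ^ 4) * hi]
        simp only [mul_eq_zero, sub_eq_zero, add_eq_zero_iff_eq_neg, or_assoc]]
      have hyn : ∀ z : ZMod p, z ≠ 0 → z ≠ -z := fun z hz h ↦
        mul_ne_zero h2 hz (by linear_combination h)
      have e1 := hyn y hy
      have e2 := hyn (i * y) (mul_ne_zero hi0 hy)
      have e3 : y ≠ i * y := fun h ↦ hi1 (mul_right_cancel₀ hy (by linear_combination -h))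
      have e4 : y ≠ -(i * y) := fun h ↦ hi1' (mul_right_cancel₀ hy (by linear_combination h))
      have e5 : -y ≠ i * y := fun h ↦ e4 (by linear_combination -h)
      have e6 : -y ≠ -(i * y) := fun h ↦ e3 (by linear_combination -h)
      rw [Finset.card_insert_of_notMem, Finset.card_insert_of_notMem, Finset.card_pair e2] <;>
        simp_all
  have : (Finset.univ.filter fun z : ZMod p × ZMod p ↦ z.1 ^ 4 = z.2 ^ 4).card =
      ∑ y : ZMod p, if y = 0 then 1 else 4 := by
    rw [Finset.card_filter, Fintype.sum_prod_type, Finset.sum_comm]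
    refine Finset.sum_congr rfl fun y _ ↦ ?_
    rw [← hcard y, Finset.card_filter]
  rw [this, ← Finset.add_sum_erase _ _ (Finset.mem_univ 0), if_pos rfl,
    Finset.sum_congr rfl (g := fun _ ↦ 4) (fun y hy ↦ if_neg (Finset.ne_of_mem_erase hy)),
    Finset.sum_const, Finset.card_erase_of_mem (Finset.mem_univ _), Finset.card_univ, ZMod.card,
    nsmul_eq_mul, Nat.cast_id, Nat.cast_add, Nat.cast_mul, Nat.cast_sub (Fact.out : p.Prime).one_le]
  push_cast
  ring

theorem sum_normSq_quarticSum (hp : p % 8 = 5) :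
    ∑ t ∈ Finset.univ.erase (0 : ZMod p), Complex.normSq (quarticSum t) = 3 * p * (p - 1) := by
  have h : ((∑ t : ZMod p, Complex.normSq (quarticSum t) : ℝ) : ℂ) =
      ((p * (1 + 4 * (p - 1)) : ℝ) : ℂ) := by
    have h1 (t : ZMod p) : (Complex.normSq (quarticSum t) : ℂ) =
        ∑ z : ZMod p × ZMod p, ZMod.stdAddChar (t * (z.1 ^ 4 - z.2 ^ 4)) := by
      rw [← Complex.mul_conj, conj_quarticSum, quarticSum, quarticSum, Finset.sum_mul_sum,
        Fintype.sum_prod_type]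
      refine Finset.sum_congr rfl fun x _ ↦ Finset.sum_congr rfl fun y _ ↦ ?_
      rw [← AddChar.map_add_eq_mul]
      congr 1; ring
    push_cast
    simp_rw [h1]
    rw [Finset.sum_comm]
    simp_rw [AddChar.sum_mulShift _ (ZMod.isPrimitive_stdAddChar p), sub_eq_zero, ZMod.card]
    push_cast
    rw [← Finset.sum_filter, Finset.sum_const, nsmul_eq_mul, mul_comm]
    congr 1
    have hc := congrArg (fun z : ℝ ↦ (z : ℂ)) (card_fourth_pow_eq hp)
    push_cast at hc
    exact hc
  have h := Complex.ofReal_injective h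
  rw [← Finset.add_sum_erase _ _ (Finset.mem_univ 0), quarticSum_zero, Complex.normSq_natCast] at h
  linear_combination h

theorem normSq_quarticSum_mul_sq (hp : p % 8 = 5) (t : ZMod p) {s : ZMod p} (hs : s ≠ 0) :
    Complex.normSq (quarticSum (t * s ^ 2)) = Complex.normSq (quarticSum t) := by
  obtain ⟨i, hi, hisq⟩ := exists_sq_eq_neg_one_not_isSquare hp
  by_cases h : IsSquare s
  · obtain ⟨u, rfl⟩ := h
    have hu : u ≠ 0 := left_ne_zero_of_mul hs
    rw [show t * (u * u) ^ 2 = t * u ^ 4 by ring, quarticSum_mul_pow t hu]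
  · obtain ⟨u, hu⟩ := isSquare_mul_of_not_isSquare hisq h
    have hi0 : i ≠ 0 := by rintro rfl; simp at hisq
    have hu0 : u ≠ 0 := by rintro rfl; simp_all
    rw [show t * s ^ 2 = (-t) * u ^ 4 by
      linear_combination t * s ^ 2 * hi - t * (i * s + u * u) * hu,
      quarticSum_mul_pow _ hu0, ← conj_quarticSum, Complex.normSq_conj]

theorem normSq_quarticSum_add (hp : p % 8 = 5) {i : ZMod p} (hi : i ^ 2 = -1)
    (hisq : ¬ IsSquare i) {t : ZMod p} (ht : t ≠ 0) :
    Complex.normSq (quarticSum t) + Complex.normSq (quarticSum (i * t)) = 6 * p := by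
  have hi0 : i ≠ 0 := by rintro rfl; simp at hisq
  have hconst (t : ZMod p) (ht : t ≠ 0) :
      Complex.normSq (quarticSum t) + Complex.normSq (quarticSum (i * t)) =
      Complex.normSq (quarticSum (1 : ZMod p)) + Complex.normSq (quarticSum i) := by
    by_cases h : IsSquare t
    · obtain ⟨s, rfl⟩ := h
      have hs : s ≠ 0 := left_ne_zero_of_mul ht
      rw [← normSq_quarticSum_mul_sq hp 1 hs, ← normSq_quarticSum_mul_sq hp i hs, one_mul, sq]
    · obtain ⟨s, hs⟩ := isSquare_mul_of_not_isSquare hisq h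
      have hs0 : s ≠ 0 := by rintro rfl; simp_all
      have e : t = -i * (s * s) := by linear_combination t * hi - i * hs
      rw [hs, e, ← sq, normSq_quarticSum_mul_sq hp _ hs0, ← conj_quarticSum, Complex.normSq_conj,
        ← one_mul (s ^ 2), normSq_quarticSum_mul_sq hp _ hs0, add_comm]
  have hsum : ∑ t ∈ Finset.univ.erase (0 : ZMod p), Complex.normSq (quarticSum (i * t)) =
      ∑ t ∈ Finset.univ.erase (0 : ZMod p), Complex.normSq (quarticSum t) := by
    refine Finset.sum_equiv (Equiv.mulLeft₀ i hi0) (fun t ↦ ?_) (fun t _ ↦ rfl)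
    simp [hi0]
  have h1 := Finset.sum_congr (rfl : Finset.univ.erase (0 : ZMod p) = _)
    fun t ht ↦ hconst t (Finset.ne_of_mem_erase ht)
  rw [Finset.sum_add_distrib, hsum, sum_normSq_quarticSum hp, Finset.sum_const,
    Finset.card_erase_of_mem (Finset.mem_univ _), Finset.card_univ, ZMod.card, nsmul_eq_mul,
    Nat.cast_sub (Fact.out : p.Prime).one_le, Nat.cast_one] at h1
  rw [hconst t ht]
  have hp1 : (0 : ℝ) < p - 1 := by
    have : (1 : ℝ) < p := by exact_mod_cast (Fact.out : p.Prime).one_lt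
    linarith
  refine mul_left_cancel₀ hp1.ne' ?_
  linear_combination -h1

theorem normSq_quarticSum_le (hp : p % 8 = 5) {t : ZMod p} (ht : t ≠ 0) :
    Complex.normSq (quarticSum t) ≤ 5 * p := by
  obtain ⟨i, hi, hisq⟩ := exists_sq_eq_neg_one_not_isSquare hp
  have hi0 : i ≠ 0 := by rintro rfl; simp at hisq
  have h := normSq_quarticSum_add hp hi hisq ht
  have h2 := re_quarticSum_sq hp (mul_ne_zero hi0 ht)
  rw [Complex.normSq_apply (quarticSum (i * t))] at h
  nlinarith [mul_self_nonneg (quarticSum (i * t)).im]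

theorem re_quarticSum_pow_four_add_le (hp : p % 8 = 5) {i : ZMod p} (hi : i ^ 2 = -1)
    (hisq : ¬ IsSquare i) {t : ZMod p} (ht : t ≠ 0) :
    (quarticSum t ^ 4).re + (quarticSum (i * t) ^ 4).re ≤ -6 * (p : ℝ) ^ 2 := by
  have hi0 : i ≠ 0 := by rintro rfl; simp at hisq
  have h := normSq_quarticSum_add hp hi hisq ht
  have h1 := re_quarticSum_sq hp ht
  have h2 := re_quarticSum_sq hp (mul_ne_zero hi0 ht)
  have hre (z : ℂ) : (z ^ 4).re = (z.re ^ 2) ^ 2 - 6 * z.re ^ 2 * z.im ^ 2 + (z.im ^ 2) ^ 2 := by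
    simp only [pow_succ, pow_zero, one_mul, Complex.mul_re, Complex.mul_im]
    ring
  rw [Complex.normSq_apply, Complex.normSq_apply, ← sq, ← sq, ← sq, ← sq, h1, h2] at h
  rw [hre, hre, h1, h2]
  have hA : (quarticSum t).im ^ 2 = 4 * p - (quarticSum (i * t)).im ^ 2 := by linarith
  have hA0 := sq_nonneg (quarticSum t).im
  have hB0 := sq_nonneg (quarticSum (i * t)).im
  nlinarith [mul_nonneg hA0 hB0]

theorem card_erase_zero : ((Finset.univ.erase (0 : ZMod p)).card : ℝ) = p - 1 := by
  rw [Finset.card_erase_of_mem (Finset.mem_univ _), Finset.card_univ, ZMod.card,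
    Nat.cast_sub (Fact.out : p.Prime).one_le, Nat.cast_one]

/-- The residue class `0` modulo `p ≡ 5 (mod 8)` is under-represented by sums of four
biquadrates. -/
theorem rmod4_le_of_dvd (hp : p % 8 = 5) {m : ℤ} (hm : (p : ℤ) ∣ m) :
    (rmod4 m p : ℝ) ≤ (p : ℝ) ^ 3 - 3 * p * (p - 1) := by
  obtain ⟨i, hi, hisq⟩ := exists_sq_eq_neg_one_not_isSquare hp
  have hi0 : i ≠ 0 := by rintro rfl; simp at hisq
  have hp0 : (0 : ℝ) < p := by exact_mod_cast (Fact.out : p.Prime).pos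
  have h := congrArg Complex.re (card_mul_rmod4_eq_sum (p := p) m)
  have hm0 : (m : ZMod p) = 0 := (ZMod.intCast_zmod_eq_zero_iff_dvd m p).mpr hm
  simp only [hm0, mul_zero, neg_zero, AddChar.map_zero_eq_one, mul_one] at h
  rw [← Finset.add_sum_erase _ _ (Finset.mem_univ 0), quarticSum_zero, Complex.add_re,
    Complex.re_sum] at h
  have hsum : ∑ t ∈ Finset.univ.erase (0 : ZMod p), (quarticSum (i * t) ^ 4).re =
      ∑ t ∈ Finset.univ.erase (0 : ZMod p), (quarticSum t ^ 4).re := by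
    refine Finset.sum_equiv (Equiv.mulLeft₀ i hi0) (fun t ↦ ?_) (fun t _ ↦ rfl)
    simp [hi0]
  have hle := Finset.sum_le_sum fun t (ht : t ∈ Finset.univ.erase (0 : ZMod p)) ↦
    re_quarticSum_pow_four_add_le hp hi hisq (Finset.ne_of_mem_erase ht)
  rw [Finset.sum_add_distrib, hsum, Finset.sum_const, nsmul_eq_mul, card_erase_zero] at hle
  have e1 : ((p : ℂ) * (rmod4 m p : ℂ)).re = p * rmod4 m p := by
    exact_mod_cast Complex.ofReal_re ((p : ℝ) * rmod4 m p)
  have e2 : ((p : ℂ) ^ 4).re = (p : ℝ) ^ 4 := by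
    exact_mod_cast Complex.ofReal_re ((p : ℝ) ^ 4)
  rw [e1, e2] at h
  refine le_of_mul_le_mul_left ?_ hp0
  rw [h]
  linarith

theorem rmod4_le_of_not_dvd (hp : p % 8 = 5) {m : ℤ} (hm : ¬ (p : ℤ) ∣ m) :
    (rmod4 m p : ℝ) ≤ (p : ℝ) ^ 3 + 25 * p * (√(5 * p) + 1) := by
  have hp0 : (0 : ℝ) < p := by exact_mod_cast (Fact.out : p.Prime).pos
  have hp1 : (0 : ℝ) < p - 1 := by
    have : (1 : ℝ) < p := by exact_mod_cast (Fact.out : p.Prime).one_lt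
    linarith
  have hm0 : (m : ZMod p) ≠ 0 := fun h ↦ hm ((ZMod.intCast_zmod_eq_zero_iff_dvd m p).mp h)
  set E : Finset (ZMod p) := Finset.univ.erase 0 with hE
  set R := ∑ t ∈ E, quarticSum t ^ 4 * ZMod.stdAddChar (-(t * (m : ZMod p))) with hR
  have havg : ((p : ℂ) - 1) * R =
      ∑ t ∈ E, quarticSum t ^ 4 * (quarticSum (-(t * (m : ZMod p))) - 1) := by
    have h1 (u : ZMod p) (hu : u ∈ E) : R = ∑ t ∈ E, quarticSum t ^ 4 *
        ZMod.stdAddChar (-(t * (m : ZMod p)) * u ^ 4) := by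
      have hu0 : u ≠ 0 := Finset.ne_of_mem_erase hu
      symm
      refine Finset.sum_equiv (Equiv.mulRight₀ (u ^ 4) (pow_ne_zero 4 hu0)) (fun t ↦ ?_)
        (fun t _ ↦ ?_)
      · simp [hE, hu0]
      · rw [Equiv.mulRight₀_apply, quarticSum_mul_pow t hu0]
        congr 2; ring
    have h2 : ∑ u ∈ E, R = ((p : ℂ) - 1) * R := by
      rw [Finset.sum_const, nsmul_eq_mul]
      congr 1
      exact_mod_cast congrArg (fun z : ℝ ↦ (z : ℂ)) (card_erase_zero (p := p))
    rw [← h2, Finset.sum_congr rfl h1, Finset.sum_comm]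
    refine Finset.sum_congr rfl fun t _ ↦ ?_
    have e : quarticSum (-(t * (m : ZMod p))) =
        1 + ∑ u ∈ E, ZMod.stdAddChar (-(t * (m : ZMod p)) * u ^ 4) := by
      rw [quarticSum, hE, ← Finset.add_sum_erase _ _ (Finset.mem_univ 0)]
      simp
    rw [← Finset.mul_sum, e, add_sub_cancel_left]
  have hS {t : ZMod p} (ht : t ≠ 0) : ‖quarticSum t‖ ≤ √(5 * p) := by
    apply Real.le_sqrt_of_sq_le
    rw [← Complex.normSq_eq_norm_sq]
    exact normSq_quarticSum_le hp ht
  have hRle : ‖R‖ ≤ 25 * p ^ 2 * (√(5 * p) + 1) := by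
    have : (p - 1) * ‖R‖ ≤ (p - 1) * (25 * p ^ 2 * (√(5 * p) + 1)) := by
      have hn : ‖((p : ℂ) - 1)‖ = p - 1 := by
        rw [show (p : ℂ) - 1 = ((p - 1 : ℝ) : ℂ) by push_cast; ring, Complex.norm_real,
          Real.norm_of_nonneg hp1.le]
      calc (p - 1) * ‖R‖ = ‖((p : ℂ) - 1) * R‖ := by rw [norm_mul, hn]
        _ ≤ ∑ t ∈ E, 25 * p ^ 2 * (√(5 * p) + 1) := by
          rw [havg]
          refine norm_sum_le_of_le _ fun t ht ↦ ?_
          have ht0 : t ≠ 0 := Finset.ne_of_mem_erase ht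
          rw [norm_mul, norm_pow]
          refine mul_le_mul ?_ ?_ (norm_nonneg _) (by positivity)
          · calc ‖quarticSum t‖ ^ 4 ≤ √(5 * p) ^ 4 := by gcongr; exact hS ht0
              _ = (√(5 * p) ^ 2) ^ 2 := by ring
              _ = 25 * p ^ 2 := by rw [Real.sq_sqrt (by positivity)]; ring
          · refine (norm_sub_le _ _).trans ?_
            rw [norm_one]
            gcongr
            exact hS (neg_ne_zero.mpr (mul_ne_zero ht0 hm0))
        _ = _ := by rw [Finset.sum_const, nsmul_eq_mul, card_erase_zero]
    exact le_of_mul_le_mul_left this hp1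
  have h := card_mul_rmod4_eq_sum (p := p) m
  rw [← Finset.add_sum_erase _ _ (Finset.mem_univ 0), quarticSum_zero, zero_mul, neg_zero,
    AddChar.map_zero_eq_one, mul_one, ← hE, ← hR] at h
  have h' := congrArg norm h
  rw [norm_mul, Complex.norm_natCast, Complex.norm_natCast] at h'
  have h2 := norm_add_le ((p : ℂ) ^ 4) R
  rw [norm_pow, Complex.norm_natCast, ← h'] at h2
  refine le_of_mul_le_mul_left ?_ hp0
  linarith

/-- The uniform bound for the number of representations modulo a prime `p ≡ 5 (mod 8)`. -/
theorem rmod4_prime_le (hp : p % 8 = 5) (m : ℤ) :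
    (rmod4 m p : ℝ) ≤ (p : ℝ) ^ 3 * (1 + 100 * (1 / (p : ℝ) ^ (3 / 2 : ℝ))) := by
  have hp1 : (1 : ℝ) ≤ p := by exact_mod_cast (Fact.out : p.Prime).one_le
  have hp0 : (0 : ℝ) < p := by linarith
  by_cases hm : (p : ℤ) ∣ m
  · have h := rmod4_le_of_dvd hp hm
    have : 0 ≤ (p : ℝ) ^ 3 * (100 * (1 / (p : ℝ) ^ (3 / 2 : ℝ))) := by positivity
    nlinarith
  · refine (rmod4_le_of_not_dvd hp hm).trans ?_
    have e : (p : ℝ) ^ 3 * (1 / (p : ℝ) ^ (3 / 2 : ℝ)) = p * √p := by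
      rw [show (3 / 2 : ℝ) = 1 + 1 / 2 by norm_num, Real.rpow_add hp0, Real.rpow_one,
        ← Real.sqrt_eq_rpow]
      have h0 : 0 < √(p : ℝ) := Real.sqrt_pos.mpr hp0
      field_simp
      rw [Real.sq_sqrt hp0.le]
    have h5 : √(5 * p) ≤ 3 * √(p : ℝ) := by
      rw [Real.sqrt_mul (by norm_num)]
      gcongr
      rw [Real.sqrt_le_left (by norm_num)]
      norm_num
    have h1 : 1 ≤ √(p : ℝ) := Real.one_le_sqrt.mpr hp1
    rw [mul_add ((p : ℝ) ^ 3), mul_one, mul_left_comm _ (100 : ℝ), e]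
    nlinarith

theorem rmod4_prime_le_of_dvd (hp : p % 8 = 5) {m : ℤ} (hm : (p : ℤ) ∣ m) :
    (rmod4 m p : ℝ) ≤ (p : ℝ) ^ 3 * (1 - 1 / p) := by
  have hp2 : (2 : ℝ) ≤ p := by exact_mod_cast (Fact.out : p.Prime).two_le
  refine (rmod4_le_of_dvd hp hm).trans ?_
  have e : (p : ℝ) ^ 3 * (1 - 1 / p) = p ^ 3 - p ^ 2 := by field_simp
  rw [e]
  nlinarith

end PrimeModulus

theorem rmod4_mul {a b : ℕ} (h : a.Coprime b) (m : ℤ) :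
    rmod4 m (a * b) = rmod4 m a * rmod4 m b := by
  rw [rmod4, rmod4, rmod4, ← Nat.card_prod]
  let e := ZMod.chineseRemainder h
  have he (x : Fin 4 → ZMod (a * b)) : ∑ i, x i ^ 4 = (m : ZMod (a * b)) ↔
      ∑ i, (e (x i)).1 ^ 4 = (m : ZMod a) ∧ ∑ i, (e (x i)).2 ^ 4 = (m : ZMod b) := by
    rw [← e.injective.eq_iff, map_sum, map_intCast, Prod.ext_iff]
    simp [Prod.fst_sum, Prod.snd_sum]
  refine Nat.card_congr
    { toFun := fun x ↦ (⟨fun i ↦ (e (x.1 i)).1, ((he x.1).mp x.2).1⟩,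
        ⟨fun i ↦ (e (x.1 i)).2, ((he x.1).mp x.2).2⟩)
      invFun := fun y ↦ ⟨fun i ↦ e.symm (y.1.1 i, y.2.1 i), (he _).mpr
        ⟨by simpa using y.1.2, by simpa using y.2.2⟩⟩
      left_inv := fun x ↦ by ext; simp
      right_inv := fun y ↦ by ext <;> simp }

theorem rmod4_one (m : ℤ) : rmod4 m 1 = 1 := by
  rw [rmod4, Nat.card_eq_one_iff_unique]
  exact ⟨⟨fun x y ↦ Subtype.ext (Subsingleton.elim _ _)⟩, ⟨⟨0, Subsingleton.elim _ _⟩⟩⟩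

theorem rmod4_prod_primes {S : Finset ℕ} (hS : ∀ p ∈ S, p.Prime) (m : ℤ) :
    rmod4 m (∏ p ∈ S, p) = ∏ p ∈ S, rmod4 m p := by
  induction S using Finset.induction_on with
  | empty => simp [rmod4_one]
  | insert a s ha ih =>
    rw [Finset.prod_insert ha, Finset.prod_insert ha, rmod4_mul, ih fun p hp ↦
      hS p (Finset.mem_insert_of_mem hp)]
    refine Nat.Coprime.prod_right fun p hp ↦ ?_
    rw [Nat.coprime_primes (hS a (Finset.mem_insert_self a s))
      (hS p (Finset.mem_insert_of_mem hp))]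
    rintro rfl
    exact ha hp

/-- The trivial bound: three of the variables determine the fourth up to four choices. -/
theorem rmod4_le_four_mul {q : ℕ} (hq : q.Prime) (m : ℤ) : rmod4 m q ≤ 4 * q ^ 3 := by
  have : Fact q.Prime := ⟨hq⟩
  rw [rmod4, Nat.card_eq_fintype_card, Fintype.card_subtype]
  set A : Finset (Fin 4 → ZMod q) := Finset.univ.filter fun x ↦ ∑ i, x i ^ 4 = (m : ZMod q)
  have hA : A.card ≤ 4 * (A.image fun x : Fin 4 → ZMod q ↦ Fin.tail x).card := by
    refine Finset.card_le_mul_card_image _ _ fun y _ ↦ ?_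
    have hroots : (Polynomial.nthRoots 4 ((m : ZMod q) - ∑ i, y i ^ 4)).toFinset.card ≤ 4 :=
      (Multiset.toFinset_card_le _).trans (Polynomial.card_nthRoots _ _)
    refine le_trans (Finset.card_le_card_of_injOn (fun x ↦ x 0) ?_ ?_) hroots
    · intro x hx
      simp only [A, Finset.coe_filter, Finset.mem_filter, Finset.mem_univ, true_and,
        Set.mem_ofPred_eq] at hx
      rw [Finset.mem_coe, Multiset.mem_toFinset, Polynomial.mem_nthRoots (by norm_num), ← hx.1,
        ← hx.2, Fin.sum_univ_succ]
      simp [Fin.tail]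
    · intro x hx x' hx' h
      simp only [A, Finset.coe_filter, Finset.mem_filter, Finset.mem_univ, true_and,
        Set.mem_ofPred_eq] at hx hx'
      rw [← Fin.cons_self_tail x, ← Fin.cons_self_tail x', hx.2, hx'.2]
      simp only at h
      rw [h]
  refine hA.trans (Nat.mul_le_mul_left 4 ((Finset.card_le_univ _).trans ?_))
  simp [ZMod.card]

theorem rmod4_two_le (m : ℤ) : rmod4 m 2 ≤ 16 := by
  rw [rmod4, Nat.card_eq_fintype_card]
  exact (Fintype.card_subtype_le _).trans (by simp)

/-- Bounds the Euler product of the local factors `1 + 100 / p ^ (3 / 2)`. -/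
noncomputable def eulerBound : ℝ := ∑' n : ℕ, 100 * (1 / (n : ℝ) ^ (3 / 2 : ℝ))

theorem sum_le_eulerBound (S : Finset ℕ) :
    ∑ p ∈ S, 100 * (1 / (p : ℝ) ^ (3 / 2 : ℝ)) ≤ eulerBound :=
  ((Real.summable_one_div_nat_rpow.mpr (by norm_num)).mul_left 100).sum_le_tsum S
    fun n _ ↦ by positivity

theorem rmod4_modulus_le {S D : Finset ℕ} (hS : ∀ p ∈ S, p.Prime ∧ p % 8 = 5) (hD : D ⊆ S)
    {q : ℕ} (hq : q.Prime) (hq2 : q ≠ 2) (hqS : q ∉ S) {m : ℤ} (hm : ∀ p ∈ D, (p : ℤ) ∣ m) :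
    (rmod4 m (2 * q * ∏ p ∈ S, p) : ℝ) ≤ 8 * Real.exp (eulerBound - ∑ p ∈ D, 1 / (p : ℝ)) *
      ((2 * q * ∏ p ∈ S, p : ℕ) : ℝ) ^ 3 := by
  have hc1 : Nat.Coprime 2 q := (Nat.coprime_primes Nat.prime_two hq).mpr hq2.symm
  have hc2 : Nat.Coprime (2 * q) (∏ p ∈ S, p) := by
    refine Nat.Coprime.prod_right fun p hp ↦ Nat.Coprime.mul_left ?_ ?_
    · rw [Nat.coprime_primes Nat.prime_two (hS p hp).1]
      rintro rfl
      exact absurd (hS 2 hp).2 (by norm_num)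
    · rw [Nat.coprime_primes hq (hS p hp).1]
      rintro rfl
      exact hqS hp
  rw [rmod4_mul hc2, rmod4_mul hc1, rmod4_prod_primes fun p hp ↦ (hS p hp).1]
  have hprod : ∏ p ∈ S, (rmod4 m p : ℝ) ≤
      ∏ p ∈ S, ((p : ℝ) ^ 3 * Real.exp (100 * (1 / (p : ℝ) ^ (3 / 2 : ℝ)) -
        if p ∈ D then 1 / (p : ℝ) else 0)) := by
    refine Finset.prod_le_prod (fun p _ ↦ Nat.cast_nonneg _) fun p hp ↦ ?_
    have : Fact p.Prime := ⟨(hS p hp).1⟩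
    have h0 : 0 ≤ 100 * (1 / (p : ℝ) ^ (3 / 2 : ℝ)) := by positivity
    split_ifs with h
    · refine (rmod4_prime_le_of_dvd (hS p hp).2 (hm p h)).trans ?_
      gcongr
      have h1 := Real.add_one_le_exp (-(1 / (p : ℝ)))
      have h2 := Real.exp_le_exp.mpr (by linarith : -(1 / (p : ℝ)) ≤
        100 * (1 / (p : ℝ) ^ (3 / 2 : ℝ)) - 1 / p)
      linarith
    · refine (rmod4_prime_le (hS p hp).2 m).trans ?_
      gcongr
      rw [sub_zero, add_comm]
      exact Real.add_one_le_exp _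
  rw [Finset.prod_mul_distrib, Finset.prod_pow, ← Real.exp_sum, Finset.sum_sub_distrib,
    ← Finset.sum_filter, Finset.filter_mem_eq_inter, Finset.inter_eq_right.mpr hD] at hprod
  have hexp := Real.exp_le_exp.mpr (sub_le_sub_right (sum_le_eulerBound S) (∑ p ∈ D, 1 / (p : ℝ)))
  have h2 : (rmod4 m 2 : ℝ) ≤ 16 := by exact_mod_cast rmod4_two_le m
  have h3 : (rmod4 m q : ℝ) ≤ 4 * q ^ 3 := by exact_mod_cast rmod4_le_four_mul hq m
  push_cast
  calc (rmod4 m 2 : ℝ) * rmod4 m q * ∏ p ∈ S, (rmod4 m p : ℝ)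
      ≤ 16 * (4 * q ^ 3) * ((∏ p ∈ S, (p : ℝ)) ^ 3 *
        Real.exp (eulerBound - ∑ p ∈ D, 1 / (p : ℝ))) := by
        gcongr
        exact hprod.trans (by gcongr)
    _ = _ := by ring

/-- Given disjoint blocks `Q k` of primes, some `m` has `m + k` divisible by all primes
of the block `Q k`, simultaneously for all `k < K`. -/
theorem exists_dvd_add_of_blocks {K : ℕ} {Q : ℕ → Finset ℕ}
    (hQ : ∀ k < K, ∀ p ∈ Q k, p.Prime)
    (hdisj : ((Finset.range K : Finset ℕ) : Set ℕ).PairwiseDisjoint Q) :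
    ∃ m < ∏ p ∈ (Finset.range K).biUnion Q, p, ∀ k < K, ∀ p ∈ Q k, p ∣ m + k := by
  set S := (Finset.range K).biUnion Q with hS
  have hSp : ∀ p ∈ S, p.Prime := fun p hp ↦ by
    obtain ⟨k, hk, hpk⟩ := Finset.mem_biUnion.mp hp
    exact hQ k (Finset.mem_range.mp hk) p hpk
  have hblock (p : ℕ) : ∃ j, ∀ k < K, p ∈ Q k → k = j := by
    by_cases h : ∃ j < K, p ∈ Q j
    · obtain ⟨j, hj, hpj⟩ := h
      refine ⟨j, fun k hk hpk ↦ ?_⟩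
      by_contra hne
      exact Finset.disjoint_left.mp (hdisj (by simpa using hk) (by simpa using hj) hne) hpk hpj
    · exact ⟨0, fun k hk hpk ↦ absurd ⟨k, hk, hpk⟩ h⟩
  choose κ hκ using hblock
  have hne : ∀ p ∈ S, p ≠ 0 := fun p hp ↦ (hSp p hp).ne_zero
  have hco : Set.Pairwise (S : Set ℕ) (Function.onFun Nat.Coprime fun p : ℕ ↦ p) :=
    fun p hp r hr hpr ↦ (Nat.coprime_primes (hSp p hp) (hSp r hr)).mpr hpr
  refine ⟨Nat.chineseRemainderOfFinset (fun p ↦ (p - 1) * κ p) (fun p ↦ p) S hne hco,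
    Nat.chineseRemainderOfFinset_lt_prod _ _ hne hco, fun k hk p hp ↦ ?_⟩
  have hpS : p ∈ S := Finset.mem_biUnion.mpr ⟨k, Finset.mem_range.mpr hk, hp⟩
  have h := (Nat.chineseRemainderOfFinset (fun p ↦ (p - 1) * κ p) (fun p ↦ p) S hne hco).2 p hpS
  rw [← hκ p k hk hp] at h
  refine (Nat.modEq_zero_iff_dvd).mp ((h.add_right k).trans (Nat.modEq_zero_iff_dvd.mpr ?_))
  have h1 : p - 1 + 1 = p := Nat.succ_pred_eq_of_pos (hSp p hpS).pos
  exact ⟨k, by rw [← Nat.succ_mul, Nat.succ_eq_add_one, h1]⟩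

/-- The primes congruent to `5` modulo `8` in the interval `(a, b]`. -/
def primeWindow (a b : ℕ) : Finset ℕ :=
  (Finset.Ioc a b).filter fun p ↦ p.Prime ∧ (p : ZMod 8) = 5

theorem mod_eight_of_mem_primeWindow {a b p : ℕ} (hp : p ∈ primeWindow a b) : p % 8 = 5 := by
  have h := (Finset.mem_filter.mp hp).2.2
  rwa [show (5 : ZMod 8) = (5 : ℕ) from rfl, ZMod.natCast_eq_natCast_iff'] at h

theorem disjoint_primeWindow {a b c d : ℕ} (h : b ≤ c) :
    Disjoint (primeWindow a b) (primeWindow c d) := by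
  refine Finset.disjoint_left.mpr fun p hp hp' ↦ ?_
  have h1 := (Finset.mem_Ioc.mp (Finset.mem_filter.mp hp).1).2
  have h2 := (Finset.mem_Ioc.mp (Finset.mem_filter.mp hp').1).1
  omega

theorem tower_mono {X i j : ℕ} (hX : 1 ≤ X) (h : i ≤ j) : X ^ 64 ^ i ≤ X ^ 64 ^ j :=
  Nat.pow_le_pow_right hX (Nat.pow_le_pow_right (by norm_num) h)

/-- The sum of the reciprocals of the primes congruent to `5` modulo `8` between two terms of the
tower `X ^ 64 ^ j` grows at least linearly in the number of steps. -/
theorem exists_mul_le_sum_primeWindow : ∃ c : ℝ, 0 < c ∧ ∃ X : ℕ, 3 ≤ X ∧ ∀ i n : ℕ,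
    n * c ≤ ∑ p ∈ primeWindow (X ^ 64 ^ i) (X ^ 64 ^ (i + n)), 1 / (p : ℝ) := by
  obtain ⟨c, hc, X, hX⟩ := sum_window_inv_primes_lower (q := 8) (a := 5) (by decide)
  refine ⟨c, hc, max X 3, le_max_right _ _, fun i n ↦ ?_⟩
  set Y := max X 3
  have hY : 1 ≤ Y := le_trans (by norm_num) (le_max_right X 3)
  induction n with
  | zero =>
    rw [Nat.cast_zero, zero_mul]
    exact Finset.sum_nonneg fun p _ ↦ by positivity
  | succ n ih =>
    have hstep := hX (Y ^ 64 ^ (i + n))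
      ((le_max_left X 3).trans (Nat.le_self_pow (by positivity) Y))
    rw [← pow_mul, ← pow_succ] at hstep
    have hsub : primeWindow (Y ^ 64 ^ i) (Y ^ 64 ^ (i + n)) ∪
        primeWindow (Y ^ 64 ^ (i + n)) (Y ^ 64 ^ (i + n + 1)) ⊆
        primeWindow (Y ^ 64 ^ i) (Y ^ 64 ^ (i + n + 1)) :=
      Finset.union_subset
        (Finset.filter_subset_filter _
          (Finset.Ioc_subset_Ioc_right (tower_mono hY (Nat.le_succ _))))
        (Finset.filter_subset_filter _
          (Finset.Ioc_subset_Ioc_left (tower_mono hY (Nat.le_add_right i n))))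
    calc ((n + 1 : ℕ) : ℝ) * c = n * c + c := by push_cast; ring
      _ ≤ _ := add_le_add ih hstep
      _ = _ := (Finset.sum_union (disjoint_primeWindow le_rfl)).symm
      _ ≤ _ := Finset.sum_le_sum_of_subset_of_nonneg hsub fun p _ _ ↦ by positivity

/-- Disjoint blocks of primes give a modulus of size about `exp T` with few representations
along a run of residues. -/
theorem exists_modulus_of_blocks {T : ℝ} (hT : 2 ≤ T) {K : ℕ} (hK : (K : ℝ) ≤ T)
    {Q : ℕ → Finset ℕ} (hQ : ∀ k < K, ∀ p ∈ Q k, p.Prime ∧ p % 8 = 5 ∧ (p : ℝ) ≤ T)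
    (hdisj : ((Finset.range K : Finset ℕ) : Set ℕ).PairwiseDisjoint Q) :
    ∃ M m : ℕ, Even M ∧ 2 * m < M ∧ 4 * K < M ∧ T ≤ Real.log M ∧ Real.log M ≤ 10 * T ∧
      (∀ k < K, (rmod4 ((m : ℤ) + (k : ℤ)) M : ℝ) ≤
        8 * Real.exp (eulerBound - ∑ p ∈ Q k, 1 / (p : ℝ)) * (M : ℝ) ^ 3) ∧
      ∀ m' : ℤ, (rmod4 m' M : ℝ) ≤ Real.exp (eulerBound + 3) * (M : ℝ) ^ 3 := by
  obtain ⟨m, hm, hdvd⟩ := exists_dvd_add_of_blocks (fun k hk p hp ↦ (hQ k hk p hp).1) hdisj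
  set S := (Finset.range K).biUnion Q with hSdef
  have hS : ∀ p ∈ S, p.Prime ∧ p % 8 = 5 ∧ (p : ℝ) ≤ T := fun p hp ↦ by
    obtain ⟨k, hk, hpk⟩ := Finset.mem_biUnion.mp hp
    exact hQ k (Finset.mem_range.mp hk) p hpk
  have hS' : ∀ p ∈ S, p.Prime ∧ p % 8 = 5 := fun p hp ↦ ⟨(hS p hp).1, (hS p hp).2.1⟩
  set n := ⌈Real.exp T⌉₊
  have hn : Real.exp T ≤ n := Nat.le_ceil _
  have hn' : (n : ℝ) < Real.exp T + 1 := Nat.ceil_lt_add_one (Real.exp_pos T).le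
  have hTexp : T + 1 ≤ Real.exp T := Real.add_one_le_exp T
  have hn0 : n ≠ 0 := fun h ↦ by rw [h, Nat.cast_zero] at hn; linarith
  obtain ⟨q, hq, hnq, hqn⟩ := Nat.exists_prime_lt_and_le_two_mul n hn0
  have hqT : Real.exp T < q := hn.trans_lt (by exact_mod_cast hnq)
  have hq4 : (q : ℝ) ≤ 4 * Real.exp T := by
    have : (q : ℝ) ≤ 2 * n := by exact_mod_cast hqn
    linarith
  have hq2 : q ≠ 2 := by
    rintro rfl
    norm_num at hqT
    linarith
  have hqS : q ∉ S := fun h ↦ by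
    have := (hS q h).2.2
    linarith
  set P := ∏ p ∈ S, p with hP
  have hPpos : 1 ≤ P := Finset.prod_pos fun p hp ↦ (hS p hp).1.pos
  have hP1 : (1 : ℝ) ≤ P := by exact_mod_cast hPpos
  have hP4 : (P : ℝ) ≤ 4 ^ T := by
    have hle : P ≤ primorial ⌊T⌋₊ := by
      refine Finset.prod_le_prod_of_subset_of_one_le' (fun p hp ↦ ?_) fun p hp _ ↦
        (Finset.mem_filter.mp hp).2.pos
      exact Finset.mem_filter.mpr ⟨Finset.mem_range.mpr
        (Nat.lt_succ_of_le (Nat.le_floor (hS p hp).2.2)), (hS p hp).1⟩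
    calc (P : ℝ) ≤ (4 : ℝ) ^ ⌊T⌋₊ := by exact_mod_cast hle.trans (primorial_le_four_pow _)
      _ = (4 : ℝ) ^ (⌊T⌋₊ : ℝ) := (Real.rpow_natCast _ _).symm
      _ ≤ 4 ^ T := Real.rpow_le_rpow_of_exponent_le (by norm_num) (Nat.floor_le (by linarith))
  have hMcast : ((2 * q * P : ℕ) : ℝ) = 2 * q * P := by push_cast; rfl
  have hlow : 2 * Real.exp T < ((2 * q * P : ℕ) : ℝ) := by
    rw [hMcast]
    nlinarith [Real.exp_pos T]
  have hl2 : Real.log 2 < 1 := by linarith [Real.log_two_lt_d9]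
  refine ⟨2 * q * P, m, ⟨q * P, by ring⟩, ?_, ?_, ?_, ?_, fun k hk ↦ ?_, fun m' ↦ ?_⟩
  · have := hq.one_lt
    nlinarith
  · have hK' : (4 * K : ℝ) < ((2 * q * P : ℕ) : ℝ) := by
      have h := Real.quadratic_le_exp_of_nonneg (by linarith : 0 ≤ T)
      nlinarith
    exact_mod_cast hK'
  · rw [Real.le_log_iff_exp_le (by linarith [Real.exp_pos T])]
    linarith [Real.exp_pos T]
  · have hup : ((2 * q * P : ℕ) : ℝ) ≤ 8 * Real.exp T * 4 ^ T := by
      calc ((2 * q * P : ℕ) : ℝ) = 2 * q * P := hMcast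
        _ ≤ 2 * (4 * Real.exp T) * 4 ^ T := by gcongr
        _ = 8 * Real.exp T * 4 ^ T := by ring
    refine (Real.log_le_log (by linarith [Real.exp_pos T]) hup).trans ?_
    rw [Real.log_mul (by positivity) (by positivity), Real.log_mul (by norm_num) (by positivity),
      Real.log_exp, Real.log_rpow (by norm_num), show (8 : ℝ) = 2 ^ 3 by norm_num,
      show (4 : ℝ) = 2 ^ 2 by norm_num, Real.log_pow, Real.log_pow]
    push_cast
    nlinarith
  · refine rmod4_modulus_le hS' (Finset.subset_biUnion_of_mem Q (Finset.mem_range.mpr hk))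
      hq hq2 hqS fun p hp ↦ ?_
    exact_mod_cast hdvd k hk p hp
  · refine (rmod4_modulus_le hS' (Finset.empty_subset S) hq hq2 hqS
      (by simp : ∀ p ∈ (∅ : Finset ℕ), (p : ℤ) ∣ m')).trans ?_
    gcongr
    rw [Finset.sum_empty, sub_zero, Real.exp_add, mul_comm]
    gcongr
    have h : Real.exp 3 = Real.exp 1 ^ 3 := by rw [← Real.exp_nat_mul]; norm_num
    rw [h]
    have h2 : (2 : ℝ) ≤ Real.exp 1 := by linarith [Real.add_one_le_exp (1 : ℝ)]
    calc (8 : ℝ) = 2 ^ 3 := by norm_num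
      _ ≤ _ := by gcongr

/-- The choice of the number `K` of blocks and of the number `L` of tower steps in each block. -/
theorem eventually_exists_block_parameters {c : ℝ} (hc : 0 < c) {X : ℕ} (hX : 3 ≤ X) (B : ℝ) :
    ∀ᶠ T : ℝ in Filter.atTop, ∃ K L : ℕ,
      c / 80 * (Real.log (Real.log T) / Real.log (Real.log (Real.log T))) ≤ K ∧ (K : ℝ) ≤ T ∧
      ((X ^ 64 ^ (K * L) : ℕ) : ℝ) ≤ T ∧ 8 * Real.exp (B - L * c) ≤ 1 / (2 * (K : ℝ)) := by
  have hlog := Real.tendsto_log_atTop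
  have hW := hlog.comp hlog
  filter_upwards [Filter.eventually_ge_atTop 1, hlog.eventually_ge_atTop 1,
    hW.eventually_ge_atTop (16 * Real.exp B),
    hW.eventually_ge_atTop (2 * Real.log (Real.log X)),
    hW.eventually_ge_atTop 1,
    (hlog.comp hW).eventually_ge_atTop (c / 40),
    (hlog.comp hW).eventually_ge_atTop (c / 2),
    hW.eventually (Real.isLittleO_log_id_atTop.def (by positivity : 0 < c / 80))]
    with T hT1 hT2 h1 h2 h3 h4 h5 h6
  simp only [Function.comp_apply] at h1 h2 h3 h4 h5 h6
  rw [Real.norm_eq_abs, id_eq,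
    Real.norm_of_nonneg (by linarith : 0 ≤ Real.log (Real.log T))] at h6
  set W := Real.log (Real.log T) with hWdef
  set ℓ := Real.log W with hℓ
  have hW0 : 0 < W := by linarith
  have hℓ0 : 0 < ℓ := by linarith
  set κ := c / 80 * (W / ℓ) with hκ
  have hκ1 : 1 ≤ κ := by
    rw [hκ, mul_div_assoc', one_le_div hℓ0]
    exact (le_abs_self ℓ).trans h6
  have hK : (⌈κ⌉₊ : ℝ) ≤ 2 * κ := by linarith [Nat.ceil_lt_add_one (by linarith : 0 ≤ κ)]
  have hcℓ : 1 ≤ 2 * ℓ / c := by rw [le_div_iff₀ hc]; linarith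
  have hL : (⌈2 * ℓ / c⌉₊ : ℝ) ≤ 4 * ℓ / c := by
    have := Nat.ceil_lt_add_one (by linarith : 0 ≤ 2 * ℓ / c)
    have : 4 * ℓ / c = 2 * ℓ / c + 2 * ℓ / c := by ring
    linarith
  have hKW : (⌈κ⌉₊ : ℝ) ≤ W := by
    refine hK.trans ?_
    rw [hκ, ← mul_assoc, mul_div_assoc', div_le_iff₀ hℓ0]
    nlinarith
  have hK0 : 0 < ⌈κ⌉₊ := Nat.ceil_pos.mpr (by linarith)
  have hTlog : 0 < Real.log T := by linarith
  refine ⟨⌈κ⌉₊, ⌈2 * ℓ / c⌉₊, Nat.le_ceil _, ?_, ?_, ?_⟩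
  · linarith [Real.log_le_sub_one_of_pos hTlog,
      Real.log_le_sub_one_of_pos (by linarith : 0 < T)]
  · have hKL : (⌈κ⌉₊ : ℝ) * ⌈2 * ℓ / c⌉₊ ≤ W / 10 := by
      calc (⌈κ⌉₊ : ℝ) * ⌈2 * ℓ / c⌉₊ ≤ (2 * κ) * (4 * ℓ / c) := by gcongr
        _ = W / 10 := by rw [hκ]; field_simp; norm_num
    have hX1 : 1 < (X : ℝ) := by exact_mod_cast (by omega : 1 < X)
    have hlogX : 0 < Real.log X := Real.log_pos hX1
    have h64 : Real.log 64 ≤ 5 := by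
      rw [show (64 : ℝ) = 2 ^ 6 by norm_num, Real.log_pow]
      push_cast
      linarith [Real.log_two_lt_d9]
    push_cast
    rw [← Real.log_le_log_iff (by positivity) (by linarith), Real.log_pow,
      ← Real.log_le_log_iff (by positivity) hTlog, Real.log_mul (by positivity) (by positivity)]
    push_cast
    rw [Real.log_pow]
    push_cast
    have : (⌈κ⌉₊ : ℝ) * ⌈2 * ℓ / c⌉₊ * Real.log 64 ≤ W / 10 * 5 := by gcongr
    linarith
  · have hLc : 2 * ℓ ≤ ⌈2 * ℓ / c⌉₊ * c := (div_le_iff₀ hc).mp (Nat.le_ceil _)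
    have hexp : Real.exp (B - ⌈2 * ℓ / c⌉₊ * c) ≤ Real.exp B / W ^ 2 := by
      calc Real.exp (B - ⌈2 * ℓ / c⌉₊ * c) ≤ Real.exp (B - 2 * ℓ) := by gcongr
        _ = Real.exp B / W ^ 2 := by
          rw [Real.exp_sub, hℓ, ← Real.exp_log (pow_pos hW0 2), Real.log_pow]
          norm_num
    have hKpos : (0 : ℝ) < ⌈κ⌉₊ := by exact_mod_cast hK0
    calc 8 * Real.exp (B - ⌈2 * ℓ / c⌉₊ * c) ≤ 8 * (Real.exp B / W ^ 2) := by gcongr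
      _ ≤ 1 / (2 * (⌈κ⌉₊ : ℝ)) := by
        rw [mul_div_assoc', div_le_div_iff₀ (by positivity) (by positivity)]
        calc 8 * Real.exp B * (2 * (⌈κ⌉₊ : ℝ)) = 16 * Real.exp B * ⌈κ⌉₊ := by ring
          _ ≤ W * W := by gcongr
          _ = 1 * W ^ 2 := by ring

end Biquadrates

/-- Key input from Waring's problem for fourth powers: existence of moduli `M`
with long runs of residues having few representations as sums of four fourth
powers. -/
theorem waring_biquadrates_modular_gaps :
    ∃ C₀ C₁ C₂ C₃ T₀ : ℝ, 0 < C₀ ∧ 0 < C₁ ∧ 0 < C₂ ∧ 0 < C₃ ∧ 0 < T₀ ∧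
      ∀ T : ℝ, T₀ ≤ T →
        ∃ M m K₁ : ℕ, Even M ∧ 2 * m < M ∧ 4 * K₁ < M ∧
          (C₀ * T ≤ Real.log M ∧ Real.log M ≤ C₁ * T) ∧
          C₂ * (Real.log (Real.log T) / Real.log (Real.log (Real.log T))) ≤ (K₁ : ℝ) ∧
          (∀ k < K₁, (rmod4 ((m : ℤ) + (k : ℤ)) M : ℝ) ≤
            (M : ℝ) ^ 3 / (2 * (K₁ : ℝ))) ∧
          (∀ m' : ℤ, (rmod4 m' M : ℝ) ≤ Real.exp C₃ * (M : ℝ) ^ 3) := by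
  obtain ⟨c, hc, X, hX, hsum⟩ := Biquadrates.exists_mul_le_sum_primeWindow
  obtain ⟨T₁, hT₁⟩ := Filter.eventually_atTop.mp
    (Biquadrates.eventually_exists_block_parameters hc hX Biquadrates.eulerBound)
  have hE : 0 ≤ Biquadrates.eulerBound := by simpa using Biquadrates.sum_le_eulerBound ∅
  refine ⟨1, 10, c / 80, Biquadrates.eulerBound + 3, max T₁ 2, one_pos, by norm_num, by positivity,
    by positivity, by positivity, fun T hT ↦ ?_⟩
  obtain ⟨K, L, hKlow, hKT, hXT, hexp⟩ := hT₁ T ((le_max_left _ _).trans hT)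
  have hX1 : 1 ≤ X := by omega
  obtain ⟨M, m, hM, hmM, hKM, hlow, hup, hgap, htriv⟩ :=
    Biquadrates.exists_modulus_of_blocks ((le_max_right _ _).trans hT) hKT
      (Q := fun k ↦ Biquadrates.primeWindow (X ^ 64 ^ (k * L)) (X ^ 64 ^ (k * L + L)))
      (fun k hk p hp ↦ by
        have hp' := Finset.mem_filter.mp hp
        refine ⟨hp'.2.1, Biquadrates.mod_eight_of_mem_primeWindow hp, le_trans ?_ hXT⟩
        refine Nat.cast_le.mpr ((Finset.mem_Ioc.mp hp'.1).2.trans ?_)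
        exact Biquadrates.tower_mono hX1 (by nlinarith))
      (fun i _ j _ hij ↦ by
        rcases lt_or_gt_of_ne hij with h | h
        · exact Biquadrates.disjoint_primeWindow (Biquadrates.tower_mono hX1 (by nlinarith))
        · exact (Biquadrates.disjoint_primeWindow
            (Biquadrates.tower_mono hX1 (by nlinarith))).symm)
  refine ⟨M, m, K, hM, hmM, hKM, ⟨by rwa [one_mul], hup⟩, hKlow, fun k hk ↦ ?_, htriv⟩
  calc _ ≤ _ := hgap k hk
    _ ≤ 1 / (2 * (K : ℝ)) * (M : ℝ) ^ 3 := by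
      gcongr
      refine le_trans ?_ hexp
      gcongr
      exact hsum _ L
    _ = (M : ℝ) ^ 3 / (2 * K) := by ring
end

section
/- There exists a constant c₄ > 0 with the following property. Let q ≥ 2 be an integer, let θ₄(q) := Σ_{n=0}^∞ q^{-n⁴}, let A > 1.1 be a real number, and let α₀, α₁, α₂, α₃, α₄ be integers with |α_j| ≤ q^A for all j and α₄ ≠ 0. Then |α₀ + α₁·θ₄(q) + α₂·θ₄(q)² + α₃·θ₄(q)³ + α₄·θ₄(q)⁴| > exp( − (log q) · exp(exp(exp( c₄ · A · log A ))) ). -/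
/-- The biquadratic theta value `θ₄(q) = ∑_{n=0}^∞ q^{-n⁴}`. -/
noncomputable def theta4 (q : ℕ) : ℝ := ∑' n : ℕ, (1 : ℝ) / (q : ℝ) ^ (n ^ 4)

open Finset

section PrimesInResidueClass

open ArithmeticFunction

/-- Telescoping comparison for the tail of `∑ n^{-1-δ}`. -/
lemma rpow_tail_step {δ : ℝ} (hδ : 0 < δ) {n : ℕ} (hn : 1 ≤ n) :
    ((n + 1 : ℕ) : ℝ) ^ (-1 - δ) ≤ δ⁻¹ * ((n : ℝ) ^ (-δ) - ((n + 1 : ℕ) : ℝ) ^ (-δ)) := by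
  have hn0 : (0 : ℝ) < n := by exact_mod_cast hn
  have hm : (0 : ℝ) < ((n + 1 : ℕ) : ℝ) := by positivity
  have h1 : 1 + δ / ((n + 1 : ℕ) : ℝ) ≤ ((n : ℝ) / ((n + 1 : ℕ) : ℝ)) ^ (-δ) := by
    rw [Real.rpow_def_of_pos (by positivity)]
    have hl : Real.log ((n : ℝ) / ((n + 1 : ℕ) : ℝ)) ≤ (n : ℝ) / ((n + 1 : ℕ) : ℝ) - 1 :=
      Real.log_le_sub_one_of_pos (by positivity)
    have h2 : (n : ℝ) / ((n + 1 : ℕ) : ℝ) - 1 = - (1 / ((n + 1 : ℕ) : ℝ)) := by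
      field_simp; push_cast; ring
    have h3 : δ / ((n + 1 : ℕ) : ℝ) ≤ Real.log ((n : ℝ) / ((n + 1 : ℕ) : ℝ)) * -δ := by
      rw [h2] at hl
      have := mul_le_mul_of_nonneg_left hl hδ.le
      have e : δ / ((n + 1 : ℕ) : ℝ) = δ * (1 / ((n + 1 : ℕ) : ℝ)) := by ring
      rw [e]; nlinarith
    have := Real.add_one_le_exp (Real.log ((n : ℝ) / ((n + 1 : ℕ) : ℝ)) * -δ)
    linarith
  rw [Real.div_rpow hn0.le hm.le, le_div_iff₀ (by positivity)] at h1
  have e : ((n + 1 : ℕ) : ℝ) ^ (-1 - δ) = ((n + 1 : ℕ) : ℝ) ^ (-δ) / ((n + 1 : ℕ) : ℝ) := by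
    rw [show -1 - δ = -δ - 1 by ring, Real.rpow_sub_one hm.ne']
  rw [e, le_inv_mul_iff₀ hδ]
  have : (1 + δ / ((n + 1 : ℕ) : ℝ)) * ((n + 1 : ℕ) : ℝ) ^ (-δ)
      = ((n + 1 : ℕ) : ℝ) ^ (-δ) + δ * (((n + 1 : ℕ) : ℝ) ^ (-δ) / ((n + 1 : ℕ) : ℝ)) := by ring
  linarith

lemma sum_rpow_tail_le {δ : ℝ} (hδ : 0 < δ) {Y : ℕ} (hY : 1 ≤ Y) (N : ℕ) :
    ∑ n ∈ range N, ((n + (Y + 1) : ℕ) : ℝ) ^ (-1 - δ) ≤ δ⁻¹ * (Y : ℝ) ^ (-δ) := by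
  suffices h : ∑ n ∈ range N, ((n + (Y + 1) : ℕ) : ℝ) ^ (-1 - δ)
      ≤ δ⁻¹ * ((Y : ℝ) ^ (-δ) - ((N + Y : ℕ) : ℝ) ^ (-δ)) by
    refine h.trans (mul_le_mul_of_nonneg_left ?_ (by positivity))
    have : 0 ≤ ((N + Y : ℕ) : ℝ) ^ (-δ) := by positivity
    linarith
  induction N with
  | zero => simp
  | succ N ih =>
    rw [sum_range_succ]
    have := rpow_tail_step hδ (n := N + Y) (by omega)
    have e1 : N + (Y + 1) = N + Y + 1 := by ring
    have e2 : N + 1 + Y = N + Y + 1 := by ring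
    rw [e1, e2]
    linarith

/-- `log n · ∑_{j<J} 2^{-j} n^{-2^{-j}}` is bounded by a telescoping sum. -/
lemma log_mul_sum_le {x : ℝ} (hx : 1 ≤ x) (J : ℕ) :
    Real.log x * ∑ j ∈ range J, (1 / 2 : ℝ) ^ j * x ^ (-(1 / 2 : ℝ) ^ j)
      ≤ 2 * x ^ (-(1 / 2 : ℝ) ^ J) := by
  have hx0 : 0 < x := by linarith
  have step : ∀ j : ℕ, Real.log x * ((1 / 2 : ℝ) ^ j * x ^ (-(1 / 2 : ℝ) ^ j))
      ≤ 2 * (x ^ (-(1 / 2 : ℝ) ^ (j + 1)) - x ^ (-(1 / 2 : ℝ) ^ j)) := by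
    intro j
    have hl : 0 ≤ Real.log x := Real.log_nonneg hx
    set v := Real.log x * (1 / 2 : ℝ) ^ j with hv
    have e1 : x ^ (-(1 / 2 : ℝ) ^ j) = Real.exp (-v) := by
      rw [Real.rpow_def_of_pos hx0, hv]; ring_nf
    have e2 : x ^ (-(1 / 2 : ℝ) ^ (j + 1)) = Real.exp (-v) * Real.exp (v / 2) := by
      rw [Real.rpow_def_of_pos hx0, hv, ← Real.exp_add]; ring_nf
    rw [e1, e2, ← mul_assoc, ← hv]
    have := Real.add_one_le_exp (v / 2)
    have h0 := Real.exp_pos (-v)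
    nlinarith
  suffices h : Real.log x * ∑ j ∈ range J, (1 / 2 : ℝ) ^ j * x ^ (-(1 / 2 : ℝ) ^ j)
      ≤ 2 * (x ^ (-(1 / 2 : ℝ) ^ J) - x ^ (-(1 / 2 : ℝ) ^ 0)) by
    have : 0 ≤ x ^ (-(1 / 2 : ℝ) ^ 0) := by positivity
    linarith
  rw [mul_sum]
  calc _ ≤ ∑ j ∈ range J, 2 * (x ^ (-(1 / 2 : ℝ) ^ (j + 1)) - x ^ (-(1 / 2 : ℝ) ^ j)) :=
        sum_le_sum fun j _ => step j
    _ = _ := by rw [← mul_sum, sum_range_sub (fun j : ℕ => x ^ (-(1 / 2 : ℝ) ^ j))]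

/-- Quantitative divergence of `∑ 1/p` over primes in an invertible residue class. -/
lemma sum_inv_primes_residue_lower {m : ℕ} [NeZero m] {a : ZMod m} (ha : IsUnit a) :
    ∃ C : ℝ, ∀ J : ℕ, (m.totient : ℝ)⁻¹ * J / 2 - C ≤
      ∑ n ∈ (range (4 ^ (J * 2 ^ J) + 1)).filter (fun n : ℕ => n.Prime ∧ (n : ZMod m) = a), (1 : ℝ) / n := by
  obtain ⟨C, hC⟩ := vonMangoldt.LSeries_residueClass_lower_bound ha
  set f : ℕ → ℝ := vonMangoldt.residueClass a with hf
  have hf0 : ∀ n, 0 ≤ f n := vonMangoldt.residueClass_nonneg a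
  have hsN := vonMangoldt.summable_residueClass_non_primes_div a
  set g : ℕ → ℝ := fun n => (if n.Prime then 0 else f n) / n with hg
  have hg0 : ∀ n, 0 ≤ g n := fun n => by
    simp only [hg]; split_ifs
    · simp
    · exact div_nonneg (hf0 n) (by positivity)
  have hsum : ∀ x : ℝ, 1 < x → Summable fun n : ℕ => f n / (n : ℝ) ^ x := fun x hx =>
    LSeries.summable_real_of_abscissaOfAbsConv_lt <|
        (vonMangoldt.abscissaOfAbsConv_residueClass_le_one a).trans_lt <| mod_cast hx
  refine ⟨|C| + ∑' n, g n + 1, fun J => ?_⟩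
  set δ : ℝ := (1 / 2 : ℝ) ^ J with hδ
  have hδ0 : 0 < δ := by positivity
  set S : Set ℕ := {n : ℕ | n.Prime ∧ (n : ZMod m) = a} with hS
  set w : ℕ → ℝ := S.indicator fun n => (n : ℝ) ^ (-1 - δ) with hw
  have hw0 : ∀ n, 0 ≤ w n := fun n => Set.indicator_nonneg (fun _ _ => by positivity) n
  have hwle : ∀ n, w n ≤ (n : ℝ) ^ (-1 - δ) := fun n =>
    Set.indicator_le_self' (fun _ _ => by positivity) n
  have hws : Summable w := by
    refine Summable.of_nonneg_of_le hw0 hwle ?_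
    exact Real.summable_nat_rpow.2 (by linarith)
  -- lower bound
  have hlow : (m.totient : ℝ)⁻¹ * J - 2 * |C| ≤
      ∑ j ∈ range J, (1 / 2 : ℝ) ^ j * ∑' n, f n / (n : ℝ) ^ (1 + (1 / 2 : ℝ) ^ j) := by
    have hj : ∀ j : ℕ, (m.totient : ℝ)⁻¹ - (1 / 2 : ℝ) ^ j * |C| ≤
        (1 / 2 : ℝ) ^ j * ∑' n, f n / (n : ℝ) ^ (1 + (1 / 2 : ℝ) ^ j) := by
      intro j
      have hp : (0 : ℝ) < (1 / 2 : ℝ) ^ j := by positivity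
      have hp1 : (1 / 2 : ℝ) ^ j ≤ 1 := pow_le_one₀ (by norm_num) (by norm_num)
      have := hC (x := 1 + (1 / 2 : ℝ) ^ j) ⟨by linarith, by linarith⟩
      have h2 := mul_le_mul_of_nonneg_left this hp.le
      rw [add_sub_cancel_left, mul_sub, mul_div_cancel₀ _ hp.ne'] at h2
      have h3 := mul_le_mul_of_nonneg_left (le_abs_self C) hp.le
      linarith
    have hgeo : ∑ j ∈ range J, (1 / 2 : ℝ) ^ j ≤ 2 := sum_geometric_two_le J
    calc _ ≤ (m.totient : ℝ)⁻¹ * J - (∑ j ∈ range J, (1 / 2 : ℝ) ^ j) * |C| := by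
            have := mul_le_mul_of_nonneg_right hgeo (abs_nonneg C)
            linarith
      _ = ∑ j ∈ range J, ((m.totient : ℝ)⁻¹ - (1 / 2 : ℝ) ^ j * |C|) := by
            rw [sum_sub_distrib, ← sum_mul]; simp [mul_comm]
      _ ≤ _ := sum_le_sum fun j _ => hj j
  have hswap : ∑ j ∈ range J, (1 / 2 : ℝ) ^ j * ∑' n, f n / (n : ℝ) ^ (1 + (1 / 2 : ℝ) ^ j)
      = ∑' n, ∑ j ∈ range J, (1 / 2 : ℝ) ^ j * (f n / (n : ℝ) ^ (1 + (1 / 2 : ℝ) ^ j)) := by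
    rw [Summable.tsum_finsetSum]
    · simp_rw [tsum_mul_left]
    · intro j _
      exact (hsum _ (by simp)).mul_left _
  have hpt : ∀ n, ∑ j ∈ range J, (1 / 2 : ℝ) ^ j * (f n / (n : ℝ) ^ (1 + (1 / 2 : ℝ) ^ j))
      ≤ 2 * g n + 2 * w n := by
    intro n
    rcases Nat.eq_zero_or_pos n with rfl | hn
    · have : f 0 = 0 := by simp [hf]
      simp only [this, zero_div, mul_zero, sum_const_zero]
      have := hg0 0; have := hw0 0; positivity
    have hn0 : (0 : ℝ) < n := by exact_mod_cast hn
    have hn1 : (1 : ℝ) ≤ n := by exact_mod_cast hn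
    have e : ∀ j : ℕ, (1 / 2 : ℝ) ^ j * (f n / (n : ℝ) ^ (1 + (1 / 2 : ℝ) ^ j))
        = f n / n * ((1 / 2 : ℝ) ^ j * (n : ℝ) ^ (-(1 / 2 : ℝ) ^ j)) := by
      intro j
      rw [Real.rpow_add hn0, Real.rpow_one, Real.rpow_neg hn0.le]
      field_simp
    simp_rw [e]
    rw [← mul_sum]
    by_cases hp : n.Prime
    · have hgn : g n = 0 := by simp [hg, hp]
      rw [hgn]
      by_cases hna : (n : ZMod m) = a
      · have hfn : f n = Real.log n := by
          simp [hf, vonMangoldt.residueClass, hna, vonMangoldt_apply_prime hp]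
        have hwn : w n = (n : ℝ) ^ (-1 - δ) := by
          simp only [hw]; exact Set.indicator_of_mem (show n ∈ S from ⟨hp, hna⟩) _
        rw [hfn, hwn]
        have := log_mul_sum_le hn1 J
        rw [show -1 - δ = -δ - 1 by ring, Real.rpow_sub_one hn0.ne', div_mul_eq_mul_div]
        rw [mul_zero, zero_add, ← mul_div_assoc]
        gcongr
      · have hfn : f n = 0 := by
          simp [hf, vonMangoldt.residueClass, hna]
        rw [hfn]; have := hw0 n; simp; linarith
    · have hgn : g n = f n / n := by simp [hg, hp]
      have h1 : ∑ j ∈ range J, (1 / 2 : ℝ) ^ j * (n : ℝ) ^ (-(1 / 2 : ℝ) ^ j) ≤ 2 := by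
        refine le_trans (sum_le_sum fun j _ => ?_) (sum_geometric_two_le J)
        have : (n : ℝ) ^ (-(1 / 2 : ℝ) ^ j) ≤ 1 :=
          Real.rpow_le_one_of_one_le_of_nonpos hn1 (by simp)
        have h2 : (0 : ℝ) < (1 / 2 : ℝ) ^ j := by positivity
        nlinarith
      have := mul_le_mul_of_nonneg_left h1 (hg0 n)
      rw [hgn] at this ⊢
      have := hw0 n
      linarith
  have hup : ∑' n, ∑ j ∈ range J, (1 / 2 : ℝ) ^ j * (f n / (n : ℝ) ^ (1 + (1 / 2 : ℝ) ^ j))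
      ≤ 2 * ∑' n, g n + 2 * ∑' n, w n := by
    rw [← tsum_mul_left, ← tsum_mul_left, ← (hsN.mul_left 2).tsum_add (hws.mul_left 2)]
    refine Summable.tsum_le_tsum hpt ?_ ((hsN.mul_left 2).add (hws.mul_left 2))
    exact summable_sum fun j _ => (hsum _ (by simp)).mul_left _
  have htail : ∑' n, w n ≤
      ∑ n ∈ (range (4 ^ (J * 2 ^ J) + 1)).filter (fun n : ℕ => n.Prime ∧ (n : ZMod m) = a), (1 : ℝ) / n + 1 := by
    rw [← hws.sum_add_tsum_nat_add (4 ^ (J * 2 ^ J) + 1)]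
    gcongr
    · rw [sum_filter]
      refine sum_le_sum fun n _ => ?_
      simp only [hw, Set.indicator, hS, Set.mem_ofPred_eq]
      split_ifs with h
      · have hn1 : (1 : ℝ) ≤ n := by exact_mod_cast h.1.one_le
        rw [one_div, ← Real.rpow_neg_one]
        exact Real.rpow_le_rpow_of_exponent_le hn1 (by linarith)
      · exact le_rfl
    · have : ∀ N, ∑ n ∈ range N, w (n + (4 ^ (J * 2 ^ J) + 1)) ≤ 1 := by
        intro N
        refine (sum_le_sum fun n _ => hwle _).trans ?_
        refine (sum_rpow_tail_le hδ0 (Nat.one_le_pow _ _ (by norm_num)) N).trans ?_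
        have e : (((4 ^ (J * 2 ^ J) : ℕ) : ℝ)) ^ (-δ) = ((4 : ℝ) ^ J)⁻¹ := by
          push_cast
          rw [Real.rpow_neg (by positivity), ← Real.rpow_natCast, ← Real.rpow_natCast,
            ← Real.rpow_mul (by norm_num)]
          congr 2
          rw [hδ]; push_cast
          rw [mul_assoc, ← mul_pow]; norm_num
        rw [e, hδ, ← inv_pow, ← inv_pow, ← mul_pow]
        exact pow_le_one₀ (by norm_num) (by norm_num)
      exact Real.tsum_le_of_sum_range_le (fun n => hw0 _) this
  have : (0:ℝ) ≤ ∑' n, g n := tsum_nonneg hg0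
  linarith

end PrimesInResidueClass

/-- The exponential sum `∑ x, ψ (a * x ^ k)` over `ZMod p`. -/
noncomputable def powExpSum (p : ℕ) [NeZero p] (k : ℕ) (a : ZMod p) : ℂ :=
  ∑ x : ZMod p, ZMod.stdAddChar (a * x ^ k)

/-- The number of solutions of `x⁴ + y⁴ + z⁴ + w⁴ = c` in `ZMod n`. -/
def biquadCount (n : ℕ) [NeZero n] (c : ZMod n) : ℕ :=
  #{v : ZMod n × ZMod n × ZMod n × ZMod n |
    v.1 ^ 4 + (v.2.1 ^ 4 + (v.2.2.1 ^ 4 + v.2.2.2 ^ 4)) = c}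

section LocalDensity

variable {p : ℕ} [Fact p.Prime] {i : ZMod p}

lemma sum_stdAddChar_mul (b : ZMod p) :
    ∑ a : ZMod p, (ZMod.stdAddChar (a * b) : ℂ) = if b = 0 then (p : ℂ) else 0 := by
  rw [AddChar.sum_mulShift b (ZMod.isPrimitive_stdAddChar p)]
  split_ifs <;> simp [ZMod.card]

lemma sum_comp_mul {M : Type*} [AddCommMonoid M] {b : ZMod p} (hb : b ≠ 0) (f : ZMod p → M) :
    ∑ x, f (b * x) = ∑ x, f x :=
  Equiv.sum_comp (Equiv.mulLeft₀ b hb) f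

lemma powExpSum_zero (k : ℕ) : powExpSum p k 0 = p := by
  simp [powExpSum, ZMod.card]

lemma powExpSum_mul_pow {b : ZMod p} (hb : b ≠ 0) (k : ℕ) (a : ZMod p) :
    powExpSum p k (b ^ k * a) = powExpSum p k a := by
  unfold powExpSum
  rw [← sum_comp_mul hb (fun x => (ZMod.stdAddChar (a * x ^ k) : ℂ))]
  refine sum_congr rfl fun x _ => ?_
  congr 1; ring

lemma conj_powExpSum (k : ℕ) (a : ZMod p) :
    (starRingEnd ℂ) (powExpSum p k a) = powExpSum p k (-a) := by
  unfold powExpSum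
  rw [map_sum]
  refine sum_congr rfl fun x _ => ?_
  rw [← AddChar.map_neg_eq_conj, neg_mul]

lemma mul_biquadCount (c : ZMod p) :
    (p : ℂ) * biquadCount p c
      = ∑ a : ZMod p, ZMod.stdAddChar (a * -c) * powExpSum p 4 a ^ 4 := by
  have h1 : ∀ a : ZMod p, (ZMod.stdAddChar (a * -c) * powExpSum p 4 a ^ 4 : ℂ) =
      ∑ v : ZMod p × ZMod p × ZMod p × ZMod p, ZMod.stdAddChar
        (a * (v.1 ^ 4 + (v.2.1 ^ 4 + (v.2.2.1 ^ 4 + v.2.2.2 ^ 4)) - c)) := by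
    intro a
    simp_rw [Fintype.sum_prod_type, sub_eq_add_neg, mul_add, AddChar.map_add_eq_mul, ← sum_mul,
      ← mul_sum, ← sum_mul]
    unfold powExpSum
    ring
  simp_rw [h1]
  rw [sum_comm]
  simp_rw [sum_stdAddChar_mul, sub_eq_zero]
  rw [← sum_filter, sum_const, nsmul_eq_mul, mul_comm]
  rfl

lemma sqrt_neg_one_ne_zero (hi : i ^ 2 = -1) : i ≠ 0 := by
  rintro rfl
  norm_num at hi

lemma powExpSum_two_real (hi : i ^ 2 = -1) (a : ZMod p) :
    (starRingEnd ℂ) (powExpSum p 2 a) = powExpSum p 2 a := by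
  rw [conj_powExpSum, ← powExpSum_mul_pow (sqrt_neg_one_ne_zero hi) 2 a, hi, neg_one_mul]

lemma two_ne_zero_of_sqrt_neg_one (hi : i ^ 2 = -1) (hns : ¬ IsSquare i) : (2 : ZMod p) ≠ 0 := by
  intro h
  apply hns
  have h1 : (-1 : ZMod p) = 1 := by
    have : (1 : ZMod p) + 1 = 0 := by rw [one_add_one_eq_two, h]
    exact neg_eq_of_add_eq_zero_left this
  rw [h1] at hi
  rcases sq_eq_one_iff.1 hi with h | h
  · exact ⟨1, by rw [h, one_mul]⟩
  · exact ⟨1, by rw [h, h1, one_mul]⟩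

lemma powExpSum_two_sq (hi : i ^ 2 = -1) (hns : ¬ IsSquare i)
    {a : ZMod p} (ha : a ≠ 0) : powExpSum p 2 a ^ 2 = p := by
  have h2 := two_ne_zero_of_sqrt_neg_one hi hns
  have hi0 := sqrt_neg_one_ne_zero hi
  have h1 : powExpSum p 2 a ^ 2 =
      ∑ z : ZMod p, ∑ y : ZMod p, (ZMod.stdAddChar (a * y ^ 2 + z * (2 * i * a * y)) : ℂ) := by
    rw [sq]
    nth_rw 2 [powExpSum]
    rw [mul_sum]
    refine sum_congr rfl fun z _ => ?_
    rw [powExpSum, sum_mul, ← Equiv.sum_comp (Equiv.addRight (i * z))]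
    refine sum_congr rfl fun y _ => ?_
    rw [← AddChar.map_add_eq_mul]
    congr 1
    simp only [Equiv.coe_addRight]
    linear_combination a * z ^ 2 * hi
  rw [h1, sum_comm]
  simp_rw [AddChar.map_add_eq_mul, ← mul_sum, sum_stdAddChar_mul]
  simp [h2, hi0, ha]

lemma eq_sq_or_eq_mul_sq (hi : i ^ 2 = -1) (hns : ¬ IsSquare i)
    {b : ZMod p} (hb : b ≠ 0) : ∃ c ≠ 0, b = c ^ 2 ∨ b = i * c ^ 2 := by
  have hi0 := sqrt_neg_one_ne_zero hi
  rcases em (IsSquare b) with ⟨c, hc⟩ | hb'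
  · exact ⟨c, by rintro rfl; simp_all, Or.inl (by rw [hc, sq])⟩
  · have h1 := quadraticChar_neg_one_iff_not_isSquare.2 hb'
    have h2 := quadraticChar_neg_one_iff_not_isSquare.2 hns
    have h3 : quadraticChar (ZMod p) (b * i) = 1 := by rw [map_mul, h1, h2]; norm_num
    obtain ⟨c, hc⟩ := (quadraticChar_one_iff_isSquare (mul_ne_zero hb hi0)).1 h3
    refine ⟨i * c, ?_, Or.inr ?_⟩
    · refine mul_ne_zero hi0 ?_
      rintro rfl
      simp [hb, hi0] at hc
    · linear_combination b * hi - i * hc - (i * c ^ 2) * hi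

lemma exists_fourth_power (hi : i ^ 2 = -1) (hns : ¬ IsSquare i) {a : ZMod p} (ha : a ≠ 0) :
    ∃ c ≠ 0, a = c ^ 4 * 1 ∨ a = -(c ^ 4 * 1) ∨ a = c ^ 4 * i ∨ a = -(c ^ 4 * i) := by
  obtain ⟨b, hb, h⟩ := eq_sq_or_eq_mul_sq hi hns ha
  obtain ⟨c, hc, h'⟩ := eq_sq_or_eq_mul_sq hi hns hb
  refine ⟨c, hc, ?_⟩
  rcases h with rfl | rfl <;> rcases h' with rfl | rfl
  · left; ring
  · right; left; linear_combination c ^ 4 * hi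
  · right; right; left; ring
  · right; right; right; linear_combination i * c ^ 4 * hi

lemma sum_comp_sq (hi : i ^ 2 = -1) (hns : ¬ IsSquare i) (f : ZMod p → ℂ) :
    ∑ x, f (x ^ 2) = ∑ y, (1 + (quadraticChar (ZMod p) y : ℂ)) * f y := by
  rw [← sum_fiberwise univ (fun x : ZMod p => x ^ 2)]
  refine sum_congr rfl fun y _ => ?_
  have : ringChar (ZMod p) ≠ 2 := by
    rw [ZMod.ringChar_zmod_n]
    rintro rfl
    exact two_ne_zero_of_sqrt_neg_one hi hns (by exact_mod_cast CharP.cast_eq_zero (ZMod 2) 2)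
  have h := quadraticChar_card_sqrts this y
  rw [sum_congr rfl (g := fun _ => f y) (fun x hx => by rw [(mem_filter.1 hx).2]), sum_const,
    nsmul_eq_mul]
  congr 1
  rw [add_comm]
  have e : ({x | x ^ 2 = y} : Set (ZMod p)).toFinset = ({x | x ^ 2 = y} : Finset (ZMod p)) := by
    ext; simp
  rw [e] at h
  exact_mod_cast congrArg (Int.cast : ℤ → ℂ) h

lemma powExpSum_four_add_neg (hi : i ^ 2 = -1) (hns : ¬ IsSquare i) (a : ZMod p) :
    powExpSum p 4 a + powExpSum p 4 (-a) = 2 * powExpSum p 2 a := by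
  have hi0 := sqrt_neg_one_ne_zero hi
  have h1 : powExpSum p 4 a =
      ∑ y, (1 + (quadraticChar (ZMod p) y : ℂ)) * ZMod.stdAddChar (a * y ^ 2) := by
    rw [← sum_comp_sq hi hns (fun y => (ZMod.stdAddChar (a * y ^ 2) : ℂ))]
    simp only [powExpSum, ← pow_mul]
  have h2 : powExpSum p 4 (-a) =
      ∑ y, (1 + (quadraticChar (ZMod p) (i * y) : ℂ)) * ZMod.stdAddChar (a * y ^ 2) := by
    have : powExpSum p 4 (-a) = ∑ x : ZMod p, (ZMod.stdAddChar (-a * (x ^ 2) ^ 2) : ℂ) := by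
      simp only [powExpSum, ← pow_mul]
    rw [this, sum_comp_sq hi hns (fun y => (ZMod.stdAddChar (-a * y ^ 2) : ℂ)), ← sum_comp_mul hi0]
    refine sum_congr rfl fun y _ => ?_
    congr 2
    linear_combination (-a) * y ^ 2 * hi
  rw [h1, h2, ← sum_add_distrib, powExpSum, mul_sum]
  refine sum_congr rfl fun y _ => ?_
  rw [map_mul (quadraticChar (ZMod p)), quadraticChar_neg_one_iff_not_isSquare.2 hns]
  push_cast
  ring

lemma re_pow_four_eq (hi : i ^ 2 = -1) (hns : ¬ IsSquare i) {a : ZMod p} (ha : a ≠ 0) :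
    (p : ℝ) ≤ Complex.normSq (powExpSum p 4 a) ∧
    (powExpSum p 4 a ^ 4).re = 8 * (p : ℝ) ^ 2 - 8 * p * Complex.normSq (powExpSum p 4 a)
      + Complex.normSq (powExpSum p 4 a) ^ 2 := by
  set g := powExpSum p 4 a with hg
  set r := powExpSum p 2 a with hr
  have h1 : g + (starRingEnd ℂ) g = 2 * r := by
    rw [conj_powExpSum]; exact powExpSum_four_add_neg hi hns a
  have h2 : r.im = 0 := Complex.conj_eq_iff_im.1 (powExpSum_two_real hi a)
  have h3 : r.re ^ 2 = p := by
    have := congrArg Complex.re (powExpSum_two_sq hi hns ha)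
    rw [← hr] at this
    simpa [sq, h2] using this
  have h4 : g.re = r.re := by
    have := congrArg Complex.re h1
    simp at this
    linarith
  rw [← h4] at h3
  rw [Complex.normSq_apply]
  constructor
  · nlinarith
  · have : (g ^ 4).re = (g.re ^ 2) ^ 2 - 6 * g.re ^ 2 * g.im ^ 2 + g.im ^ 4 := by
      simp only [pow_succ, pow_zero, one_mul, Complex.mul_re, Complex.mul_im]
      ring
    rw [this, ← h3]
    ring

lemma card_fourth_power_eq (hi : i ^ 2 = -1) (hns : ¬ IsSquare i) {y : ZMod p} (hy : y ≠ 0) :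
    #{x : ZMod p | x ^ 4 = y ^ 4} = 4 := by
  have h2 := two_ne_zero_of_sqrt_neg_one hi hns
  have hi1 : i ≠ 1 := by rintro rfl; exact hns ⟨1, by simp⟩
  have hi2 : i ≠ -1 := by
    rintro rfl
    exact hns ⟨1, by rw [neg_sq, one_pow] at hi; simp [← hi]⟩
  have e : ({x : ZMod p | x ^ 4 = y ^ 4} : Finset (ZMod p)) = {y, -y, i * y, -(i * y)} := by
    ext x
    simp only [mem_filter, mem_univ, true_and, mem_insert, mem_singleton]
    constructor
    · intro h
      have : (x - y) * ((x + y) * ((x - i * y) * (x + i * y))) = 0 := by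
        linear_combination h - (x ^ 2 * y ^ 2 - y ^ 4) * hi
      rcases mul_eq_zero.1 this with h | h
      · left; linear_combination h
      rcases mul_eq_zero.1 h with h | h
      · right; left; linear_combination h
      rcases mul_eq_zero.1 h with h | h
      · right; right; left; linear_combination h
      · right; right; right; linear_combination h
    · rintro (rfl | rfl | rfl | rfl)
      · rfl
      · ring
      · linear_combination (i ^ 2 - 1) * y ^ 4 * hi
      · linear_combination (i ^ 2 - 1) * y ^ 4 * hi
  have hyn : y ≠ -y := fun h => by
    have : 2 * y = 0 := by linear_combination h
    simp [h2, hy] at this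
  have h3 : y ≠ i * y := fun h => hi1 (mul_right_cancel₀ hy (by linear_combination -h))
  have h4 : y ≠ -(i * y) := fun h => hi2 (mul_right_cancel₀ hy (by linear_combination h))
  have h5 : i * y ≠ -(i * y) := fun h => by
    have : 2 * (i * y) = 0 := by linear_combination h
    simp [h2, hy, sqrt_neg_one_ne_zero hi] at this
  have h6 : -y ≠ i * y := fun h => h4 (by linear_combination -h)
  have h7 : -y ≠ -(i * y) := fun h => h3 (by linear_combination -h)
  rw [e, card_insert_of_notMem, card_insert_of_notMem, card_insert_of_notMem, card_singleton]
  · simpa using h5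
  · simp [h6]; simpa using h7
  · simp [hyn, h3, h4]

lemma sum_normSq_quartic (hi : i ^ 2 = -1) (hns : ¬ IsSquare i) :
    ∑ a : ZMod p, Complex.normSq (powExpSum p 4 a) = p * (1 + 4 * (p - 1)) := by
  have h1 : ∀ a : ZMod p, (Complex.normSq (powExpSum p 4 a) : ℂ) =
      ∑ y : ZMod p, ∑ x : ZMod p, (ZMod.stdAddChar (a * (x ^ 4 - y ^ 4)) : ℂ) := by
    intro a
    rw [← Complex.mul_conj, conj_powExpSum, mul_comm]
    unfold powExpSum
    rw [sum_mul_sum]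
    refine sum_congr rfl fun y _ => sum_congr rfl fun x _ => ?_
    rw [← AddChar.map_add_eq_mul]
    congr 1; ring
  have h2 : ∀ y : ZMod p, (#{x : ZMod p | x ^ 4 = y ^ 4} : ℂ) = if y = 0 then 1 else 4 := by
    intro y
    split_ifs with h
    · subst h
      have : ({x : ZMod p | x ^ 4 = 0 ^ 4} : Finset (ZMod p)) = {0} := by ext; simp
      rw [this]; simp
    · rw [card_fourth_power_eq hi hns h]; norm_num
  have h3 : ((∑ a : ZMod p, Complex.normSq (powExpSum p 4 a) : ℝ) : ℂ)
      = ((p * (1 + 4 * (p - 1)) : ℝ) : ℂ) := by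
    push_cast
    simp_rw [h1]
    rw [sum_comm]
    simp_rw [sum_comm (s := univ) (t := univ) (f := fun (a x : ZMod p) =>
      (ZMod.stdAddChar (a * (x ^ 4 - _)) : ℂ)), sum_stdAddChar_mul, sub_eq_zero]
    simp_rw [← sum_filter, sum_const, nsmul_eq_mul, h2]
    rw [← sum_mul, Fintype.sum_eq_add_sum_compl 0,
      sum_congr rfl (g := fun _ => (4 : ℂ)) (fun x hx => if_neg (by simpa using hx)),
      sum_const, card_compl, card_singleton, ZMod.card]
    simp [Nat.cast_sub (Fact.out : p.Prime).one_le]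
    ring
  exact_mod_cast h3

lemma normSq_add_normSq (hi : i ^ 2 = -1) (hns : ¬ IsSquare i) {a : ZMod p} (ha : a ≠ 0) :
    Complex.normSq (powExpSum p 4 a) + Complex.normSq (powExpSum p 4 (i * a)) = 6 * p := by
  have hi0 := sqrt_neg_one_ne_zero hi
  set V : ZMod p → ℝ := fun a => Complex.normSq (powExpSum p 4 a) with hV
  have hneg : ∀ a, V (-a) = V a := fun a => by
    simp only [hV]; rw [← conj_powExpSum, Complex.normSq_conj]
  have hpow : ∀ b ≠ 0, ∀ a, V (b ^ 4 * a) = V a := fun b hb a => by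
    simp only [hV]; rw [powExpSum_mul_pow hb]
  have hii : V (i * i) = V 1 := by rw [← hneg]; congr 1; linear_combination -hi
  have key : ∀ a ≠ 0, V a + V (i * a) = V 1 + V i := by
    intro a ha
    obtain ⟨c, hc, h⟩ := exists_fourth_power hi hns ha
    rcases h with rfl | rfl | rfl | rfl
    · rw [hpow c hc, show i * (c ^ 4 * 1) = c ^ 4 * i by ring, hpow c hc]
    · rw [hneg, hpow c hc, mul_neg, hneg, show i * (c ^ 4 * 1) = c ^ 4 * i by ring, hpow c hc]
    · rw [hpow c hc, show i * (c ^ 4 * i) = c ^ 4 * (i * i) by ring, hpow c hc, hii, add_comm]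
    · rw [hneg, hpow c hc, mul_neg, hneg, show i * (c ^ 4 * i) = c ^ 4 * (i * i) by ring,
        hpow c hc, hii, add_comm]
  have hsum := sum_normSq_quartic hi hns
  change ∑ a, V a = _ at hsum
  have h0 : V 0 = p ^ 2 := by simp only [hV]; rw [powExpSum_zero]; simp [sq]
  have h2 : ∑ a, (V a + V (i * a)) = 2 * (p * (1 + 4 * (p - 1))) := by
    rw [sum_add_distrib, sum_comp_mul hi0 V, hsum]; ring
  rw [Fintype.sum_eq_add_sum_compl 0, mul_zero, h0,
    sum_congr rfl (g := fun _ => V 1 + V i) (fun x hx => key x (by simpa using hx)),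
    sum_const, card_compl, card_singleton, ZMod.card, nsmul_eq_mul,
    Nat.cast_sub (Fact.out : p.Prime).one_le] at h2
  change V a + V (i * a) = _
  rw [key a ha]
  have hp : (1 : ℝ) < p := by exact_mod_cast (Fact.out : p.Prime).one_lt
  push_cast at h2
  have : ((p : ℝ) - 1) * (V 1 + V i - 6 * p) = 0 := by linear_combination h2
  rcases mul_eq_zero.1 this with h | h <;> linarith

lemma biquadCount_zero_le (hi : i ^ 2 = -1) (hns : ¬ IsSquare i) :
    (biquadCount p 0 : ℝ) ≤ (p : ℝ) ^ 3 - 3 * p ^ 2 + 3 * p := by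
  have hi0 := sqrt_neg_one_ne_zero hi
  have hp : (1 : ℝ) < p := by exact_mod_cast (Fact.out : p.Prime).one_lt
  have h := congrArg Complex.re (mul_biquadCount (0 : ZMod p))
  simp only [neg_zero, mul_zero, AddChar.map_zero_eq_one, one_mul, Complex.re_sum] at h
  set F : ZMod p → ℝ := fun a => (powExpSum p 4 a ^ 4).re with hF
  have hFi : ∀ a ≠ 0, F a + F (i * a) ≤ -6 * (p : ℝ) ^ 2 := by
    intro a ha
    obtain ⟨h1, h2⟩ := re_pow_four_eq hi hns ha
    obtain ⟨h3, h4⟩ := re_pow_four_eq hi hns (mul_ne_zero hi0 ha)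
    have h5 := normSq_add_normSq hi hns ha
    simp only [hF]
    rw [h2, h4]
    rw [eq_sub_of_add_eq' h5] at h3 ⊢
    nlinarith
  have h0 : F 0 = p ^ 4 := by
    simp only [hF]; rw [powExpSum_zero]; exact_mod_cast Complex.ofReal_re ((p : ℝ) ^ 4)
  have h1 : (2 : ℝ) * (p * biquadCount p 0) ≤ 2 * p ^ 4 + (p - 1) * (-6 * (p : ℝ) ^ 2) := by
    have e : ((p : ℂ) * (biquadCount p 0 : ℂ)).re = (p : ℝ) * biquadCount p 0 := by
      exact_mod_cast Complex.ofReal_re ((p : ℝ) * biquadCount p 0)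
    rw [← e, h]
    have h2 : 2 * ∑ a, F a = ∑ a, (F a + F (i * a)) := by
      rw [sum_add_distrib, sum_comp_mul hi0 F]; ring
    rw [h2, Fintype.sum_eq_add_sum_compl 0, mul_zero, h0]
    have h3 := sum_le_sum (s := ({0} : Finset (ZMod p))ᶜ)
      (fun x hx => hFi x (by simpa using hx))
    rw [sum_const, card_compl, card_singleton, ZMod.card, nsmul_eq_mul,
      Nat.cast_sub (Fact.out : p.Prime).one_le] at h3
    push_cast at h3
    linarith
  have : (p : ℝ) * biquadCount p 0 ≤ p * ((p : ℝ) ^ 3 - 3 * p ^ 2 + 3 * p) := by linarith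
  exact le_of_mul_le_mul_left this (by linarith)

lemma biquadCount_le (hi : i ^ 2 = -1) (hns : ¬ IsSquare i) {c : ZMod p} (hc : c ≠ 0) :
    (biquadCount p c : ℝ) ≤ (p : ℝ) ^ 3 + 100 * (p * √p) := by
  have hi0 := sqrt_neg_one_ne_zero hi
  have hp : (1 : ℝ) < p := by exact_mod_cast (Fact.out : p.Prime).one_lt
  have hG : ∀ a : ZMod p, a ≠ 0 → ‖powExpSum p 4 a‖ ^ 2 ≤ 5 * p := by
    intro a ha
    rw [← Complex.normSq_eq_norm_sq]
    have h1 := (re_pow_four_eq hi hns (mul_ne_zero hi0 ha)).1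
    have h2 := normSq_add_normSq hi hns ha
    linarith
  set E : ZMod p → ℂ := fun c =>
    ∑ a ∈ ({0} : Finset (ZMod p))ᶜ, ZMod.stdAddChar (a * -c) * powExpSum p 4 a ^ 4 with hE
  have hEc : (p : ℂ) * biquadCount p c - p ^ 4 = E c := by
    rw [mul_biquadCount, Fintype.sum_eq_add_sum_compl 0, powExpSum_zero]
    simp [hE]
  have hinv : ∀ b ≠ 0, E (b ^ 4 * c) = E c := by
    intro b hb
    have : ∀ c', E c' = ∑ a, ZMod.stdAddChar (a * -c') * powExpSum p 4 a ^ 4 - p ^ 4 := by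
      intro c'
      rw [Fintype.sum_eq_add_sum_compl 0, powExpSum_zero]
      simp [hE]
    rw [this, this, ← sum_comp_mul (pow_ne_zero 4 hb)
      (fun a => (ZMod.stdAddChar (a * -c) * powExpSum p 4 a ^ 4 : ℂ))]
    congr 1
    refine sum_congr rfl fun a _ => ?_
    rw [powExpSum_mul_pow hb]
    congr 2; ring
  have hcard : (#({0} : Finset (ZMod p))ᶜ : ℝ) = p - 1 := by
    rw [card_compl, card_singleton, ZMod.card, Nat.cast_sub (Fact.out : p.Prime).one_le]
    simp
  have hsum : ((p : ℂ) - 1) * E c = ∑ a ∈ ({0} : Finset (ZMod p))ᶜ,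
      powExpSum p 4 a ^ 4 * (powExpSum p 4 (a * -c) - 1) := by
    have h1 : ((p : ℂ) - 1) * E c = ∑ b ∈ ({0} : Finset (ZMod p))ᶜ, E (b ^ 4 * c) := by
      rw [sum_congr rfl (g := fun _ => E c) (fun b hb => hinv b (by simpa using hb)), sum_const,
        nsmul_eq_mul]
      congr 1
      exact_mod_cast congrArg (Complex.ofReal) hcard.symm
    rw [h1]
    simp only [hE]
    rw [sum_comm]
    refine sum_congr rfl fun a _ => ?_
    rw [← sum_mul, mul_comm]
    congr 1
    have h2 : powExpSum p 4 (a * -c) = ∑ b, ZMod.stdAddChar (a * -(b ^ 4 * c)) := by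
      unfold powExpSum
      refine sum_congr rfl fun b _ => ?_
      congr 1; ring
    rw [h2, Fintype.sum_eq_add_sum_compl 0]
    simp
  have hs : √(p : ℝ) ^ 2 = p := Real.sq_sqrt (by linarith)
  have hs1 : 1 ≤ √(p : ℝ) := Real.one_le_sqrt.2 hp.le
  have hterm : ∀ a ∈ ({0} : Finset (ZMod p))ᶜ,
      ‖powExpSum p 4 a ^ 4 * (powExpSum p 4 (a * -c) - 1)‖ ≤ 25 * p ^ 2 * (4 * √p) := by
    intro a ha
    have ha0 : a ≠ 0 := by simpa using ha
    rw [norm_mul, norm_pow]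
    have h1 := hG a ha0
    have h2 := hG (a * -c) (mul_ne_zero ha0 (neg_ne_zero.2 hc))
    have h3 : ‖powExpSum p 4 a‖ ^ 4 ≤ 25 * p ^ 2 := by
      have : ‖powExpSum p 4 a‖ ^ 4 = (‖powExpSum p 4 a‖ ^ 2) ^ 2 := by ring
      rw [this]
      calc _ ≤ (5 * (p : ℝ)) ^ 2 := by gcongr
        _ = _ := by ring
    have h4 : ‖powExpSum p 4 (a * -c)‖ ≤ 3 * √p := by
      refine abs_le_of_sq_le_sq' ?_ (by positivity) |>.2
      rw [mul_pow, hs]; linarith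
    have h5 : ‖powExpSum p 4 (a * -c) - 1‖ ≤ 4 * √p := by
      refine (norm_sub_le _ _).trans ?_
      rw [norm_one]; linarith
    gcongr
  have hnorm : (p - 1) * ‖E c‖ ≤ (p - 1) * (25 * (p : ℝ) ^ 2 * (4 * √p)) := by
    have h1 : (p - 1 : ℝ) * ‖E c‖ = ‖((p : ℂ) - 1) * E c‖ := by
      rw [norm_mul]
      congr 1
      have : ((p : ℂ) - 1) = ((p - 1 : ℝ) : ℂ) := by push_cast; ring
      rw [this, Complex.norm_real, Real.norm_of_nonneg (by linarith)]
    rw [h1, hsum]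
    refine (norm_sum_le_of_le _ hterm).trans ?_
    rw [sum_const, nsmul_eq_mul, hcard]
  have hE2 : ‖E c‖ ≤ 25 * (p : ℝ) ^ 2 * (4 * √p) := le_of_mul_le_mul_left hnorm (by linarith)
  have h7 : (p : ℝ) * biquadCount p c - p ^ 4 ≤ ‖E c‖ := by
    rw [← hEc]
    refine le_trans (le_of_eq ?_) (Complex.re_le_norm _)
    have h8 : (p : ℂ) * biquadCount p c - p ^ 4
        = (((p : ℝ) * biquadCount p c - p ^ 4 : ℝ) : ℂ) := by push_cast; ring
    rw [h8, Complex.ofReal_re]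
  have : (p : ℝ) * biquadCount p c ≤ p * ((p : ℝ) ^ 3 + 100 * (p * √p)) := by
    linarith
  exact le_of_mul_le_mul_left this (by linarith)

/-- For `p ≡ 5 mod 8` the number `-1` is the square of a non-square mod `p`. -/
lemma exists_sqrt_neg_one (h : p % 8 = 5) : ∃ i : ZMod p, i ^ 2 = -1 ∧ ¬ IsSquare i := by
  obtain ⟨i, hi⟩ := (ZMod.exists_sq_eq_neg_one_iff (p := p)).2 (by omega)
  refine ⟨i, by rw [hi, sq], ?_⟩
  rintro ⟨j, rfl⟩
  have hj0 : j ≠ 0 := by rintro rfl; simp at hi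
  have h1 := ZMod.pow_card_sub_one_eq_one hj0
  have h4 : j ^ 4 = -1 := by rw [hi]; ring
  have h2 : p - 1 = 4 * (2 * (p / 8) + 1) := by omega
  rw [h2, pow_mul, h4, Odd.neg_one_pow ⟨_, rfl⟩] at h1
  have h3 : ((2 : ℕ) : ZMod p) = 0 := by
    push_cast; linear_combination -h1
  rw [ZMod.natCast_eq_zero_iff] at h3
  have := Nat.le_of_dvd (by norm_num) h3
  have := (Fact.out : p.Prime).two_le
  interval_cases p; omega

/-- For `p ≡ 5 mod 8`, the local density at `0` is small. -/
lemma density_zero_le (h : p % 8 = 5) :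
    (biquadCount p 0 : ℝ) / p ^ 3 ≤ Real.exp (-(2 / p)) := by
  obtain ⟨i, hi, hns⟩ := exists_sqrt_neg_one h
  have hp : (3 : ℝ) ≤ p := by
    have : 5 ≤ p := by omega
    exact_mod_cast (by omega : 3 ≤ p)
  have h1 := biquadCount_zero_le hi hns
  refine le_trans ?_ (Real.add_one_le_exp _)
  rw [div_le_iff₀ (by positivity)]
  have : (-(2 / (p : ℝ)) + 1) * p ^ 3 = p ^ 3 - 2 * p ^ 2 := by field_simp; ring
  rw [this]
  nlinarith

/-- For `p ≡ 5 mod 8`, the local density is nowhere much bigger than `1`. -/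
lemma density_le (h : p % 8 = 5) (c : ZMod p) :
    (biquadCount p c : ℝ) / p ^ 3 ≤ Real.exp (100 * (p : ℝ) ^ (-(3 / 2) : ℝ)) := by
  have hp : (0 : ℝ) < p := by exact_mod_cast (Fact.out : p.Prime).pos
  rcases eq_or_ne c 0 with rfl | hc
  · refine (density_zero_le h).trans (Real.exp_le_exp.2 ?_)
    have h1 : 0 ≤ 2 / (p : ℝ) := by positivity
    have h2 : 0 ≤ 100 * (p : ℝ) ^ (-(3 / 2) : ℝ) := by positivity
    linarith
  · obtain ⟨i, hi, hns⟩ := exists_sqrt_neg_one h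
    have h1 := biquadCount_le hi hns hc
    refine le_trans ?_ (Real.add_one_le_exp _)
    rw [div_le_iff₀ (by positivity)]
    have e : (p : ℝ) ^ (-(3 / 2) : ℝ) * p ^ 3 = p * √p := by
      rw [Real.sqrt_eq_rpow, ← Real.rpow_natCast, ← Real.rpow_add hp]
      nth_rw 2 [← Real.rpow_one (p : ℝ)]
      rw [← Real.rpow_add hp]; norm_num
    linarith

end LocalDensity

/-- Chinese remainder theorem for the number of representations by four fourth powers. -/
lemma biquadCount_mul {m n : ℕ} [NeZero m] [NeZero n] [NeZero (m * n)] (h : m.Coprime n) (c : ℕ) :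
    biquadCount (m * n) c = biquadCount m c * biquadCount n c := by
  classical
  let e := ZMod.chineseRemainder h
  unfold biquadCount
  rw [← card_product]
  refine card_bij (fun v _ => (((e v.1).1, (e v.2.1).1, (e v.2.2.1).1, (e v.2.2.2).1),
    ((e v.1).2, (e v.2.1).2, (e v.2.2.1).2, (e v.2.2.2).2))) ?_ ?_ ?_
  · rintro ⟨x, y, z, w⟩ hv
    simp only [mem_filter, mem_univ, true_and] at hv
    have h1 := congrArg e hv
    simp only [map_add, map_pow, map_natCast] at h1
    simp only [mem_product, mem_filter, mem_univ, true_and]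
    exact ⟨by simpa using congrArg Prod.fst h1, by simpa using congrArg Prod.snd h1⟩
  · rintro ⟨x, y, z, w⟩ _ ⟨x', y', z', w'⟩ _ hv
    simp only [Prod.mk.injEq] at hv
    obtain ⟨⟨h1, h2, h3, h4⟩, h5, h6, h7, h8⟩ := hv
    simp only [Prod.mk.injEq]
    exact ⟨e.injective (Prod.ext h1 h5), e.injective (Prod.ext h2 h6),
      e.injective (Prod.ext h3 h7), e.injective (Prod.ext h4 h8)⟩
  · rintro ⟨⟨x, y, z, w⟩, x', y', z', w'⟩ hv
    simp only [mem_product, mem_filter, mem_univ, true_and] at hv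
    refine ⟨(e.symm (x, x'), e.symm (y, y'), e.symm (z, z'), e.symm (w, w')), ?_, by simp⟩
    simp only [mem_filter, mem_univ, true_and]
    apply e.injective
    simp only [map_add, map_pow, map_natCast, RingEquiv.apply_symm_apply]
    exact Prod.ext (by simpa using hv.1) (by simpa using hv.2)

/-- A product of local density bounds is a density bound for the product modulus. -/
lemma biquadCount_prod_le (P : Finset ℕ) (hP : ∀ p ∈ P, p.Prime) (c : ℕ) (f : ℕ → ℝ)
    (hf : ∀ p ∈ P, ∀ [NeZero p], (biquadCount p c : ℝ) / (p : ℝ) ^ 3 ≤ f p)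
    (Q : ℕ) [NeZero Q] (hQ : Q = ∏ p ∈ P, p) :
    (biquadCount Q c : ℝ) / (Q : ℝ) ^ 3 ≤ ∏ p ∈ P, f p := by
  induction P using Finset.induction_on generalizing Q with
  | empty =>
    rw [prod_empty] at hQ
    subst hQ
    rw [prod_empty, Nat.cast_one, one_pow, div_one]
    have : biquadCount 1 (c : ZMod 1) ≤ 1 := by
      unfold biquadCount
      exact (card_filter_le _ _).trans (by simp)
    exact_mod_cast this
  | insert p P hp ih =>
    rw [prod_insert hp] at hQ ⊢
    have hp' : p.Prime := hP p (mem_insert_self _ _)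
    have hR : ∏ r ∈ P, r ≠ 0 := prod_ne_zero_iff.2 fun r hr => (hP r (mem_insert_of_mem hr)).ne_zero
    have : NeZero p := ⟨hp'.ne_zero⟩
    have : NeZero (∏ r ∈ P, r) := ⟨hR⟩
    subst hQ
    have hc : p.Coprime (∏ r ∈ P, r) := Nat.Coprime.prod_right fun r hr =>
      (Nat.coprime_primes hp' (hP r (mem_insert_of_mem hr))).2 (by rintro rfl; exact hp hr)
    rw [biquadCount_mul hc]
    have h1 := hf p (mem_insert_self _ _)
    have h2 := ih (fun r hr => hP r (mem_insert_of_mem hr))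
      (fun r hr => hf r (mem_insert_of_mem hr)) _ rfl
    calc _ = ((biquadCount p (c : ZMod p) : ℝ) / (p : ℝ) ^ 3) *
          ((biquadCount (∏ r ∈ P, r) (c : ZMod (∏ r ∈ P, r)) : ℝ) /
            ((∏ r ∈ P, r : ℕ) : ℝ) ^ 3) := by
          rw [Nat.cast_mul, Nat.cast_mul, mul_pow, mul_div_mul_comm]
      _ ≤ _ := mul_le_mul h1 h2 (by positivity) (le_trans (by positivity) h1)

/-- A uniform upper bound for the densities of the sums of four fourth powers to moduli composed
of distinct primes `≡ 5 mod 8`. -/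
noncomputable def densityConst : ℝ := Real.exp (100 * ∑' n : ℕ, (n : ℝ) ^ (-(3 / 2) : ℝ))

lemma one_le_densityConst : 1 ≤ densityConst := by
  refine Real.one_le_exp (mul_nonneg (by norm_num) (tsum_nonneg fun n => by positivity))

lemma biquadCount_density_le (P : Finset ℕ) (hP : ∀ p ∈ P, p.Prime ∧ p % 8 = 5) (c : ℕ)
    (T : Finset ℕ) (hT : T ⊆ P) (hTc : ∀ p ∈ T, p ∣ c)
    (Q : ℕ) [NeZero Q] (hQ : Q = ∏ p ∈ P, p) :
    (biquadCount Q c : ℝ) / (Q : ℝ) ^ 3 ≤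
      densityConst * Real.exp (-2 * ∑ p ∈ T, (1 : ℝ) / p) := by
  classical
  have h1 := biquadCount_prod_le P (fun p hp => (hP p hp).1) c
    (fun p => Real.exp (100 * (p : ℝ) ^ (-(3 / 2) : ℝ) - if p ∈ T then 2 * (1 / (p : ℝ)) else 0))
    (by
      intro p hp _
      have : Fact p.Prime := ⟨(hP p hp).1⟩
      by_cases hpT : p ∈ T
      · rw [(ZMod.natCast_eq_zero_iff c p).2 (hTc p hpT)]
        refine (le_of_eq ?_).trans ((density_zero_le (hP p hp).2).trans (Real.exp_le_exp.2 ?_))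
        · rfl
        · have : 0 ≤ 100 * (p : ℝ) ^ (-(3 / 2) : ℝ) := by positivity
          rw [if_pos hpT, mul_one_div]; linarith
      · simp only [if_neg hpT, sub_zero]
        exact density_le (hP p hp).2 _) Q hQ
  refine h1.trans ?_
  rw [← Real.exp_sum, densityConst, ← Real.exp_add, Real.exp_le_exp, sum_sub_distrib, ← mul_sum]
  have hs : Summable fun n : ℕ => (n : ℝ) ^ (-(3 / 2) : ℝ) :=
    Real.summable_nat_rpow.2 (by norm_num)
  have h2 := hs.sum_le_tsum P (fun n _ => by positivity)
  have h3 : ∑ p ∈ P, (if p ∈ T then 2 * (1 / (p : ℝ)) else 0) = 2 * ∑ p ∈ T, (1 : ℝ) / p := by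
    rw [← sum_filter, filter_mem_eq_inter, inter_eq_right.2 hT, mul_sum]
  rw [h3]; linarith

lemma sum_range_mul_natCast_zmod {Q : ℕ} [NeZero Q] (m : ℕ) (φ : ZMod Q → ℕ) :
    ∑ x ∈ range (Q * m), φ x = m * ∑ u, φ u := by
  have h0 : ∑ x ∈ range Q, φ x = ∑ u, φ u := by
    refine sum_bij' (fun x _ => (x : ZMod Q)) (fun u _ => u.val) ?_ ?_ ?_ ?_ ?_
    · simp
    · intro u _; exact mem_range.2 u.val_lt
    · intro x hx; exact ZMod.val_cast_of_lt (mem_range.1 hx)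
    · intro u _; exact ZMod.natCast_zmod_val u
    · simp
  induction m with
  | zero => simp
  | succ m ih =>
    rw [Nat.mul_succ, sum_range_add, ih, ← h0]
    simp only [Nat.cast_add, Nat.cast_mul, CharP.cast_eq_zero, zero_mul, zero_add]
    ring

/-- The number of points of a box, whose side is a multiple of `Q`, at which the sum of four
fourth powers lies in a given residue class mod `Q`. -/
lemma sum_box_eq {Q : ℕ} [NeZero Q] (m : ℕ) (a : ZMod Q) :
    ∑ x ∈ range (Q * m), ∑ y ∈ range (Q * m), ∑ z ∈ range (Q * m), ∑ w ∈ range (Q * m),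
      (if ((x ^ 4 + (y ^ 4 + (z ^ 4 + w ^ 4)) : ℕ) : ZMod Q) = a then 1 else 0)
      = m ^ 4 * biquadCount Q a := by
  push_cast
  have h1 (b : ZMod Q) := sum_range_mul_natCast_zmod m
    fun w : ZMod Q => if b + w ^ 4 = a then 1 else 0
  have e (x y z w : ZMod Q) : x ^ 4 + (y ^ 4 + (z ^ 4 + w ^ 4)) = x ^ 4 + y ^ 4 + z ^ 4 + w ^ 4 := by
    ring
  simp only [e, h1]
  rw [sum_range_mul_natCast_zmod m fun x : ZMod Q => ∑ y ∈ range (Q * m), ∑ z ∈ range (Q * m),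
    m * ∑ w : ZMod Q, if x ^ 4 + (y : ZMod Q) ^ 4 + (z : ZMod Q) ^ 4 + w ^ 4 = a then 1 else 0]
  have h2 (x : ZMod Q) := sum_range_mul_natCast_zmod m fun y : ZMod Q =>
    m * ∑ z : ZMod Q, m * ∑ w : ZMod Q, if x ^ 4 + y ^ 4 + z ^ 4 + w ^ 4 = a then 1 else 0
  have h3 (x y : ZMod Q) := sum_range_mul_natCast_zmod m fun z : ZMod Q =>
    m * ∑ w : ZMod Q, if x ^ 4 + y ^ 4 + z ^ 4 + w ^ 4 = a then 1 else 0
  simp only [h3, h2]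
  unfold biquadCount
  simp only [card_filter, Fintype.sum_prod_type, e, ← mul_sum]
  ring

/-- Greedy splitting of a finite weighted set into `L` pieces of weight at least `s`. -/
lemma exists_disjoint_of_le_sum {ι : Type*} [DecidableEq ι] (P : Finset ι) (f : ι → ℝ)
    (hf0 : ∀ i ∈ P, 0 ≤ f i) (hf1 : ∀ i ∈ P, f i ≤ 1) {s : ℝ} (hs : 0 ≤ s) (L : ℕ)
    (hL : L * (s + 1) ≤ ∑ i ∈ P, f i) :
    ∃ T : ℕ → Finset ι, (∀ k < L, T k ⊆ P ∧ s ≤ ∑ i ∈ T k, f i) ∧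
      ∀ k < L, ∀ l < L, k ≠ l → Disjoint (T k) (T l) := by
  induction L generalizing P with
  | zero => exact ⟨fun _ => ∅, by simp, by simp⟩
  | succ L ih =>
    have key : ∀ R ⊆ P, ∃ U ⊆ R, ∑ i ∈ U, f i ≤ s + 1 ∧ (s ≤ ∑ i ∈ U, f i ∨ U = R) := by
      intro R
      induction R using Finset.induction_on with
      | empty => exact fun _ => ⟨∅, Subset.rfl, by simp; linarith, Or.inr rfl⟩
      | insert a R ha ih =>
        intro hR
        obtain ⟨U, hU, h1, h2⟩ := ih ((subset_insert _ _).trans hR)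
        rcases le_or_gt s (∑ i ∈ U, f i) with h | h
        · exact ⟨U, hU.trans (subset_insert _ _), h1, Or.inl h⟩
        · rcases h2 with h2 | rfl
          · linarith
          · refine ⟨insert a U, Subset.rfl, ?_, Or.inr rfl⟩
            rw [sum_insert ha]
            linarith [hf1 a (hR (mem_insert_self _ _))]
    obtain ⟨U, hU, h1, h2⟩ := key P Subset.rfl
    have hsum := sum_sdiff hU (f := f)
    push_cast at hL
    have h3 : s ≤ ∑ i ∈ U, f i := by
      rcases h2 with h2 | rfl
      · exact h2
      · nlinarith [(Nat.cast_nonneg L : (0 : ℝ) ≤ L)]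
    obtain ⟨T, hT, hd⟩ := ih (P \ U) (fun i hi => hf0 i (mem_sdiff.1 hi).1)
      (fun i hi => hf1 i (mem_sdiff.1 hi).1) (by linarith)
    refine ⟨fun k => if k = L then U else T k, ?_, ?_⟩
    · intro k hk
      by_cases hkL : k = L
      · simp [hkL, hU, h3]
      · simp only [if_neg hkL]
        have := hT k (by omega)
        exact ⟨this.1.trans sdiff_subset, this.2⟩
    · intro k hk l hl hkl
      by_cases hkL : k = L
      · subst hkL
        simp only [if_true, if_neg hkl.symm]
        exact (disjoint_sdiff.mono_right ((hT l (by omega)).1))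
      · by_cases hlL : l = L
        · subst hlL
          simp only [if_true, if_neg hkl]
          exact (disjoint_sdiff.mono_right ((hT k (by omega)).1)).symm
        · simp only [if_neg hkL, if_neg hlL]
          exact hd k (by omega) l (by omega) hkl

/-- There is `c` such that, for each `k < L`, all primes in `T k` divide `c + k + 1`. -/
lemma exists_dvd_add (L : ℕ) (T : ℕ → Finset ℕ) (hT : ∀ k < L, ∀ p ∈ T k, p.Prime)
    (hd : ∀ k < L, ∀ l < L, k ≠ l → Disjoint (T k) (T l)) :
    ∃ c : ℕ, ∀ k < L, ∀ p ∈ T k, p ∣ c + (k + 1) := by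
  classical
  let S : Finset (ℕ × ℕ) := (range L).sigma (fun k => T k) |>.image fun x => (x.1, x.2)
  have hS : ∀ x, x ∈ S ↔ x.1 < L ∧ x.2 ∈ T x.1 := by
    rintro ⟨k, p⟩
    simp [S]
  have hne : ∀ x ∈ S, x.2 ≠ 0 := fun x hx => (hT _ ((hS x).1 hx).1 _ ((hS x).1 hx).2).ne_zero
  obtain ⟨c, hc⟩ := Nat.chineseRemainderOfFinset (fun x : ℕ × ℕ => x.2 * (x.1 + 1) - (x.1 + 1))
    (fun x => x.2) S hne (by
      intro x hx y hy hxy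
      have hx' := (hS x).1 hx
      have hy' := (hS y).1 hy
      refine (Nat.coprime_primes (hT _ hx'.1 _ hx'.2) (hT _ hy'.1 _ hy'.2)).2 fun h => ?_
      by_cases h1 : x.1 = y.1
      · exact hxy (Prod.ext h1 h)
      · exact disjoint_left.1 (hd _ hx'.1 _ hy'.1 h1) hx'.2 (h ▸ hy'.2))
  refine ⟨c, fun k hk p hp => ?_⟩
  have h1 := hc (k, p) ((hS _).2 ⟨hk, hp⟩)
  simp only at h1
  have hp1 : 1 ≤ p := (hT k hk p hp).one_le
  have h2 := h1.add_right (k + 1)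
  rw [Nat.sub_add_cancel (Nat.le_mul_of_pos_left _ hp1)] at h2
  exact (Nat.modEq_zero_iff_dvd.1 (h2.trans (Nat.modEq_zero_iff_dvd.2 (dvd_mul_right _ _))))

open Classical in
/-- The indicator function of the fourth powers. -/
noncomputable def biquadInd (n : ℕ) : ℕ := if ∃ x, x ^ 4 = n then 1 else 0

/-- The number of representations of `n` as an ordered sum of `j` fourth powers of naturals. -/
noncomputable def biquadRep : ℕ → ℕ → ℕ
  | 0, n => if n = 0 then 1 else 0
  | j + 1, n => ∑ p ∈ antidiagonal n, biquadInd p.1 * biquadRep j p.2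

lemma biquadInd_pow (x : ℕ) : biquadInd (x ^ 4) = 1 := if_pos ⟨x, rfl⟩

lemma biquadInd_le_one (n : ℕ) : biquadInd n ≤ 1 := by
  unfold biquadInd; split_ifs <;> simp

lemma biquadInd_eq_zero {n : ℕ} (h : n ∉ Set.range fun x : ℕ => x ^ 4) : biquadInd n = 0 :=
  if_neg h

lemma biquadRep_succ (j n : ℕ) :
    biquadRep (j + 1) n = ∑ p ∈ antidiagonal n, biquadInd p.1 * biquadRep j p.2 := rfl

lemma biquadRep_le_add_pow (j n x : ℕ) : biquadRep j n ≤ biquadRep (j + 1) (n + x ^ 4) := by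
  rw [biquadRep_succ]
  have h : (x ^ 4, n) ∈ antidiagonal (n + x ^ 4) := by simp [add_comm]
  refine le_trans ?_ (single_le_sum (f := fun p : ℕ × ℕ => biquadInd p.1 * biquadRep j p.2)
    (fun _ _ => Nat.zero_le _) h)
  simp [biquadInd_pow]

lemma biquadRep_mono (n : ℕ) : Monotone fun j => biquadRep j n :=
  monotone_nat_of_le_succ fun j => by simpa using biquadRep_le_add_pow j n 0

lemma biquadRep_le_pow (j n : ℕ) : biquadRep j n ≤ (n + 1) ^ j := by
  induction j generalizing n with
  | zero => unfold biquadRep; split_ifs <;> simp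
  | succ j ih =>
    rw [biquadRep_succ, pow_succ, mul_comm]
    refine (sum_le_card_nsmul _ _ ((n + 1) ^ j) fun p hp => ?_).trans (by simp)
    have h1 : p.2 ≤ n := by have := mem_antidiagonal.1 hp; omega
    calc _ ≤ 1 * (p.2 + 1) ^ j := Nat.mul_le_mul (biquadInd_le_one _) (ih _)
      _ ≤ _ := by rw [one_mul]; gcongr

/-- Sums over values of `biquadRep` are bounded by sums over boxes. -/
lemma sum_biquadRep_le (B j : ℕ) (φ : ℕ → ℕ) :
    ∑ n ∈ range (B ^ 4), biquadRep (j + 1) n * φ n ≤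
      ∑ x ∈ range B, ∑ m ∈ range (B ^ 4), biquadRep j m * φ (x ^ 4 + m) := by
  have h1 : ∑ n ∈ range (B ^ 4), biquadRep (j + 1) n * φ n =
      ∑ n ∈ range (B ^ 4), ∑ p ∈ antidiagonal n,
        biquadInd p.1 * (biquadRep j p.2 * φ (p.1 + p.2)) := by
    refine sum_congr rfl fun n _ => ?_
    rw [biquadRep_succ, sum_mul]
    refine sum_congr rfl fun p hp => ?_
    rw [mem_antidiagonal.1 hp, mul_assoc]
  rw [h1, ← sum_product']
  rw [sum_sigma', ← sum_filter_of_ne (p := fun a : (_ : ℕ) × ℕ × ℕ => biquadInd a.2.1 ≠ 0)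
    (fun a _ h h' => h (by rw [h', zero_mul]))]
  have key : ∀ a : (_ : ℕ) × ℕ × ℕ, biquadInd a.2.1 ≠ 0 → ∃ x, x ^ 4 = a.2.1 := by
    intro a ha
    by_contra h
    exact ha (if_neg h)
  choose! g hg using key
  set F := ((range (B ^ 4)).sigma antidiagonal).filter fun a => biquadInd a.2.1 ≠ 0 with hF
  have hmem : ∀ a ∈ F, a.1 < B ^ 4 ∧ a.2.1 + a.2.2 = a.1 ∧ g a ^ 4 = a.2.1 := by
    intro a ha
    simp only [hF, mem_filter, mem_sigma, mem_range, HasAntidiagonal.mem_antidiagonal] at ha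
    exact ⟨ha.1.1, ha.1.2, hg a ha.2⟩
  have hinj : Set.InjOn (fun a : (_ : ℕ) × ℕ × ℕ => (g a, a.2.2)) F := by
    rintro ⟨a, b, c⟩ ha ⟨a', b', c'⟩ ha' h
    obtain ⟨-, h1, h2⟩ := hmem _ ha
    obtain ⟨-, h1', h2'⟩ := hmem _ ha'
    simp only [Prod.mk.injEq] at h h1 h2 h1' h2'
    obtain ⟨h3, rfl⟩ := h
    have hb : b = b' := by rw [← h2, ← h2', h3]
    subst hb
    have ha : a = a' := by rw [← h1, ← h1']
    subst ha
    rfl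
  calc _ ≤ ∑ a ∈ F, biquadRep j a.2.2 * φ (g a ^ 4 + a.2.2) := by
        refine sum_le_sum fun a ha => ?_
        rw [(hmem a ha).2.2]
        exact (Nat.mul_le_mul_right _ (biquadInd_le_one _)).trans (one_mul _).le
    _ = ∑ b ∈ F.image fun a => (g a, a.2.2), biquadRep j b.2 * φ (b.1 ^ 4 + b.2) :=
        (sum_image (f := fun b : ℕ × ℕ => biquadRep j b.2 * φ (b.1 ^ 4 + b.2)) hinj).symm
    _ ≤ _ := by
        refine sum_le_sum_of_subset fun b hb => ?_
        obtain ⟨a, ha, rfl⟩ := mem_image.1 hb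
        obtain ⟨h1, h2, h3⟩ := hmem a ha
        simp only [mem_product, mem_range]
        refine ⟨lt_of_pow_lt_pow_left₀ 4 (Nat.zero_le _) (by omega), by omega⟩

lemma hasSum_biquadInd {q : ℕ} (hq : 2 ≤ q) :
    HasSum (fun n => (biquadInd n : ℝ) * (1 / (q : ℝ)) ^ n) (theta4 q) := by
  have hq' : (2 : ℝ) ≤ q := by exact_mod_cast hq
  have hz0 : 0 ≤ 1 / (q : ℝ) := by positivity
  have hz1 : 1 / (q : ℝ) < 1 := by rw [div_lt_one (by linarith)]; linarith
  have hinj : Function.Injective fun x : ℕ => x ^ 4 := Nat.pow_left_injective (by norm_num)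
  rw [← hinj.hasSum_iff fun n hn => by rw [biquadInd_eq_zero hn]; simp]
  have h1 : (fun n => (biquadInd n : ℝ) * (1 / (q : ℝ)) ^ n) ∘ (fun x : ℕ => x ^ 4) =
      fun n : ℕ => (1 : ℝ) / (q : ℝ) ^ (n ^ 4) := by
    ext n
    simp [biquadInd_pow]
  rw [h1]
  refine Summable.hasSum ?_
  have := (summable_geometric_of_lt_one hz0 hz1).comp_injective hinj
  simpa [Function.comp_def] using this

/-- The power series expansion of the powers of `theta4 q`. -/
lemma hasSum_biquadRep {q : ℕ} (hq : 2 ≤ q) (j : ℕ) :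
    HasSum (fun n => (biquadRep j n : ℝ) * (1 / (q : ℝ)) ^ n) (theta4 q ^ j) := by
  induction j with
  | zero =>
    convert hasSum_ite_eq (0 : ℕ) (1 : ℝ) using 2 with n
    · unfold biquadRep
      split_ifs with h <;> simp [h]
    · simp
  | succ j ih =>
    have h1 := hasSum_biquadInd hq
    have n1 : Summable fun n => ‖(biquadInd n : ℝ) * (1 / (q : ℝ)) ^ n‖ := h1.summable.norm
    have n2 : Summable fun n => ‖(biquadRep j n : ℝ) * (1 / (q : ℝ)) ^ n‖ := ih.summable.norm
    have h2 : (fun n => (biquadRep (j + 1) n : ℝ) * (1 / (q : ℝ)) ^ n) = fun n =>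
        ∑ p ∈ antidiagonal n, ((biquadInd p.1 : ℝ) * (1 / (q : ℝ)) ^ p.1) *
          ((biquadRep j p.2 : ℝ) * (1 / (q : ℝ)) ^ p.2) := by
      ext n
      rw [biquadRep_succ]
      push_cast
      rw [sum_mul]
      refine sum_congr rfl fun p hp => ?_
      rw [← mem_antidiagonal.1 hp, pow_add]; ring
    rw [h2, pow_succ', ← ih.tsum_eq, ← h1.tsum_eq,
      tsum_mul_tsum_eq_tsum_sum_antidiagonal_of_summable_norm n1 n2]
    exact (summable_norm_sum_mul_antidiagonal_of_summable_norm n1 n2).of_norm.hasSum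

lemma sum_biquadRep_zero {B : ℕ} (hB : 0 < B) (φ : ℕ → ℕ) :
    ∑ n ∈ range (B ^ 4), biquadRep 0 n * φ n = φ 0 := by
  rw [sum_eq_single 0]
  · simp [biquadRep]
  · intro n _ hn; simp [biquadRep, hn]
  · intro h; exact absurd (mem_range.2 (by positivity)) h

/-- The number of sums of three fourth powers in an initial segment. -/
lemma card_biquadRep_three_le {B : ℕ} (hB : 0 < B) :
    #{n ∈ range (B ^ 4) | biquadRep 3 n ≠ 0} ≤ B ^ 3 := by
  have h1 : #{n ∈ range (B ^ 4) | biquadRep 3 n ≠ 0} ≤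
      ∑ n ∈ range (B ^ 4), biquadRep 3 n * 1 := by
    rw [card_filter]
    refine sum_le_sum fun n _ => ?_
    split_ifs with h <;> omega
  refine h1.trans ((sum_biquadRep_le B 2 fun _ => 1).trans ?_)
  refine (sum_le_sum fun x _ => sum_biquadRep_le B 1 fun _ => 1).trans ?_
  refine (sum_le_sum fun x _ => sum_le_sum fun y _ => sum_biquadRep_le B 0 fun _ => 1).trans ?_
  simp only [sum_biquadRep_zero hB (fun _ => 1), sum_const, card_range, smul_eq_mul]
  exact le_of_eq (by ring)

/-- The average of `biquadRep 4` over a residue class is at most the local density. -/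
lemma sum_biquadRep_four_le {Q : ℕ} [NeZero Q] {m : ℕ} (hm : 0 < m) (a : ℕ) :
    ∑ n ∈ range ((Q * m) ^ 4) with n ≡ a [MOD Q], biquadRep 4 n ≤ m ^ 4 * biquadCount Q a := by
  have hB : 0 < Q * m := Nat.mul_pos (NeZero.pos Q) hm
  set B := Q * m with hBdef
  set φ : ℕ → ℕ := fun n => if (n : ZMod Q) = (a : ZMod Q) then 1 else 0 with hφ
  have h1 : ∑ n ∈ range (B ^ 4) with n ≡ a [MOD Q], biquadRep 4 n =
      ∑ n ∈ range (B ^ 4), biquadRep 4 n * φ n := by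
    rw [sum_filter]
    refine sum_congr rfl fun n _ => ?_
    simp only [hφ, ZMod.natCast_eq_natCast_iff]
    split_ifs <;> simp
  rw [h1, ← sum_box_eq, ← hBdef]
  refine (sum_biquadRep_le B 3 φ).trans (sum_le_sum fun x _ => ?_)
  refine (sum_biquadRep_le B 2 fun n => φ (x ^ 4 + n)).trans (sum_le_sum fun y _ => ?_)
  refine (sum_biquadRep_le B 1 fun n => φ (x ^ 4 + (y ^ 4 + n))).trans (sum_le_sum fun z _ => ?_)
  refine (sum_biquadRep_le B 0 fun n => φ (x ^ 4 + (y ^ 4 + (z ^ 4 + n)))).trans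
    (sum_le_sum fun w _ => ?_)
  exact (sum_biquadRep_zero hB fun n => φ (x ^ 4 + (y ^ 4 + (z ^ 4 + (w ^ 4 + n))))).le

lemma card_Ico_modEq_le {Q : ℕ} (hQ : 0 < Q) (c a b : ℕ) (hab : a ≤ b) :
    (#{n ∈ Ico a b | n ≡ c [MOD Q]} : ℝ) ≤ ((b : ℝ) - a) / Q + 1 := by
  have h := Nat.Ico_filter_modEq_card a b hQ c
  have hQ' : (0 : ℚ) < Q := by exact_mod_cast hQ
  have h2 : (#{n ∈ Ico a b | n ≡ c [MOD Q]} : ℚ) ≤ ((b : ℚ) - a) / Q + 1 := by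
    have h3 : ((#{n ∈ Ico a b | n ≡ c [MOD Q]} : ℤ) : ℚ) ≤ ((b : ℚ) - a) / Q + 1 := by
      rw [h, Int.cast_max, Int.cast_sub]
      refine max_le ?_ ?_
      · have h4 := Int.ceil_lt_add_one (((b : ℚ) - c) / Q)
        have h5 := Int.le_ceil (((a : ℚ) - c) / Q)
        have h6 : ((b : ℚ) - a) / Q = ((b : ℚ) - c) / Q - ((a : ℚ) - c) / Q := by ring
        rw [h6]; linarith
      · have : (a : ℚ) ≤ b := by exact_mod_cast hab
        have : 0 ≤ ((b : ℚ) - a) / Q := div_nonneg (by linarith) hQ'.le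
        push_cast; linarith
    exact_mod_cast h3
  have h7 := (Rat.cast_le (K := ℝ)).2 h2
  push_cast at h7
  exact h7

lemma card_range_modEq {Q : ℕ} (hQ : 0 < Q) (c m : ℕ) :
    #{n ∈ range (Q * m) | n ≡ c [MOD Q]} = m := by
  rw [← Nat.count_eq_card_filter_range, Nat.count_modEq_card _ hQ]
  simp [Nat.mul_div_cancel_left _ hQ]

/-- `N` lies in the last quarter (up to `E`) of a gap of the set `R`. -/
def InGapTail (R : ℕ → Prop) (E N : ℕ) : Prop :=
  ∃ m m', m ≤ N ∧ N < m' ∧ R m ∧ R m' ∧ (∀ k, m < k → k < m' → ¬ R k) ∧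
    3 * m' + m ≤ 4 * N + 4 * E

open Classical in
lemma card_inGapTail_le {R : ℕ → Prop} (h0 : R 0) {Q : ℕ} (hQ : 0 < Q) (c E : ℕ) (Y : ℕ)
    (hY : R Y) :
    (#{N ∈ range Y | N ≡ c [MOD Q] ∧ InGapTail R E N} : ℝ) ≤
      Y / (4 * Q) + (E / Q + 1) * #{n ∈ range (Y + 1) | R n} := by
  have hQ' : (0 : ℝ) < Q := by exact_mod_cast hQ
  induction Y using Nat.strong_induction_on with
  | _ Y ih =>
  rcases Nat.eq_zero_or_pos Y with rfl | hpos
  · simp only [range_zero, filter_empty, card_empty, CharP.cast_eq_zero]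
    positivity
  · set Z := Nat.findGreatest R (Y - 1) with hZ
    have hZR : R Z := Nat.findGreatest_spec (Nat.zero_le _) h0
    have hZY : Z < Y := by
      have := Nat.findGreatest_le (P := R) (Y - 1)
      omega
    have hgap : ∀ k, Z < k → k < Y → ¬ R k := fun k h1 h2 =>
      Nat.findGreatest_is_greatest h1 (by omega)
    have h1 := ih Z hZY hZR
    set a := max Z ((3 * Y + Z + 3) / 4 - E) with ha
    have hsub : ({N ∈ range Y | N ≡ c [MOD Q] ∧ InGapTail R E N} : Finset ℕ) ⊆
        ({N ∈ range Z | N ≡ c [MOD Q] ∧ InGapTail R E N} : Finset ℕ) ∪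
          ({N ∈ Ico (min a Y) Y | N ≡ c [MOD Q]} : Finset ℕ) := by
      intro N hN
      simp only [mem_filter, mem_range, mem_union, mem_Ico] at hN ⊢
      obtain ⟨hNY, hNc, hN⟩ := hN
      rcases lt_or_ge N Z with h | h
      · exact Or.inl ⟨h, hNc, hN⟩
      · refine Or.inr ⟨⟨?_, hNY⟩, hNc⟩
        obtain ⟨m, m', h2, h3, h4, h5, h6, h7⟩ := hN
        have hm : m = Z := by
          rcases lt_trichotomy m Z with h8 | h8 | h8
          · exact absurd hZR (h6 Z h8 (by omega))
          · exact h8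
          · exact absurd h4 (hgap m h8 (by omega))
        have hm' : m' = Y := by
          rcases lt_trichotomy m' Y with h8 | h8 | h8
          · exact absurd h5 (hgap m' (by omega) h8)
          · exact h8
          · exact absurd hY (h6 Y (by omega) h8)
        subst hm hm'
        omega
    have h2 := (card_le_card hsub).trans (card_union_le _ _)
    have h3 := card_Ico_modEq_le hQ c (min a Y) Y (min_le_right _ _)
    have h4 : #{n ∈ range (Z + 1) | R n} + 1 ≤ #{n ∈ range (Y + 1) | R n} := by
      rw [← card_insert_of_notMem (a := Y) (by simp; omega)]
      refine card_le_card fun n hn => ?_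
      simp only [mem_insert, mem_filter, mem_range] at hn ⊢
      rcases hn with rfl | hn
      · exact ⟨by omega, hY⟩
      · exact ⟨by omega, hn.2⟩
    have h5 : 4 * Y ≤ 4 * min a Y + (Y - Z) + 4 * E := by omega
    have h6 : 4 * (Y : ℝ) ≤ 4 * (min a Y : ℕ) + (Y - Z) + 4 * E := by
      have : ((4 * Y : ℕ) : ℝ) ≤ ((4 * min a Y + (Y - Z) + 4 * E : ℕ) : ℝ) := by exact_mod_cast h5
      rw [Nat.cast_add, Nat.cast_add, Nat.cast_sub hZY.le] at this
      push_cast at this ⊢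
      linarith
    have h7 : ((Y : ℝ) - (min a Y : ℕ)) / Q ≤ (Y - Z) / (4 * Q) + E / Q := by
      rw [div_add_div _ _ (by positivity) (by positivity), div_le_div_iff₀ hQ' (by positivity)]
      nlinarith [mul_pos hQ' hQ']
    have h2' : (#{N ∈ range Y | N ≡ c [MOD Q] ∧ InGapTail R E N} : ℝ) ≤
        #{N ∈ range Z | N ≡ c [MOD Q] ∧ InGapTail R E N} +
          #{N ∈ Ico (min a Y) Y | N ≡ c [MOD Q]} := by exact_mod_cast h2
    have h4' : (#{n ∈ range (Z + 1) | R n} : ℝ) + 1 ≤ #{n ∈ range (Y + 1) | R n} := by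
      exact_mod_cast h4
    have h8 := mul_le_mul_of_nonneg_left h4' (by positivity : 0 ≤ (E : ℝ) / Q + 1)
    have h9 : (Y : ℝ) / (4 * Q) = Z / (4 * Q) + (Y - Z) / (4 * Q) := by ring
    linarith

/-- Weighted averages of `biquadRep 4` over shifts of a residue class. -/
lemma sum_weighted_biquadRep_le {Q : ℕ} [NeZero Q] {m : ℕ} (hm : 0 < m) (c K : ℕ) (g : ℕ → ℝ)
    (hg : ∀ k, 0 ≤ g k) (s : Finset ℕ) (hs : ∀ N ∈ s, N + K < (Q * m) ^ 4 ∧ N ≡ c [MOD Q]) :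
    ∑ N ∈ s, ∑ k ∈ range K, g k * biquadRep 4 (N + (k + 1)) ≤
      m ^ 4 * Q ^ 3 * ∑ k ∈ range K, g k * ((biquadCount Q (c + (k + 1) : ℕ) : ℝ) / Q ^ 3) := by
  have hQ : (0 : ℝ) < Q := by exact_mod_cast NeZero.pos Q
  rw [sum_comm, mul_sum]
  refine sum_le_sum fun k hk => ?_
  rw [← mul_sum]
  have h1 : ∑ N ∈ s, biquadRep 4 (N + (k + 1)) ≤
      ∑ n ∈ range ((Q * m) ^ 4) with n ≡ c + (k + 1) [MOD Q], biquadRep 4 n := by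
    rw [← sum_image (f := fun n => biquadRep 4 n) (g := fun N => N + (k + 1))
      (fun a _ b _ h => Nat.add_right_cancel h)]
    refine sum_le_sum_of_subset fun n hn => ?_
    obtain ⟨N, hN, rfl⟩ := mem_image.1 hn
    have := mem_range.1 hk
    exact mem_filter.2 ⟨mem_range.2 (by have := (hs N hN).1; omega), (hs N hN).2.add_right _⟩
  have h2 := h1.trans (sum_biquadRep_four_le hm _)
  have h3 : (∑ N ∈ s, (biquadRep 4 (N + (k + 1)) : ℝ)) ≤
      m ^ 4 * biquadCount Q (c + (k + 1) : ℕ) := by exact_mod_cast h2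
  refine (mul_le_mul_of_nonneg_left h3 (hg k)).trans (le_of_eq ?_)
  field_simp

lemma biquadRep_zero_ne_zero (j : ℕ) : biquadRep j 0 ≠ 0 := by
  have h := biquadRep_mono 0 (Nat.zero_le j)
  simp only [biquadRep] at h
  simp at h
  omega

lemma biquadRep_three_pow_ne_zero (x : ℕ) : biquadRep 3 (x ^ 4) ≠ 0 := by
  have h := biquadRep_le_add_pow 2 0 x
  have h' := biquadRep_zero_ne_zero 2
  rw [zero_add] at h
  exact Nat.ne_of_gt ((Nat.pos_of_ne_zero h').trans_le h)

/-- If the weighted densities are small then some `N` in the residue class avoids small gaps of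
the sums of three fourth powers, and the weighted count of representations after `N` is small. -/
lemma exists_good {Q : ℕ} [NeZero Q] {m : ℕ} (c K E : ℕ) (g : ℕ → ℝ) (hg : ∀ k, 0 ≤ g k)
    (hB : 100 * (E + K + Q) ≤ Q * m)
    (hgs : ∑ k ∈ range K, g k * ((biquadCount Q (c + (k + 1) : ℕ) : ℝ) / Q ^ 3) ≤ 1 / 8) :
    ∃ N, N + K < (Q * m) ^ 4 ∧ ∑ k ∈ range K, g k * biquadRep 4 (N + (k + 1)) < 1 ∧
      ¬ InGapTail (fun n => biquadRep 3 n ≠ 0) E N := by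
  classical
  have hQ0 : 0 < Q := NeZero.pos Q
  have hQ : (1 : ℝ) ≤ Q := by exact_mod_cast hQ0
  have hm : 0 < m := by
    rcases Nat.eq_zero_or_pos m with rfl | h
    · rw [mul_zero] at hB; omega
    · exact h
  by_contra! hcon
  set B := Q * m with hBdef
  have hB0 : 0 < B := Nat.mul_pos hQ0 hm
  set S1 : Finset ℕ := {N ∈ range (B ^ 4) | N ≡ c [MOD Q] ∧ N + K < B ^ 4 ∧
    1 ≤ ∑ k ∈ range K, g k * biquadRep 4 (N + (k + 1))} with hS1
  set S2 : Finset ℕ := {N ∈ range (B ^ 4) | N ≡ c [MOD Q] ∧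
    InGapTail (fun n => biquadRep 3 n ≠ 0) E N} with hS2
  set S3 : Finset ℕ := {N ∈ Ico (B ^ 4 - K) (B ^ 4) | N ≡ c [MOD Q]} with hS3
  have hcover : ({N ∈ range (B ^ 4) | N ≡ c [MOD Q]} : Finset ℕ) ⊆ S1 ∪ (S2 ∪ S3) := by
    intro N hN
    simp only [hS1, hS2, hS3, mem_union, mem_filter, mem_range, mem_Ico] at hN ⊢
    by_cases h : N + K < B ^ 4
    · by_cases h' : 1 ≤ ∑ k ∈ range K, g k * (biquadRep 4 (N + (k + 1)) : ℝ)
      · exact Or.inl ⟨hN.1, hN.2, h, h'⟩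
      · exact Or.inr (Or.inl ⟨hN.1, hN.2, hcon N h (not_le.1 h')⟩)
    · exact Or.inr (Or.inr ⟨⟨by omega, hN.1⟩, hN.2⟩)
  have hcard : (#{N ∈ range (B ^ 4) | N ≡ c [MOD Q]} : ℝ) ≤ #S1 + (#S2 + #S3) := by
    exact_mod_cast (card_le_card hcover).trans ((card_union_le _ _).trans
      (Nat.add_le_add_left (card_union_le _ _) _))
  have hX : B ^ 4 = Q * (Q ^ 3 * m ^ 4) := by rw [hBdef]; ring
  have hall : #{N ∈ range (B ^ 4) | N ≡ c [MOD Q]} = Q ^ 3 * m ^ 4 := by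
    rw [hX]; exact card_range_modEq hQ0 _ _
  have hc1 : (#S1 : ℝ) ≤ m ^ 4 * Q ^ 3 * (1 / 8) := by
    calc (#S1 : ℝ) = ∑ N ∈ S1, (1 : ℝ) := by simp
      _ ≤ ∑ N ∈ S1, ∑ k ∈ range K, g k * biquadRep 4 (N + (k + 1)) :=
        sum_le_sum fun N hN => (mem_filter.1 hN).2.2.2
      _ ≤ _ := sum_weighted_biquadRep_le hm c K g hg S1 fun N hN =>
        ⟨(mem_filter.1 hN).2.2.1, (mem_filter.1 hN).2.1⟩
      _ ≤ _ := by gcongr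
  have hc2 : (#S2 : ℝ) ≤ (B ^ 4 : ℕ) / (4 * Q) +
      (E / Q + 1) * #{n ∈ range (B ^ 4 + 1) | biquadRep 3 n ≠ 0} := by
    convert card_inGapTail_le (R := fun n => biquadRep 3 n ≠ 0) (biquadRep_zero_ne_zero 3) hQ0 c E
      (B ^ 4) (biquadRep_three_pow_ne_zero B)
  have hR : #{n ∈ range (B ^ 4 + 1) | biquadRep 3 n ≠ 0} ≤ (B + 1) ^ 3 := by
    refine (card_le_card (filter_subset_filter _ (range_subset_range.2 ?_))).trans
      (card_biquadRep_three_le (Nat.succ_pos B))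
    exact Nat.pow_lt_pow_left (Nat.lt_succ_self B) (by norm_num)
  have hR' : (#{n ∈ range (B ^ 4 + 1) | biquadRep 3 n ≠ 0} : ℝ) ≤ (B + 1) ^ 3 := by
    exact_mod_cast hR
  have hc3 : (#S3 : ℝ) ≤ K / Q + 1 := by
    refine (card_Ico_modEq_le hQ0 c _ _ (Nat.sub_le _ _)).trans ?_
    gcongr
    have : B ^ 4 ≤ (B ^ 4 - K) + K := by omega
    have : ((B ^ 4 : ℕ) : ℝ) ≤ ((B ^ 4 - K : ℕ) : ℝ) + K := by exact_mod_cast this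
    linarith
  rw [hall] at hcard
  have hB1 : (1 : ℝ) ≤ B := by exact_mod_cast hB0
  have hBR : 100 * ((E : ℝ) + K + Q) ≤ B := by exact_mod_cast hB
  have hXR : (B : ℝ) ^ 4 = Q * (Q ^ 3 * m ^ 4) := by exact_mod_cast hX
  have h1 : ((E : ℝ) / Q + 1) * #{n ∈ range (B ^ 4 + 1) | biquadRep 3 n ≠ 0} ≤
      (E / Q + 1) * (B + 1) ^ 3 := mul_le_mul_of_nonneg_left hR' (by positivity)
  have h2 : ((Q ^ 3 * m ^ 4 : ℕ) : ℝ) = B ^ 4 / Q := by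
    push_cast; rw [hXR]; field_simp
  have h3 : (m : ℝ) ^ 4 * Q ^ 3 * (1 / 8) = B ^ 4 / Q / 8 := by
    rw [hXR]; field_simp
  have h4 : (B : ℝ) ^ 4 / Q ≤ B ^ 4 / Q / 8 + ((B ^ 4 / (4 * Q) + (E / Q + 1) * (B + 1) ^ 3) +
      (K / Q + 1)) := by
    rw [h2] at hcard
    rw [h3] at hc1
    push_cast at hc2
    linarith
  have h5 : (B : ℝ) ^ 4 * (5 / 8) ≤ (E + Q) * (B + 1) ^ 3 + (K + Q) := by
    have h6 := mul_le_mul_of_nonneg_left h4 (by positivity : (0 : ℝ) ≤ Q)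
    have h7 : (Q : ℝ) * (B ^ 4 / Q) = B ^ 4 := by field_simp
    have h8 : (Q : ℝ) * (B ^ 4 / Q / 8 + ((B ^ 4 / (4 * Q) + (E / Q + 1) * (B + 1) ^ 3) +
      (K / Q + 1))) = B ^ 4 / 8 + (B ^ 4 / 4 + (E + Q) * (B + 1) ^ 3 + (K + Q)) := by
      field_simp
    rw [h7, h8] at h6
    linarith
  have h9 : ((B : ℝ) + 1) ^ 3 ≤ 8 * B ^ 3 := by
    calc ((B : ℝ) + 1) ^ 3 ≤ (2 * B) ^ 3 := by gcongr; linarith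
      _ = _ := by ring
  have hE : (0 : ℝ) ≤ E := Nat.cast_nonneg _
  have hK : (0 : ℝ) ≤ K := Nat.cast_nonneg _
  have hB3 : (1 : ℝ) ≤ B ^ 3 := one_le_pow₀ hB1
  have h10 : ((E : ℝ) + Q) * (B + 1) ^ 3 ≤ (E + Q) * (8 * B ^ 3) := by gcongr
  have h11 : (K : ℝ) + Q ≤ (K + Q) * (8 * B ^ 3) := by nlinarith
  have h12 : ((E : ℝ) + Q) * (8 * B ^ 3) + (K + Q) * (8 * B ^ 3) ≤ 16 * (B / 100) * B ^ 3 := by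
    nlinarith
  nlinarith

lemma exists_pow_four_le_lt (d : ℕ) : ∃ w, w ^ 4 ≤ d ∧ d < (w + 1) ^ 4 := by
  have hex : ∃ w, d < (w + 1) ^ 4 :=
    ⟨d, lt_of_lt_of_le (Nat.lt_succ_self d) (Nat.le_self_pow (by norm_num) _)⟩
  classical
  refine ⟨Nat.find hex, ?_, Nat.find_spec hex⟩
  rcases Nat.eq_zero_or_pos (Nat.find hex) with h | h
  · rw [h]; simp
  · have h1 := Nat.find_min hex (Nat.sub_lt h one_pos)
    rwa [Nat.sub_add_cancel (show 1 ≤ Nat.find hex from h), not_lt] at h1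

lemma four_mul_add_one_pow_four_le (w : ℕ) : 4 * (w + 1) ^ 4 ≤ 5 * w ^ 4 + 12000 := by
  rcases le_or_gt w 18 with h | h
  · interval_cases w <;> norm_num
  · obtain ⟨v, rfl⟩ := Nat.exists_eq_add_of_le h
    ring_nf
    nlinarith [Nat.zero_le v, Nat.zero_le (v ^ 2), Nat.zero_le (v ^ 3), Nat.zero_le (v ^ 4)]

lemma add_one_pow_four_le (w : ℕ) : (w + 1) ^ 4 ≤ 16 * w ^ 4 + 1 := by
  rcases Nat.eq_zero_or_pos w with rfl | h
  · norm_num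
  · calc (w + 1) ^ 4 ≤ (2 * w) ^ 4 := Nat.pow_le_pow_left (by omega) 4
      _ ≤ _ := by rw [mul_pow]; omega

/-- If `N` is not close to the end of a gap of the set of sums of three fourth powers, some sum of
four fourth powers `M > N` is followed by many numbers not in that set. -/
lemma exists_biquadRep_of_not_inGapTail {K N : ℕ}
    (h : ¬ InGapTail (fun n => biquadRep 3 n ≠ 0) (K + 3000) N) :
    ∃ M, N < M ∧ M ≤ 17 * N + 1 ∧ biquadRep 4 M ≠ 0 ∧
      ∀ n, N < n → n ≤ M + K → biquadRep 3 n = 0 := by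
  classical
  set m := Nat.findGreatest (fun n => biquadRep 3 n ≠ 0) N with hm
  have hmR : biquadRep 3 m ≠ 0 :=
    Nat.findGreatest_spec (P := fun n => biquadRep 3 n ≠ 0) (Nat.zero_le _)
      (biquadRep_zero_ne_zero 3)
  have hmN : m ≤ N := Nat.findGreatest_le N
  obtain ⟨w, hw1, hw2⟩ := exists_pow_four_le_lt (N - m)
  have hw3 := add_one_pow_four_le w
  have hw4 := four_mul_add_one_pow_four_le w
  refine ⟨m + (w + 1) ^ 4, by omega, by omega, ?_, ?_⟩
  · exact ((Nat.pos_of_ne_zero hmR).trans_le (biquadRep_le_add_pow 3 m (w + 1))).ne'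
  · by_contra! hcon
    obtain ⟨n, hn1, hn2, hn3⟩ := hcon
    have hex : ∃ n, N < n ∧ biquadRep 3 n ≠ 0 := ⟨n, hn1, hn3⟩
    have h1 := Nat.find_spec hex
    have h2 := Nat.find_min' hex ⟨hn1, hn3⟩
    refine h ⟨m, Nat.find hex, hmN, h1.1, hmR, h1.2, fun k hk1 hk2 => ?_, by omega⟩
    rcases le_or_gt k N with h3 | h3
    · exact Nat.findGreatest_is_greatest (P := fun n => biquadRep 3 n ≠ 0) hk1 h3
    · exact fun h4 => Nat.find_min hex hk2 ⟨h3, h4⟩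

section LowerBound

variable {q : ℕ} {a : ℕ → ℤ} {S : ℝ}

lemma summable_tail (hS : Summable fun n => (a n : ℝ) * (1 / (q : ℝ)) ^ n) (hq : 2 ≤ q) (M : ℕ) :
    Summable fun k => (a (M + 1 + k) : ℝ) * (1 / (q : ℝ)) ^ (k + 1) := by
  have hq0 : (q : ℝ) ≠ 0 := by positivity
  refine (((summable_nat_add_iff (M + 1)).2 hS).mul_left ((q : ℝ) ^ M)).congr fun k => ?_
  rw [add_comm k (M + 1), show M + 1 + k = M + (k + 1) by ring, pow_add]
  simp only [one_div, inv_pow]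
  field_simp

/-- Multiplying a power series in `1 / q` by `q ^ M` gives an integer plus a tail. -/
lemma pow_mul_eq_add_tail (hS : HasSum (fun n => (a n : ℝ) * (1 / (q : ℝ)) ^ n) S)
    (hq : 2 ≤ q) (M : ℕ) :
    (q : ℝ) ^ M * S = ((∑ n ∈ range (M + 1), a n * (q : ℤ) ^ (M - n) : ℤ) : ℝ) +
      ∑' k, (a (M + 1 + k) : ℝ) * (1 / (q : ℝ)) ^ (k + 1) := by
  have hq0 : (q : ℝ) ≠ 0 := by positivity
  rw [← hS.tsum_eq, ← hS.summable.sum_add_tsum_nat_add (M + 1), mul_add, mul_sum, ← tsum_mul_left]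
  congr 1
  · push_cast
    refine sum_congr rfl fun n hn => ?_
    have h1 : (q : ℝ) ^ M = q ^ n * q ^ (M - n) := by
      rw [← pow_add]; congr 1; have := mem_range.1 hn; omega
    rw [h1, one_div, inv_pow]; field_simp
  · refine tsum_congr fun k => ?_
    rw [add_comm k (M + 1), show M + 1 + k = M + (k + 1) by ring, pow_add]
    simp only [one_div, inv_pow]
    field_simp

lemma abs_far_tail_le {G : ℝ} (hS : Summable fun n => (a n : ℝ) * (1 / (q : ℝ)) ^ n) (hq : 2 ≤ q)
    (ha : ∀ n, |(a n : ℝ)| ≤ G * biquadRep 4 n) (M K : ℕ) :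
    |(∑' k, (a (M + 1 + k) : ℝ) * (1 / (q : ℝ)) ^ (k + 1)) -
        ∑ k ∈ range K, (a (M + 1 + k) : ℝ) * (1 / (q : ℝ)) ^ (k + 1)| ≤
      ∑' k, G * biquadRep 4 (M + 1 + (k + K)) * (1 / (q : ℝ)) ^ (k + K + 1) := by
  have hs := summable_tail hS hq M
  rw [← hs.sum_add_tsum_nat_add K, add_sub_cancel_left, ← Real.norm_eq_abs]
  have h1 := ((summable_nat_add_iff K).2 (summable_tail
    (a := fun n => (biquadRep 4 n : ℤ)) (by simpa using (hasSum_biquadRep hq 4).summable)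
    hq M)).mul_left G
  refine tsum_of_norm_bounded (h1.congr fun k => ?_).hasSum fun k => ?_
  · push_cast; ring
  · rw [norm_mul, Real.norm_eq_abs, norm_pow, Real.norm_of_nonneg (by positivity)]
    exact mul_le_mul_of_nonneg_right (ha _) (by positivity)

/-- The main lower bound, conditional on the existence of a suitable residue class `c` mod `Q`. -/
lemma lower_bound_of_density {G : ℝ} (hG : 0 ≤ G) (hq : 2 ≤ q)
    (hS : HasSum (fun n => (a n : ℝ) * (1 / (q : ℝ)) ^ n) S)
    (ha : ∀ n, |(a n : ℝ)| ≤ G * biquadRep 4 n)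
    (ha' : ∀ n, biquadRep 3 n = 0 → (biquadRep 4 n : ℤ) ≤ a n)
    {Q : ℕ} [NeZero Q] {m c L K : ℕ} (hB : 100 * (K + 3000 + K + Q) ≤ Q * m)
    (hdens : ∑ k ∈ range K, (if k < L then 1 else 2 * G * (1 / (q : ℝ)) ^ (k + 1)) *
      ((biquadCount Q (c + (k + 1) : ℕ) : ℝ) / Q ^ 3) ≤ 1 / 8)
    (htail : ∀ M ≤ 17 * (Q * m) ^ 4,
      ∑' k, G * biquadRep 4 (M + 1 + (k + K)) * (1 / (q : ℝ)) ^ (k + K + 1) ≤ 1 / 4) :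
    (1 / (q : ℝ)) ^ (17 * (Q * m) ^ 4) / 4 ≤ |S| := by
  have hq0 : (0 : ℝ) < q := by positivity
  have hq1 : (1 : ℝ) ≤ q := by exact_mod_cast (by omega : 1 ≤ q)
  obtain ⟨N, hN, hW, hgap⟩ := exists_good c K (K + 3000) _ (fun k => by positivity) hB hdens
  obtain ⟨M, hNM, hM17, hM4, hgap⟩ := exists_biquadRep_of_not_inGapTail hgap
  by_contra! hcon
  have hsmall : ∀ j ≤ 17 * (Q * m) ^ 4, (q : ℝ) ^ j * |S| < 1 / 4 := by
    intro j hj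
    have h1 : (q : ℝ) ^ j ≤ q ^ (17 * (Q * m) ^ 4) := pow_le_pow_right₀ hq1 hj
    calc (q : ℝ) ^ j * |S| ≤ q ^ (17 * (Q * m) ^ 4) * |S| := by gcongr
      _ < q ^ (17 * (Q * m) ^ 4) * ((1 / (q : ℝ)) ^ (17 * (Q * m) ^ 4) / 4) := by gcongr
      _ = 1 / 4 := by rw [one_div, inv_pow]; field_simp
  have hMX : M ≤ 17 * (Q * m) ^ 4 := by omega
  have hz : ∀ k, 0 ≤ (1 / (q : ℝ)) ^ k := fun k => by positivity
  -- the head of the tail at `N` is small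
  have hhead : |∑ k ∈ range K, (a (N + 1 + k) : ℝ) * (1 / (q : ℝ)) ^ (k + 1)| ≤ 1 / 2 := by
    have hterm : ∀ k ∈ range K, |(a (N + 1 + k) : ℝ) * (1 / (q : ℝ)) ^ (k + 1)| ≤
        1 / 2 * ((if k < L then 1 else 2 * G * (1 / (q : ℝ)) ^ (k + 1)) *
          biquadRep 4 (N + (k + 1))) := by
      intro k hk
      have h1 := ha (N + 1 + k)
      rw [show N + 1 + k = N + (k + 1) by ring] at h1 ⊢
      rw [abs_mul, abs_of_nonneg (hz _)]
      split_ifs with hkL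
      · have h2 := single_le_sum (f := fun k =>
          (if k < L then 1 else 2 * G * (1 / (q : ℝ)) ^ (k + 1)) *
            (biquadRep 4 (N + (k + 1)) : ℝ)) (fun i _ => by positivity) hk
        simp only [if_pos hkL, one_mul] at h2
        have h3 : biquadRep 4 (N + (k + 1)) = 0 := by
          have : (biquadRep 4 (N + (k + 1)) : ℝ) < 1 := lt_of_le_of_lt h2 hW
          have : biquadRep 4 (N + (k + 1)) < 1 := by exact_mod_cast this
          omega
        rw [h3] at h1 ⊢
        simp only [CharP.cast_eq_zero, mul_zero] at h1 ⊢
        rw [le_antisymm h1 (abs_nonneg _), zero_mul]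
      · calc _ ≤ G * biquadRep 4 (N + (k + 1)) * (1 / (q : ℝ)) ^ (k + 1) :=
            mul_le_mul_of_nonneg_right h1 (hz _)
          _ = _ := by ring
    refine (abs_sum_le_sum_abs _ _).trans ((sum_le_sum hterm).trans ?_)
    rw [← mul_sum]
    linarith
  have hIN : ∑ n ∈ range (N + 1), a n * (q : ℤ) ^ (N - n) = 0 := by
    have h1 := pow_mul_eq_add_tail hS hq N
    have h2 := (abs_far_tail_le hS.summable hq ha N K).trans (htail N (by omega))
    have h3 := hsmall N (by omega)
    have h4 : |(q : ℝ) ^ N * S| < 1 / 4 := by rwa [abs_mul, abs_of_nonneg (by positivity)]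
    have h5 : |((∑ n ∈ range (N + 1), a n * (q : ℤ) ^ (N - n) : ℤ) : ℝ)| < 1 := by
      rw [abs_le] at h2 hhead
      rw [abs_lt] at h4 ⊢
      constructor <;> linarith
    exact Int.abs_lt_one_iff.1 (by exact_mod_cast h5)
  have hpos : ∀ n, N < n → n ≤ M + K → 0 ≤ a n := fun n h1 h2 =>
    (Int.natCast_nonneg _).trans (ha' n (hgap n h1 h2))
  have hIM : 1 ≤ ∑ n ∈ range (M + 1), a n * (q : ℤ) ^ (M - n) := by
    rw [← sum_range_add_sum_Ico _ (by omega : N + 1 ≤ M + 1)]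
    have h1 : ∑ n ∈ range (N + 1), a n * (q : ℤ) ^ (M - n) =
        q ^ (M - N) * ∑ n ∈ range (N + 1), a n * (q : ℤ) ^ (N - n) := by
      rw [mul_sum]
      refine sum_congr rfl fun n hn => ?_
      have := mem_range.1 hn
      rw [show M - n = (M - N) + (N - n) by omega, pow_add]; ring
    rw [h1, hIN, mul_zero, zero_add]
    have h2 := single_le_sum (s := Ico (N + 1) (M + 1)) (f := fun n => a n * (q : ℤ) ^ (M - n))
      (fun n hn => by
        have := mem_Ico.1 hn
        exact mul_nonneg (hpos n (by omega) (by omega)) (by positivity))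
      (mem_Ico.2 ⟨hNM, Nat.lt_succ_self M⟩)
    simp only [Nat.sub_self, pow_zero, mul_one] at h2
    have h3 := ha' M (hgap M hNM (by omega))
    omega
  have h1 := pow_mul_eq_add_tail hS hq M
  have h2 := (abs_far_tail_le hS.summable hq ha M K).trans (htail M hMX)
  have h3 : 0 ≤ ∑ k ∈ range K, (a (M + 1 + k) : ℝ) * (1 / (q : ℝ)) ^ (k + 1) := by
    refine sum_nonneg fun k hk => mul_nonneg ?_ (hz _)
    have := mem_range.1 hk
    exact_mod_cast hpos (M + 1 + k) (by omega) (by omega)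
  have h4 : (1 : ℝ) ≤ ((∑ n ∈ range (M + 1), a n * (q : ℤ) ^ (M - n) : ℤ) : ℝ) := by
    exact_mod_cast hIM
  have h5 := hsmall M hMX
  have h6 : (q : ℝ) ^ M * S ≤ q ^ M * |S| := by gcongr; exact le_abs_self S
  have h7 := (abs_le.1 h2).1
  linarith

end LowerBound

lemma sum_geometric_tail_le {z : ℝ} (hz0 : 0 ≤ z) (hz : 2 * z ≤ 1) {L K : ℕ} (hLK : L ≤ K) :
    ∑ k ∈ Ico L K, z ^ (k + 1) ≤ z ^ L := by
  have h : ∑ k ∈ Ico L K, z ^ (k + 1) ≤ z ^ L - z ^ K := by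
    induction K, hLK using Nat.le_induction with
    | base => simp
    | succ K hK ih =>
      rw [sum_Ico_succ_top hK]
      have : z ^ (K + 1) = z * z ^ K := pow_succ' z K
      nlinarith [pow_nonneg hz0 K]
  linarith [pow_nonneg hz0 K]

lemma sum_weighted_density_le {q : ℕ} (hq : 2 ≤ q) {G C₀ δ : ℝ} (hG : 0 ≤ G) {d : ℕ → ℝ}
    (hd0 : ∀ k, 0 ≤ d k) {L K : ℕ} (hLK : L ≤ K) (hδ : ∀ k < L, d k ≤ δ) (hC : ∀ k, d k ≤ C₀)
    (h1 : L * δ ≤ 1 / 16) (h2 : 2 * G * C₀ * (1 / (q : ℝ)) ^ L ≤ 1 / 16) :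
    ∑ k ∈ range K, (if k < L then 1 else 2 * G * (1 / (q : ℝ)) ^ (k + 1)) * d k ≤ 1 / 8 := by
  have hq2 : (2 : ℝ) ≤ q := by exact_mod_cast hq
  rw [← sum_range_add_sum_Ico _ hLK]
  have e1 : ∑ k ∈ range L, (if k < L then 1 else 2 * G * (1 / (q : ℝ)) ^ (k + 1)) * d k
      ≤ L * δ := by
    refine (sum_le_card_nsmul _ _ δ fun k hk => ?_).trans (by simp)
    rw [if_pos (mem_range.1 hk), one_mul]
    exact hδ k (mem_range.1 hk)
  have e2 : ∑ k ∈ Ico L K, (if k < L then 1 else 2 * G * (1 / (q : ℝ)) ^ (k + 1)) * d k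
      ≤ ∑ k ∈ Ico L K, 2 * G * C₀ * (1 / (q : ℝ)) ^ (k + 1) := by
    refine sum_le_sum fun k hk => ?_
    rw [if_neg (not_lt.2 (mem_Ico.1 hk).1)]
    calc _ ≤ 2 * G * (1 / (q : ℝ)) ^ (k + 1) * C₀ :=
        mul_le_mul_of_nonneg_left (hC k) (by positivity)
      _ = _ := by ring
  have hC0 : 0 ≤ C₀ := (hd0 0).trans (hC 0)
  have e3 := sum_geometric_tail_le (z := 1 / (q : ℝ)) (by positivity)
    (by rw [mul_one_div, div_le_one (by linarith)]; exact hq2) hLK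
  rw [← mul_sum] at e2
  have e4 := mul_le_mul_of_nonneg_left e3 (by positivity : 0 ≤ 2 * G * C₀)
  linarith

/-- The value of `∑ (k + 1) ^ 4 / 2 ^ (k + 1)`. -/
noncomputable def quarticSum : ℝ := ∑' k : ℕ, ((k : ℝ) + 1) ^ 4 * (1 / 2) ^ (k + 1)

lemma summable_quartic : Summable fun k : ℕ => ((k : ℝ) + 1) ^ 4 * (1 / 2 : ℝ) ^ (k + 1) := by
  have h := summable_pow_mul_geometric_of_norm_lt_one (R := ℝ) 4 (r := 1 / 2)
    (by rw [Real.norm_of_nonneg (by norm_num)]; norm_num)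
  simpa using (summable_nat_add_iff 1).2 h

lemma pow_mul_two_pow_le {D : ℕ} (hD : 122 ≤ D) : D ^ 121 * 2 ^ D ≤ 2 ^ D ^ 2 := by
  calc D ^ 121 * 2 ^ D ≤ (2 ^ D) ^ 121 * 2 ^ D := by gcongr; exact Nat.lt_two_pow_self.le
    _ = 2 ^ (D * 122) := by rw [← pow_mul, ← pow_add]; congr 1
    _ ≤ 2 ^ D ^ 2 := Nat.pow_le_pow_right (by norm_num) (by rw [sq]; gcongr)

lemma seventeen_mul_pow_add_le {D : ℕ} (hD : 122 ≤ D) :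
    17 * D ^ 24 + 2 + D ^ 2 < D ^ 30 := by
  have h1 : D ^ 30 = D ^ 6 * D ^ 24 := by ring
  have h2 : 122 ^ 6 ≤ D ^ 6 := Nat.pow_le_pow_left hD 6
  have h3 : 122 ^ 6 * D ^ 24 ≤ D ^ 30 := by rw [h1]; gcongr
  have h4 : D ^ 2 ≤ D ^ 24 := Nat.pow_le_pow_right (by omega) (by norm_num)
  have h5 : 1 ≤ D ^ 24 := Nat.one_le_pow _ _ (by omega)
  omega

lemma far_tail_le {q : ℕ} (hq : 2 ≤ q) {G : ℝ} (hG0 : 0 ≤ G) {L D M : ℕ}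
    (hG : G ≤ 5 * (q : ℝ) ^ L) (hLD : L ≤ D) (hD : 122 ≤ D) (hDq : 20 * quarticSum ≤ D)
    (hM : M ≤ 17 * D ^ 24) :
    ∑' k, G * biquadRep 4 (M + 1 + (k + D ^ 2)) * (1 / (q : ℝ)) ^ (k + D ^ 2 + 1) ≤ 1 / 4 := by
  have hq2 : (2 : ℝ) ≤ q := by exact_mod_cast hq
  have hq0 : (0 : ℝ) < q := by linarith
  have hLK : L ≤ D ^ 2 := hLD.trans (Nat.le_self_pow (by norm_num) D)
  have hDD : D ≤ D ^ 2 := Nat.le_self_pow (by norm_num) D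
  have hMD : ((M : ℝ) + 2 + D ^ 2) ≤ D ^ 30 := by
    have := seventeen_mul_pow_add_le hD
    exact_mod_cast (by omega : M + 2 + D ^ 2 ≤ D ^ 30)
  have hterm : ∀ k : ℕ, G * biquadRep 4 (M + 1 + (k + D ^ 2)) * (1 / (q : ℝ)) ^ (k + D ^ 2 + 1) ≤
      5 * (D : ℝ) ^ 120 * (1 / 2) ^ (D ^ 2 - D) * (((k : ℝ) + 1) ^ 4 * (1 / 2) ^ (k + 1)) := by
    intro k
    have h1 : (biquadRep 4 (M + 1 + (k + D ^ 2)) : ℝ) ≤ (D : ℝ) ^ 120 * ((k : ℝ) + 1) ^ 4 := by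
      have h2 : (biquadRep 4 (M + 1 + (k + D ^ 2)) : ℝ) ≤ ((M : ℝ) + 1 + (k + D ^ 2) + 1) ^ 4 := by
        exact_mod_cast biquadRep_le_pow 4 (M + 1 + (k + D ^ 2))
      refine h2.trans ?_
      calc ((M : ℝ) + 1 + (k + D ^ 2) + 1) ^ 4 ≤ (((M : ℝ) + 2 + D ^ 2) * (k + 1)) ^ 4 := by
            gcongr
            nlinarith [mul_nonneg (by positivity : (0 : ℝ) ≤ M + 1 + D ^ 2)
              (Nat.cast_nonneg k : (0 : ℝ) ≤ k)]
        _ ≤ ((D : ℝ) ^ 30 * (k + 1)) ^ 4 := by gcongr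
        _ = _ := by ring
    have h3 : (q : ℝ) ^ L * (1 / (q : ℝ)) ^ (k + D ^ 2 + 1) ≤
        (1 / 2) ^ (D ^ 2 - D) * (1 / 2) ^ (k + 1) := by
      have e : k + D ^ 2 + 1 = L + ((D ^ 2 - L) + (k + 1)) := by omega
      rw [e, pow_add (1 / (q : ℝ)) L, ← mul_assoc, ← mul_pow, mul_one_div_cancel hq0.ne', one_pow,
        one_mul, ← pow_add]
      have h4 : 1 / (q : ℝ) ≤ 1 / 2 := one_div_le_one_div_of_le (by norm_num) hq2
      calc (1 / (q : ℝ)) ^ (D ^ 2 - L + (k + 1)) ≤ (1 / 2) ^ (D ^ 2 - L + (k + 1)) := by gcongr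
        _ ≤ _ := pow_le_pow_of_le_one (by norm_num) (by norm_num) (by omega)
    calc _ ≤ (5 * (q : ℝ) ^ L) * ((D : ℝ) ^ 120 * ((k : ℝ) + 1) ^ 4) *
          (1 / (q : ℝ)) ^ (k + D ^ 2 + 1) := by gcongr
      _ = 5 * (D : ℝ) ^ 120 * ((k : ℝ) + 1) ^ 4 *
          ((q : ℝ) ^ L * (1 / (q : ℝ)) ^ (k + D ^ 2 + 1)) := by ring
      _ ≤ 5 * (D : ℝ) ^ 120 * ((k : ℝ) + 1) ^ 4 *
          ((1 / 2) ^ (D ^ 2 - D) * (1 / 2) ^ (k + 1)) := by gcongr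
      _ = _ := by ring
  have hs := summable_quartic.mul_left (5 * (D : ℝ) ^ 120 * (1 / 2) ^ (D ^ 2 - D))
  have h1 := (Summable.of_nonneg_of_le (fun k => by positivity) hterm hs).tsum_le_tsum hterm hs
  refine h1.trans ?_
  rw [tsum_mul_left, ← quarticSum]
  have h2 : (D : ℝ) ^ 121 * 2 ^ D ≤ 2 ^ D ^ 2 := by exact_mod_cast pow_mul_two_pow_le hD
  have h3 : (2 : ℝ) ^ D ^ 2 = 2 ^ (D ^ 2 - D) * 2 ^ D := by
    rw [← pow_add]; congr 1; omega
  have h4 : (D : ℝ) ^ 121 ≤ 2 ^ (D ^ 2 - D) := by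
    rw [h3] at h2
    exact le_of_mul_le_mul_right h2 (by positivity)
  calc 5 * (D : ℝ) ^ 120 * (1 / 2) ^ (D ^ 2 - D) * quarticSum
      = (D : ℝ) ^ 120 * (1 / 2) ^ (D ^ 2 - D) * (20 * quarticSum) / 4 := by ring
    _ ≤ (D : ℝ) ^ 120 * (1 / 2) ^ (D ^ 2 - D) * D / 4 := by gcongr
    _ = (D : ℝ) ^ 121 / 2 ^ (D ^ 2 - D) / 4 := by rw [one_div, inv_pow]; field_simp
    _ ≤ 1 / 4 := by
      gcongr
      exact (div_le_one (by positivity)).2 h4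

lemma hundred_mul_le {Q L D₁ D : ℕ} (hQ : 0 < Q) (hD : D = Q + L + D₁) (hD₁ : 122 ≤ D₁) :
    100 * (D ^ 2 + 3000 + D ^ 2 + Q) ≤ Q * D ^ 5 := by
  have h1 : 122 ≤ D := by omega
  have h2 : 122 ^ 3 ≤ D ^ 3 := Nat.pow_le_pow_left h1 3
  have h3 : D ^ 5 = D ^ 3 * D ^ 2 := by ring
  have h4 : 122 ^ 3 * D ^ 2 ≤ D ^ 5 := by rw [h3]; gcongr
  have h5 : D ≤ D ^ 2 := Nat.le_self_pow (by norm_num) D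
  have h6 : D ^ 5 ≤ Q * D ^ 5 := Nat.le_mul_of_pos_left _ hQ
  have h7 : 122 ^ 2 ≤ D ^ 2 := Nat.pow_le_pow_left h1 2
  omega

/-- There is a modulus `Q` of controlled size and a residue class `c` such that sums of four
fourth powers are rare in the classes of `c + 1, …, c + L`. -/
lemma exists_modulus : ∃ C : ℝ, ∀ (L : ℕ) (s : ℝ), 0 ≤ s → ∀ J : ℕ,
    8 * (L * (s + 1) + C) ≤ J → ∃ (Q : ℕ) (_ : NeZero Q) (c : ℕ), Q ≤ 4 ^ 4 ^ (J * 2 ^ J) ∧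
      (∀ k < L, (biquadCount Q (c + (k + 1) : ℕ) : ℝ) / Q ^ 3 ≤
        densityConst * Real.exp (-2 * s)) ∧
      ∀ k, (biquadCount Q (c + (k + 1) : ℕ) : ℝ) / Q ^ 3 ≤ densityConst := by
  classical
  have hu : IsUnit (5 : ZMod 8) := by decide
  obtain ⟨C, hC⟩ := sum_inv_primes_residue_lower hu
  refine ⟨C, fun L s hs J hJ => ?_⟩
  set P := (range (4 ^ (J * 2 ^ J) + 1)).filter (fun n : ℕ => n.Prime ∧ (n : ZMod 8) = 5) with hPdef
  have hP : ∀ p ∈ P, p.Prime ∧ p % 8 = 5 := by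
    intro p hp
    have h := (mem_filter.1 hp).2
    refine ⟨h.1, ?_⟩
    have h2 : ((p : ℕ) : ZMod 8) = ((5 : ℕ) : ZMod 8) := by simpa using h.2
    exact (ZMod.natCast_eq_natCast_iff p 5 8).1 h2
  have hsum : L * (s + 1) ≤ ∑ n ∈ P, (1 : ℝ) / n := by
    have h1 := hC J
    have h2 : (Nat.totient 8 : ℝ) = 4 := by
      have : Nat.totient 8 = 4 := by decide
      rw [this]; norm_num
    rw [h2] at h1
    linarith
  obtain ⟨T, hT, hd⟩ := exists_disjoint_of_le_sum P (fun n => (1 : ℝ) / n)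
    (fun n _ => by positivity)
    (fun n hn => by
      have : (1 : ℝ) ≤ n := by exact_mod_cast (hP n hn).1.one_le
      exact (div_le_one (by linarith)).2 this) hs L hsum
  obtain ⟨c, hc⟩ := exists_dvd_add L T (fun k hk p hp => (hP p ((hT k hk).1 hp)).1) hd
  have hQ0 : ∏ p ∈ P, p ≠ 0 := prod_ne_zero_iff.2 fun p hp => (hP p hp).1.ne_zero
  refine ⟨∏ p ∈ P, p, ⟨hQ0⟩, c, ?_, ?_, ?_⟩
  · refine le_trans ?_ (primorial_le_four_pow _)
    refine prod_le_prod_of_subset_of_one_le' (fun p hp => ?_) fun p hp _ => ?_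
    · exact mem_filter.2 ⟨(mem_filter.1 hp).1, (hP p hp).1⟩
    · exact (mem_filter.1 hp).2.one_le
  · intro k hk
    have : NeZero (∏ p ∈ P, p) := ⟨hQ0⟩
    refine (biquadCount_density_le P hP _ (T k) (hT k hk).1 (hc k hk) _ rfl).trans ?_
    have h1 := (hT k hk).2
    gcongr ?_ * Real.exp ?_
    · exact zero_le_one.trans one_le_densityConst
    · linarith
  · intro k
    have : NeZero (∏ p ∈ P, p) := ⟨hQ0⟩
    have h1 := biquadCount_density_le P hP (c + (k + 1)) ∅ (empty_subset _) (by simp) _ rfl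
    simpa using h1

lemma pow_thirty_lt_exp {Q J L D₁ D : ℕ} (hQ : 0 < Q) (hQJ : Q ≤ 4 ^ 4 ^ (J * 2 ^ J))
    (hD : D = Q + L + D₁) {V : ℝ} (hV : 2 + 2 * ((J : ℝ) + L + D₁ + 4) ≤ V) :
    (D : ℝ) ^ 30 ≤ Real.exp (Real.exp (Real.exp V)) := by
  have hJ : J * 2 ^ J ≤ 4 ^ J := by
    calc J * 2 ^ J ≤ 2 ^ J * 2 ^ J := by gcongr; exact Nat.lt_two_pow_self.le
      _ = 4 ^ J := by rw [← mul_pow]; norm_num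
  set y := 4 ^ 4 ^ J with hy
  have hy1 : 1 ≤ y := Nat.one_le_pow _ _ (by norm_num)
  have hQy : Q ≤ 4 ^ y := hQJ.trans
    (Nat.pow_le_pow_right (by norm_num) (Nat.pow_le_pow_right (by norm_num) hJ))
  have hlt (n : ℕ) : n + 1 ≤ 4 ^ n := Nat.lt_pow_self (by norm_num)
  have h1 : D ≤ 4 ^ (y + (L + D₁)) := by
    calc D ≤ Q * (L + D₁ + 1) := by rw [hD]; nlinarith
      _ ≤ 4 ^ y * 4 ^ (L + D₁) := Nat.mul_le_mul hQy (hlt _)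
      _ = _ := (pow_add _ _ _).symm
  have h2 : (y + (L + D₁)) * 30 ≤ 4 ^ 4 ^ (J + L + D₁ + 4) := by
    calc (y + (L + D₁)) * 30 ≤ (y * (L + D₁ + 1)) * 4 ^ 3 := by gcongr ?_ * ?_; nlinarith; norm_num
      _ ≤ (y * 4 ^ (L + D₁)) * 4 ^ 3 := by gcongr; exact hlt _
      _ = 4 ^ (4 ^ J + (L + D₁ + 3)) := by rw [hy, ← pow_add, ← pow_add]; ring_nf
      _ ≤ 4 ^ (4 ^ J * 4 ^ (L + D₁ + 3)) := by
        have h3 := hlt (L + D₁ + 3)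
        have h4 : 1 ≤ 4 ^ J := Nat.one_le_pow _ _ (by norm_num)
        exact Nat.pow_le_pow_right (by norm_num) (by nlinarith)
      _ ≤ _ := by
        rw [← pow_add]
        exact Nat.pow_le_pow_right (by norm_num) (Nat.pow_le_pow_right (by norm_num) (by omega))
  set U := J + L + D₁ + 4 with hU
  have h3 : D ^ 30 ≤ 4 ^ 4 ^ 4 ^ U := by
    calc D ^ 30 ≤ (4 ^ (y + (L + D₁))) ^ 30 := Nat.pow_le_pow_left h1 30
      _ = 4 ^ ((y + (L + D₁)) * 30) := (pow_mul _ _ _).symm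
      _ ≤ _ := Nat.pow_le_pow_right (by norm_num) h2
  have h4e : (4 : ℝ) ≤ Real.exp 2 := by
    have := Real.add_one_le_exp (1 : ℝ)
    have h : Real.exp 2 = Real.exp 1 * Real.exp 1 := by rw [← Real.exp_add]; norm_num
    rw [h]; nlinarith
  have hpow (n : ℕ) : (4 : ℝ) ^ n ≤ Real.exp (2 * n) := by
    calc (4 : ℝ) ^ n ≤ Real.exp 2 ^ n := by gcongr
      _ = _ := by rw [← Real.exp_nat_mul]; ring_nf
  have h2e (x : ℝ) : 2 * Real.exp x ≤ Real.exp (1 + x) := by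
    rw [Real.exp_add]
    have := Real.add_one_le_exp (1 : ℝ)
    nlinarith [Real.exp_pos x]
  have s1 : (2 : ℝ) * ((4 ^ U : ℕ) : ℝ) ≤ Real.exp (1 + 2 * U) := by
    have := hpow U
    push_cast
    exact (mul_le_mul_of_nonneg_left this (by norm_num)).trans (h2e _)
  have s2 : (2 : ℝ) * ((4 ^ 4 ^ U : ℕ) : ℝ) ≤ Real.exp (Real.exp V) := by
    have h5 := hpow (4 ^ U)
    have h6 : (2 : ℝ) * ((4 ^ 4 ^ U : ℕ) : ℝ) ≤ 2 * Real.exp (2 * ((4 ^ U : ℕ) : ℝ)) := by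
      rw [Nat.cast_pow]
      exact mul_le_mul_of_nonneg_left (by exact_mod_cast h5) (by norm_num)
    refine h6.trans ((h2e _).trans (Real.exp_le_exp.2 ?_))
    have h7 : (1 : ℝ) ≤ Real.exp (1 + 2 * U) := Real.one_le_exp (by positivity)
    calc 1 + 2 * ((4 ^ U : ℕ) : ℝ) ≤ 2 * Real.exp (1 + 2 * U) := by linarith
      _ ≤ Real.exp (1 + (1 + 2 * U)) := h2e _
      _ ≤ Real.exp V := Real.exp_le_exp.2 (by rw [hU]; push_cast; linarith)
  have h8 := hpow (4 ^ 4 ^ U)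
  have h9 : (D : ℝ) ^ 30 ≤ 4 ^ 4 ^ 4 ^ U := by exact_mod_cast h3
  exact h9.trans (h8.trans (Real.exp_le_exp.2 s2))

/-- The lower bound in terms of an auxiliary parameter `D`. -/
lemma lower_bound_of_modulus {q : ℕ} (hq : 2 ≤ q) {G S : ℝ} {a : ℕ → ℤ} (hG0 : 0 ≤ G)
    (hS : HasSum (fun n => (a n : ℝ) * (1 / (q : ℝ)) ^ n) S)
    (ha : ∀ n, |(a n : ℝ)| ≤ G * biquadRep 4 n)
    (ha' : ∀ n, biquadRep 3 n = 0 → (biquadRep 4 n : ℤ) ≤ a n)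
    {Q : ℕ} [NeZero Q] {c L D₁ D : ℕ} {δ : ℝ} (hD : D = Q + L + D₁) (hD₁ : 122 ≤ D₁)
    (hD₁' : 20 * quarticSum ≤ D₁)
    (hδ : ∀ k < L, (biquadCount Q (c + (k + 1) : ℕ) : ℝ) / Q ^ 3 ≤ δ)
    (hC : ∀ k, (biquadCount Q (c + (k + 1) : ℕ) : ℝ) / Q ^ 3 ≤ densityConst)
    (h1 : L * δ ≤ 1 / 16) (h2 : 2 * G * densityConst * (1 / (q : ℝ)) ^ L ≤ 1 / 16)
    (hG : G ≤ 5 * (q : ℝ) ^ L) :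
    (1 / (q : ℝ)) ^ (17 * D ^ 24 + 2) ≤ |S| := by
  have hq2 : (2 : ℝ) ≤ q := by exact_mod_cast hq
  have hQ : 0 < Q := NeZero.pos Q
  have hLK : L ≤ D ^ 2 := (by omega : L ≤ D).trans (Nat.le_self_pow (by norm_num) D)
  have hX : 17 * (Q * D ^ 5) ^ 4 ≤ 17 * D ^ 24 := by
    have : Q ^ 4 ≤ D ^ 4 := Nat.pow_le_pow_left (by omega) 4
    calc 17 * (Q * D ^ 5) ^ 4 = 17 * (Q ^ 4 * D ^ 20) := by ring
      _ ≤ 17 * (D ^ 4 * D ^ 20) := by gcongr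
      _ = _ := by ring
  have hDq : 20 * quarticSum ≤ D := by
    have : (D₁ : ℝ) ≤ D := by exact_mod_cast (by omega : D₁ ≤ D)
    linarith
  have h := lower_bound_of_density hG0 hq hS ha ha' (hundred_mul_le hQ hD hD₁)
    (sum_weighted_density_le hq hG0 (fun k => by positivity) hLK hδ hC h1 h2)
    (fun M hM => far_tail_le hq hG0 hG (by omega) (by omega) hDq (hM.trans hX))
  refine le_trans ?_ h
  have hz1 : 1 / (q : ℝ) ≤ 1 / 2 := one_div_le_one_div_of_le (by norm_num) hq2
  have hz0 : 0 ≤ 1 / (q : ℝ) := by positivity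
  rw [pow_add]
  have e1 : (1 / (q : ℝ)) ^ (17 * D ^ 24) ≤ (1 / (q : ℝ)) ^ (17 * (Q * D ^ 5) ^ 4) :=
    pow_le_pow_of_le_one hz0 (by linarith) hX
  have e2 : (1 / (q : ℝ)) ^ 2 ≤ 1 / 4 := by
    calc (1 / (q : ℝ)) ^ 2 ≤ (1 / 2) ^ 2 := by gcongr
      _ = 1 / 4 := by norm_num
  calc _ ≤ (1 / (q : ℝ)) ^ (17 * (Q * D ^ 5) ^ 4) * (1 / 4) := by gcongr
    _ = _ := by ring

/-- The parameters `L`, `s`, `J` needed for coefficients of size `q ^ A` are `O (A log A)`. -/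
lemma exists_parameters (C : ℝ) (D₁ : ℕ) : ∃ c₄ : ℝ, 0 < c₄ ∧ ∀ A : ℝ, 1.1 < A →
    ∃ (L J : ℕ) (s : ℝ), 0 ≤ s ∧ 8 * (L * (s + 1) + C) ≤ J ∧ A ≤ L ∧
      160 * densityConst ≤ 2 ^ (L - A) ∧ L * (densityConst * Real.exp (-2 * s)) ≤ 1 / 16 ∧
      2 + 2 * ((J : ℝ) + L + D₁ + 4) ≤ c₄ * A * Real.log A := by
  have hC0 := one_le_densityConst
  obtain ⟨C₁, hC₁⟩ := pow_unbounded_of_one_lt (160 * densityConst) (one_lt_two : (1 : ℝ) < 2)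
  set b : ℝ := 2 + C₁ with hb
  have hb2 : 2 ≤ b := by rw [hb]; linarith [(Nat.cast_nonneg C₁ : (0 : ℝ) ≤ C₁)]
  set lam := Real.log 1.1 with hlam
  have hlam0 : 0 < lam := Real.log_pos (by norm_num)
  set κ := lam⁻¹ with hκ
  have hκ0 : 0 < κ := inv_pos.2 hlam0
  set e : ℝ := Real.log (16 * densityConst * b) / 2 + 1 with he
  have he0 : 0 ≤ e := by
    have : 0 ≤ Real.log (16 * densityConst * b) := Real.log_nonneg (by nlinarith)
    rw [he]; linarith
  refine ⟨16 * (b * (1 / 2 + e * κ)) + κ * (2 * b + (16 * |C| + 2 * D₁ + 12)), by positivity,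
    fun A hA => ?_⟩
  have hA1 : 1 ≤ A := by linarith
  have hlogA : lam ≤ Real.log A := Real.log_le_log (by norm_num) hA.le
  have hκA : 1 ≤ κ * Real.log A := by
    rw [hκ, inv_mul_eq_div]; exact (one_le_div hlam0).2 hlogA
  set L := ⌈A⌉₊ + C₁ with hL
  have hceil1 : A ≤ ⌈A⌉₊ := Nat.le_ceil A
  have hceil2 : (⌈A⌉₊ : ℝ) < A + 1 := Nat.ceil_lt_add_one (by linarith)
  have hLc : (L : ℝ) = ⌈A⌉₊ + C₁ := by rw [hL]; push_cast; rfl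
  have hLA : A + C₁ ≤ L := by rw [hLc]; linarith
  have hC₁0 : (0 : ℝ) ≤ C₁ := Nat.cast_nonneg _
  have hLb : (L : ℝ) ≤ A * b := by rw [hLc, hb]; nlinarith
  have hL1 : (1 : ℝ) ≤ L := by linarith
  set s := Real.log (16 * (L * densityConst)) / 2 with hs
  have hLC : 1 ≤ L * densityConst := by nlinarith
  have hs0 : 0 ≤ s := by
    have : 0 ≤ Real.log (16 * (L * densityConst)) := Real.log_nonneg (by linarith)
    rw [hs]; linarith
  have hse : s + 1 ≤ Real.log A / 2 + e := by
    have h1 : Real.log (16 * (L * densityConst)) ≤ Real.log (A * (16 * densityConst * b)) :=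
      Real.log_le_log (by linarith) (by nlinarith)
    have h2 : Real.log (A * (16 * densityConst * b)) =
        Real.log A + Real.log (16 * densityConst * b) :=
      Real.log_mul (by linarith) (by nlinarith)
    rw [h2] at h1
    rw [hs, he]; linarith
  have hnn : 0 ≤ 8 * (L * (s + 1) + |C|) := by positivity
  refine ⟨L, ⌈8 * (L * (s + 1) + |C|)⌉₊, s, hs0, ?_, by linarith, ?_, ?_, ?_⟩
  · exact le_trans (by gcongr; exact le_abs_self C) (Nat.le_ceil _)
  · refine hC₁.le.trans ?_
    rw [← Real.rpow_natCast]
    exact Real.rpow_le_rpow_of_exponent_le (by norm_num) (by linarith)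
  · have h1 : Real.exp (-2 * s) = (16 * (L * densityConst))⁻¹ := by
      rw [show -2 * s = -Real.log (16 * (L * densityConst)) by rw [hs]; ring, Real.exp_neg,
        Real.exp_log (by linarith)]
    rw [h1]
    have : (L : ℝ) * densityConst ≠ 0 := by linarith
    apply le_of_eq
    field_simp
  · have hJ := Nat.ceil_lt_add_one hnn
    have h1 : (L : ℝ) * (s + 1) ≤ b * (1 / 2 + e * κ) * (A * Real.log A) := by
      calc (L : ℝ) * (s + 1) ≤ A * b * (Real.log A / 2 + e * (κ * Real.log A)) :=
            mul_le_mul hLb (hse.trans (by linarith [le_mul_of_one_le_right he0 hκA]))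
              (by linarith) (by positivity)
        _ = _ := by ring
    have h2 : (1 : ℝ) ≤ κ * (A * Real.log A) := by nlinarith
    have h3 : (L : ℝ) ≤ κ * b * (A * Real.log A) := by
      calc (L : ℝ) ≤ A * b * 1 := by linarith
        _ ≤ A * b * (κ * Real.log A) := by gcongr
        _ = _ := by ring
    have h4 : 16 * |C| + 2 * (D₁ : ℝ) + 12 ≤
        (16 * |C| + 2 * D₁ + 12) * (κ * (A * Real.log A)) :=
      le_mul_of_one_le_right (by positivity) h2
    have e1 : (16 * (b * (1 / 2 + e * κ)) + κ * (2 * b + (16 * |C| + 2 * D₁ + 12))) * A *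
        Real.log A = 16 * (b * (1 / 2 + e * κ) * (A * Real.log A)) +
          2 * (κ * b * (A * Real.log A)) +
          (16 * |C| + 2 * D₁ + 12) * (κ * (A * Real.log A)) := by ring
    rw [e1]
    linarith

/-- Lower bound for a quartic polynomial in `theta4 q` with positive leading coefficient, in terms
of the parameters of `exists_parameters`. -/
lemma quartic_lower_bound {q : ℕ} (hq : 2 ≤ q) {A : ℝ} {α : ℕ → ℤ}
    (hα : ∀ j, |(α j : ℝ)| ≤ (q : ℝ) ^ A) (hpos : 0 < α 4)
    {Q : ℕ} [NeZero Q] {c L D₁ D : ℕ} {δ : ℝ} (hD : D = Q + L + D₁) (hD₁ : 122 ≤ D₁)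
    (hD₁' : 20 * quarticSum ≤ D₁)
    (hδ : ∀ k < L, (biquadCount Q (c + (k + 1) : ℕ) : ℝ) / Q ^ 3 ≤ δ)
    (hC : ∀ k, (biquadCount Q (c + (k + 1) : ℕ) : ℝ) / Q ^ 3 ≤ densityConst)
    (h1 : L * δ ≤ 1 / 16) (hAL : A ≤ L) (h2 : 160 * densityConst ≤ 2 ^ (L - A)) :
    (1 / (q : ℝ)) ^ (17 * D ^ 24 + 2) ≤ |∑ j ∈ range 5, (α j : ℝ) * theta4 q ^ j| := by
  have hq2 : (2 : ℝ) ≤ q := by exact_mod_cast hq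
  have hq0 : (0 : ℝ) < q := by linarith
  have hmono (j n : ℕ) (hj : j ≤ 4) : (biquadRep j n : ℝ) ≤ biquadRep 4 n := by
    exact_mod_cast biquadRep_mono n hj
  refine lower_bound_of_modulus hq (G := 5 * (q : ℝ) ^ A)
    (a := fun n => ∑ j ∈ range 5, α j * biquadRep j n) (by positivity) ?_ ?_ ?_
    hD hD₁ hD₁' hδ hC h1 ?_ ?_
  · have h := hasSum_sum (s := range 5) fun j _ => (hasSum_biquadRep hq j).mul_left (α j : ℝ)
    refine h.congr_fun fun x => ?_
    push_cast
    rw [sum_mul]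
    exact sum_congr rfl fun j _ => by ring
  · intro n
    push_cast
    refine (abs_sum_le_sum_abs _ _).trans ?_
    refine (sum_le_card_nsmul _ _ ((q : ℝ) ^ A * biquadRep 4 n) fun j hj => ?_).trans
      (le_of_eq (by simp; ring))
    rw [abs_mul, Nat.abs_cast]
    have := mem_range.1 hj
    exact mul_le_mul (hα j) (hmono j n (by omega)) (by positivity) (by positivity)
  · intro n hn
    rw [sum_range_succ, sum_eq_zero, zero_add]
    · have : (0 : ℤ) ≤ biquadRep 4 n := Int.natCast_nonneg _
      nlinarith
    · intro j hj
      have h3 : biquadRep j n ≤ biquadRep 3 n :=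
        biquadRep_mono n (by have := mem_range.1 hj; omega)
      have h5 : biquadRep j n = 0 := by omega
      rw [h5]; simp
  · have h3 : (q : ℝ) ^ A * (1 / (q : ℝ)) ^ L * 2 ^ (L - A) ≤ 1 := by
      have h4 : (2 : ℝ) ^ (L - A) ≤ (q : ℝ) ^ (L - A) :=
        Real.rpow_le_rpow (by norm_num) hq2 (by linarith)
      calc (q : ℝ) ^ A * (1 / (q : ℝ)) ^ L * 2 ^ (L - A)
          ≤ (q : ℝ) ^ A * (1 / (q : ℝ)) ^ L * (q : ℝ) ^ (L - A) := by gcongr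
        _ = 1 := by
          rw [Real.rpow_sub hq0, Real.rpow_natCast, one_div, inv_pow]
          field_simp
    have h5 : 0 ≤ (q : ℝ) ^ A * (1 / (q : ℝ)) ^ L := by positivity
    nlinarith [mul_le_mul_of_nonneg_left h2 h5]
  · rw [← Real.rpow_natCast]
    gcongr
    linarith

/-- Measure of linear independence for `1, θ₄(q), θ₄(q)², θ₄(q)³, θ₄(q)⁴`. -/
theorem theta4_linear_independence_measure :
    ∃ c₄ : ℝ, 0 < c₄ ∧
      ∀ q : ℕ, 2 ≤ q → ∀ A : ℝ, 1.1 < A →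
        ∀ α₀ α₁ α₂ α₃ α₄ : ℤ,
          (|(α₀ : ℝ)| ≤ (q : ℝ) ^ A) → (|(α₁ : ℝ)| ≤ (q : ℝ) ^ A) →
          (|(α₂ : ℝ)| ≤ (q : ℝ) ^ A) → (|(α₃ : ℝ)| ≤ (q : ℝ) ^ A) →
          (|(α₄ : ℝ)| ≤ (q : ℝ) ^ A) →
          α₄ ≠ 0 →
          Real.exp (-(Real.log q *
              Real.exp (Real.exp (Real.exp (c₄ * A * Real.log A))))) <
            |(α₀ : ℝ) + (α₁ : ℝ) * theta4 q + (α₂ : ℝ) * theta4 q ^ 2 +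
              (α₃ : ℝ) * theta4 q ^ 3 + (α₄ : ℝ) * theta4 q ^ 4| := by
  obtain ⟨C, hmod⟩ := exists_modulus
  set D₁ := max 122 ⌈20 * quarticSum⌉₊ with hD₁
  have hD₁' : 20 * quarticSum ≤ D₁ :=
    (Nat.le_ceil _).trans (by exact_mod_cast le_max_right _ _)
  obtain ⟨c₄, hc₄, hpar⟩ := exists_parameters C D₁
  refine ⟨c₄, hc₄, fun q hq A hA α₀ α₁ α₂ α₃ α₄ h₀ h₁ h₂ h₃ h₄ hne => ?_⟩
  obtain ⟨L, J, s, hs, hJ, hAL, h2L, hLs, hV⟩ := hpar A hA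
  obtain ⟨Q, _, c, hQJ, hδ, hCd⟩ := hmod L s hs J hJ
  have hq1 : (1 : ℝ) < q := by exact_mod_cast (by omega : 1 < q)
  have hq0 : (0 : ℝ) < q := by linarith
  have hD := pow_thirty_lt_exp (NeZero.pos Q) hQJ (rfl : Q + L + D₁ = _) hV
  have h122 : 122 ≤ D₁ := le_max_left _ _
  have hlarge := seventeen_mul_pow_add_le (by omega : 122 ≤ Q + L + D₁)
  have key : ∀ α : ℕ → ℤ, (∀ j, |(α j : ℝ)| ≤ (q : ℝ) ^ A) → 0 < α 4 →
      (1 / (q : ℝ)) ^ (17 * (Q + L + D₁) ^ 24 + 2) ≤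
        |∑ j ∈ range 5, (α j : ℝ) * theta4 q ^ j| := fun α hα hpos =>
    quartic_lower_bound hq hα hpos rfl h122 hD₁' hδ hCd hLs hAL h2L
  set D := Q + L + D₁
  have hlt : Real.exp (-(Real.log q * Real.exp (Real.exp (Real.exp (c₄ * A * Real.log A))))) <
      (1 / (q : ℝ)) ^ (17 * D ^ 24 + 2) := by
    have h5 : (1 / (q : ℝ)) ^ (17 * D ^ 24 + 2) =
        Real.exp (-(Real.log q * ((17 * D ^ 24 + 2 : ℕ) : ℝ))) := by
      rw [one_div, inv_pow, Real.exp_neg, mul_comm (Real.log (q : ℝ)), Real.exp_nat_mul,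
        Real.exp_log hq0]
    rw [h5, Real.exp_lt_exp, neg_lt_neg_iff]
    refine mul_lt_mul_of_pos_left (lt_of_lt_of_le ?_ hD) (Real.log_pos hq1)
    exact_mod_cast (by omega : 17 * D ^ 24 + 2 < D ^ 30)
  refine hlt.trans_le ?_
  let α : ℕ → ℤ := fun j => match j with
    | 0 => α₀ | 1 => α₁ | 2 => α₂ | 3 => α₃ | 4 => α₄ | _ => 0
  have hα : ∀ j, |(α j : ℝ)| ≤ (q : ℝ) ^ A := by
    intro j
    match j with
    | 0 => exact h₀
    | 1 => exact h₁
    | 2 => exact h₂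
    | 3 => exact h₃
    | 4 => exact h₄
    | _ + 5 => simp only [α, Int.cast_zero, abs_zero]; positivity
  have hsum : ∑ j ∈ range 5, (α j : ℝ) * theta4 q ^ j = (α₀ : ℝ) + (α₁ : ℝ) * theta4 q +
      (α₂ : ℝ) * theta4 q ^ 2 + (α₃ : ℝ) * theta4 q ^ 3 + (α₄ : ℝ) * theta4 q ^ 4 := by
    simp [sum_range_succ, α]
  rw [← hsum]
  rcases lt_or_gt_of_ne hne with h | h
  · have h6 := key (fun j => -α j) (fun j => by simpa using hα j) (by simpa [α] using h)
    rw [← abs_neg, ← sum_neg_distrib]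
    refine h6.trans (le_of_eq ?_)
    congr 1
    refine sum_congr rfl fun j _ => ?_
    push_cast; ring
  · exact key α hα h
end
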